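/- Let u and ũ be smooth global solutions for t ≥ 0 of the semilinear system □u^I = Q^I(u,∂u) (I = 1,…,N) with smooth compactly supported initial data, where Q satisfies the null condition, and assume u and ũ admit radiation fields F₀ and F̃₀ in the stated sense. Let R₁ > 0 and R₂ ∈ ℝ with R₂ ≤ −R₁. If (u,∂_t u)|_{t=0}(x) = (ũ,∂_t ũ)|_{t=0}(x) for all |x| ≥ R₁, and F₀(q,ω) = F̃₀(q,ω) for all q > R₂ and all ω ∈ S², then u = ũ everywhere on {t ≥ 0}. -/

import Mathlib

noncomputable section
open MeasureTheory Real Set Filter Topology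

namespace UCP

/-- Spacetime `ℝ^{1+3}`: a point is `(t, x)` with `x ∈ ℝ³`. -/
abbrev Spc : Type := ℝ × EuclideanSpace ℝ (Fin 3)

/-- Coordinate directions `e_α`, `α = 0,1,2,3` (`e_0` is the time direction). -/
def eVec (α : Fin 4) : Spc :=
  Fin.cases ((1 : ℝ), (0 : EuclideanSpace ℝ (Fin 3)))
    (fun i => ((0 : ℝ), EuclideanSpace.single i (1 : ℝ))) α

/-- The partial derivative `∂_α u`. -/
def pd (α : Fin 4) (u : Spc → ℝ) (p : Spc) : ℝ := fderiv ℝ u p (eVec α)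

/-- `∂_t u`. -/
def dt (u : Spc → ℝ) : Spc → ℝ := pd 0 u

/-- `∂_i u`, `i = 1,2,3`. -/
def dxi (i : Fin 3) (u : Spc → ℝ) : Spc → ℝ := pd i.succ u

/-- The d'Alembertian `□u = -∂_t² u + Δ_x u`. -/
def box (u : Spc → ℝ) (p : Spc) : ℝ :=
  - dt (dt u) p + ∑ i : Fin 3, dxi i (dxi i u) p

/-- Signs of the Minkowski metric `diag(-1,1,1,1)`, so that `∂^α = eta α • ∂_α`. -/
def eta (α : Fin 4) : ℝ := if α = 0 then -1 else 1

/-- `r = |x|`. -/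
def rr (p : Spc) : ℝ := ‖p.2‖

/-- The radial derivative `∂_r u = Σ_i (x_i/r) ∂_i u`. -/
def dr (u : Spc → ℝ) (p : Spc) : ℝ := ∑ i : Fin 3, (p.2 i / rr p) * dxi i u p

/-- `ω̂ = (-1, x/r)` as a `Fin 4`-indexed family. -/
def hatom (p : Spc) (α : Fin 4) : ℝ := Fin.cases (-1 : ℝ) (fun i => p.2 i / rr p) α

/-- The scaling field `S = t∂_t + r∂_r`. -/
def Sc (u : Spc → ℝ) (p : Spc) : ℝ := p.1 * dt u p + ∑ i : Fin 3, p.2 i * dxi i u p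

/-- The rotations `Ω_{ij} = x_i∂_j - x_j∂_i`. -/
def Rot (i j : Fin 3) (u : Spc → ℝ) (p : Spc) : ℝ := p.2 i * dxi j u p - p.2 j * dxi i u p

/-- The Lorentz boosts `Ω_{0i} = x_i∂_t + t∂_i`. -/
def Lor (i : Fin 3) (u : Spc → ℝ) (p : Spc) : ℝ := p.2 i * dt u p + p.1 * dxi i u p

/-- The eleven commuting vector fields `Z`: the four translations, the scaling, the
three rotations and the three Lorentz boosts. -/
def ZList : List ((Spc → ℝ) → Spc → ℝ) :=
  [pd 0, pd 1, pd 2, pd 3, Sc, Rot 0 1, Rot 0 2, Rot 1 2, Lor 0, Lor 1, Lor 2]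

/-- `Σ_{|I| ≤ 1} |Z^I g| = |g| + Σ_Z |Zg|` at a point. -/
def Z1sum (g : Spc → ℝ) (p : Spc) : ℝ := |g p| + (ZList.map fun Z => |Z g p|).sum

/-- `u - r⁻¹ F₀(r - t, x/r)`, componentwise. -/
def radProfile {N : ℕ} (u : Fin N → Spc → ℝ)
    (F : ℝ → EuclideanSpace ℝ (Fin 3) → Fin N → ℝ) (I : Fin N) (p : Spc) : ℝ :=
  u I p - (rr p)⁻¹ * F (rr p - p.1) ((rr p)⁻¹ • p.2) I

/-- `F` is the radiation field of `u`: it is `C¹`, it is the limit of `r u(r-q, rω)`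
as `r → ∞`, and `Σ_{|I|≤1} |Z^I (u - r⁻¹F(r-t,ω))| ≤ C t⁻² ⟨r-t⟩` for `r > t/2 ≥ c`. -/
def IsRadiationField {N : ℕ} (u : Fin N → Spc → ℝ)
    (F : ℝ → EuclideanSpace ℝ (Fin 3) → Fin N → ℝ) : Prop :=
  (ContDiff ℝ 1 fun z : ℝ × EuclideanSpace ℝ (Fin 3) => F z.1 z.2) ∧
  (∀ (q : ℝ) (ω : EuclideanSpace ℝ (Fin 3)), ‖ω‖ = 1 → ∀ I,
    Filter.Tendsto (fun ρ : ℝ => ρ * u I (ρ - q, ρ • ω)) Filter.atTop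
      (nhds (F q ω I))) ∧
  (∃ C c : ℝ, 0 < C ∧ 0 < c ∧ ∀ p : Spc, c ≤ p.1 / 2 → p.1 / 2 < rr p →
    (∑ I, Z1sum (radProfile u F I) p)
      ≤ C * (p.1 ^ 2)⁻¹ * Real.sqrt (1 + (rr p - p.1) ^ 2))

/-- `ω̂ = (-1, ω)` for a unit vector `ω ∈ 𝕊²`. -/
def hatSph (ω : EuclideanSpace ℝ (Fin 3)) (α : Fin 4) : ℝ :=
  Fin.cases (-1 : ℝ) (fun i => ω i) α

/-- `Q` is smooth, has the quadratic Taylor expansion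
`Q^I(u,v) = Σ_{J,K,α,β} A_{I,JK}^{αβ} v_α^J v_β^K + O((|u|+|v|)³)` near `0`, and the
coefficients `A` satisfy the null condition `A_{I,JK}^{αβ} ω̂_α ω̂_β = 0`. -/
def HasNullForm {N : ℕ} (Q : ((Fin N → ℝ) × (Fin N → Fin 4 → ℝ)) → Fin N → ℝ)
    (A : Fin N → Fin N → Fin N → Fin 4 → Fin 4 → ℝ) : Prop :=
  ContDiff ℝ (⊤ : ℕ∞) Q ∧
  (∃ C ε : ℝ, 0 < C ∧ 0 < ε ∧ ∀ z : (Fin N → ℝ) × (Fin N → Fin 4 → ℝ),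
    ‖z.1‖ + ‖z.2‖ ≤ ε → ∀ I,
    |Q z I - ∑ J : Fin N, ∑ K : Fin N, ∑ α : Fin 4, ∑ β : Fin 4,
        A I J K α β * z.2 J α * z.2 K β|
      ≤ C * (‖z.1‖ + ‖z.2‖) ^ 3) ∧
  (∀ I J K, ∀ ω : EuclideanSpace ℝ (Fin 3), ‖ω‖ = 1 →
    (∑ α : Fin 4, ∑ β : Fin 4, A I J K α β * hatSph ω α * hatSph ω β) = 0)

/-- `u` is a smooth solution of `□u^I = Q^I(u, ∂u)` for `t ≥ 0` with smooth compactly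
supported initial data at `t = 0`. -/
def IsGlobalSolution {N : ℕ} (Q : ((Fin N → ℝ) × (Fin N → Fin 4 → ℝ)) → Fin N → ℝ)
    (u : Fin N → Spc → ℝ) : Prop :=
  (∀ I, ContDiff ℝ (⊤ : ℕ∞) (u I)) ∧
  (∀ I, HasCompactSupport fun x : EuclideanSpace ℝ (Fin 3) => u I (0, x)) ∧
  (∀ I, HasCompactSupport fun x : EuclideanSpace ℝ (Fin 3) => dt (u I) (0, x)) ∧
  (∀ p : Spc, 0 ≤ p.1 → ∀ I,
    box (u I) p = Q (fun J => u J p, fun J α => pd α (u J) p) I)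

section
/-! ### Coordinate calculus -/

/-- The coordinate functions. -/
def co (α : Fin 4) (p : Spc) : ℝ := Fin.cases p.1 (fun i => p.2 i) α

@[simp] lemma co_zero (p : Spc) : co 0 p = p.1 := rfl
@[simp] lemma co_succ (i : Fin 3) (p : Spc) : co i.succ p = p.2 i := rfl
lemma co_one (p : Spc) : co 1 p = p.2 0 := rfl
lemma co_two (p : Spc) : co 2 p = p.2 1 := rfl
lemma co_three (p : Spc) : co 3 p = p.2 2 := rfl

/-- coordinate as a linear map -/
def coL (α : Fin 4) : Spc →L[ℝ] ℝ :=
  Fin.cases (ContinuousLinearMap.fst ℝ ℝ (EuclideanSpace ℝ (Fin 3)))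
    (fun i => (EuclideanSpace.proj i).comp
      (ContinuousLinearMap.snd ℝ ℝ (EuclideanSpace ℝ (Fin 3)))) α

lemma coL_apply (α : Fin 4) (p : Spc) : coL α p = co α p := by
  refine Fin.cases ?_ (fun i => ?_) α <;> simp [coL]

lemma co_eq (α : Fin 4) : co α = fun p => coL α p := by
  funext p; rw [coL_apply]

lemma co_eVec (α β : Fin 4) : co α (eVec β) = if α = β then 1 else 0 := by
  fin_cases α <;> fin_cases β <;> simp [co, eVec, Fin.cases, Fin.induction, Fin.induction.go]

lemma co_add (α : Fin 4) (p q : Spc) : co α (p + q) = co α p + co α q := by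
  simp [← coL_apply]
lemma co_sub (α : Fin 4) (p q : Spc) : co α (p - q) = co α p - co α q := by
  simp [← coL_apply]
lemma co_smul (α : Fin 4) (c : ℝ) (p : Spc) : co α (c • p) = c * co α p := by
  simp [← coL_apply]

lemma spc_ext {p q : Spc} (h : ∀ α, co α p = co α q) : p = q := by
  refine Prod.ext (h 0) ?_
  ext i; exact h i.succ

lemma spc_sum (p : Spc) : p = ∑ α, co α p • eVec α := by
  apply spc_ext
  intro β
  rw [← coL_apply β (∑ α, _), map_sum]
  simp [coL_apply, co_eVec]

lemma contDiff_co {n : WithTop ℕ∞} (α : Fin 4) : ContDiff ℝ n (co α) := by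
  rw [co_eq]; exact (coL α).contDiff

lemma continuous_co (α : Fin 4) : Continuous (co α) := (contDiff_co (n := 0) α).continuous

/-- `f` is differentiable at `p` with partial derivatives `d`. -/
def HasPD (f : Spc → ℝ) (d : Fin 4 → ℝ) (p : Spc) : Prop :=
  DifferentiableAt ℝ f p ∧ ∀ α, pd α f p = d α

lemma HasPD.pd {f : Spc → ℝ} {d : Fin 4 → ℝ} {p : Spc} (h : HasPD f d p) (α : Fin 4) :
    pd α f p = d α := h.2 α

lemma hasPD_of_diff {f : Spc → ℝ} {p : Spc} (h : DifferentiableAt ℝ f p) :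
    HasPD f (fun α => UCP.pd α f p) p := ⟨h, fun _ => rfl⟩

lemma HasPD.of_hasFDerivAt {f : Spc → ℝ} {p : Spc} {L : Spc →L[ℝ] ℝ} (h : HasFDerivAt f L p) :
    HasPD f (fun α => L (eVec α)) p := ⟨h.differentiableAt, fun α => by
      rw [UCP.pd, h.fderiv]⟩

lemma HasPD.congr_d {f : Spc → ℝ} {d d' : Fin 4 → ℝ} {p : Spc} (h : HasPD f d p)
    (hd : ∀ α, d α = d' α) : HasPD f d' p := ⟨h.1, fun α => (h.2 α).trans (hd α)⟩

lemma HasPD.congr_f {f g : Spc → ℝ} {d : Fin 4 → ℝ} {p : Spc} (h : HasPD f d p)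
    (hd : g =ᶠ[𝓝 p] f) : HasPD g d p :=
  ⟨h.1.congr_of_eventuallyEq hd, fun α => by rw [UCP.pd, hd.fderiv_eq]; exact h.2 α⟩

lemma pd_congr {f g : Spc → ℝ} {p : Spc} (h : f =ᶠ[𝓝 p] g) (α : Fin 4) :
    pd α f p = pd α g p := by
  rw [UCP.pd, UCP.pd, h.fderiv_eq]

lemma pd_eventually_congr {f g : Spc → ℝ} {p : Spc} (h : f =ᶠ[𝓝 p] g) (α : Fin 4) :
    pd α f =ᶠ[𝓝 p] pd α g := by
  filter_upwards [h.eventuallyEq_nhds] with q hq using pd_congr hq α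

lemma hasPD_const (c : ℝ) (p : Spc) : HasPD (fun _ => c) (fun _ => 0) p :=
  HasPD.of_hasFDerivAt (hasFDerivAt_const c p)

lemma hasPD_co (α : Fin 4) (p : Spc) : HasPD (co α) (fun β => if α = β then 1 else 0) p := by
  have := HasPD.of_hasFDerivAt (p := p) (coL α).hasFDerivAt
  rw [co_eq]
  refine this.congr_d fun β => ?_
  rw [coL_apply, co_eVec]

variable {f g : Spc → ℝ} {d e : Fin 4 → ℝ} {p : Spc}

lemma HasPD.add (hf : HasPD f d p) (hg : HasPD g e p) :
    HasPD (fun x => f x + g x) (fun α => d α + e α) p := by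
  refine (HasPD.of_hasFDerivAt (hf.1.hasFDerivAt.add hg.1.hasFDerivAt)).congr_d fun α => ?_
  rw [← hf.2 α, ← hg.2 α]; rfl

lemma HasPD.sub (hf : HasPD f d p) (hg : HasPD g e p) :
    HasPD (fun x => f x - g x) (fun α => d α - e α) p := by
  refine (HasPD.of_hasFDerivAt (hf.1.hasFDerivAt.sub hg.1.hasFDerivAt)).congr_d fun α => ?_
  rw [← hf.2 α, ← hg.2 α]; rfl

lemma HasPD.neg (hf : HasPD f d p) : HasPD (fun x => - f x) (fun α => - d α) p := by
  refine (HasPD.of_hasFDerivAt (hf.1.hasFDerivAt.neg)).congr_d fun α => ?_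
  rw [← hf.2 α]; rfl

lemma HasPD.mul (hf : HasPD f d p) (hg : HasPD g e p) :
    HasPD (fun x => f x * g x) (fun α => d α * g p + f p * e α) p := by
  refine (HasPD.of_hasFDerivAt (hf.1.hasFDerivAt.mul hg.1.hasFDerivAt)).congr_d fun α => ?_
  rw [← hf.2 α, ← hg.2 α]; simp [UCP.pd]; ring

lemma HasPD.const_mul (c : ℝ) (hf : HasPD f d p) :
    HasPD (fun x => c * f x) (fun α => c * d α) p :=
  ((hasPD_const c p).mul hf).congr_d fun α => by ring

lemma HasPD.sq (hf : HasPD f d p) :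
    HasPD (fun x => f x ^ 2) (fun α => 2 * f p * d α) p := by
  have h := (hf.mul hf).congr_d (d' := fun α => 2 * f p * d α) (fun α => by ring)
  exact h.congr_f (Eventually.of_forall fun x => by simp [pow_two])

lemma HasPD.comp {φ : ℝ → ℝ} {φ' : ℝ} (hf : HasPD f d p) (hφ : HasDerivAt φ φ' (f p)) :
    HasPD (fun x => φ (f x)) (fun α => φ' * d α) p := by
  have := HasDerivAt.comp_hasFDerivAt (h₂ := φ) (f := f) p hφ hf.1.hasFDerivAt
  refine (HasPD.of_hasFDerivAt this).congr_d fun α => ?_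
  rw [← hf.2 α]; simp [UCP.pd]

lemma HasPD.sum {ι : Type*} (s : Finset ι) {F : ι → Spc → ℝ} {D : ι → Fin 4 → ℝ}
    (h : ∀ i ∈ s, HasPD (F i) (D i) p) :
    HasPD (fun x => ∑ i ∈ s, F i x) (fun α => ∑ i ∈ s, D i α) p := by
  classical
  induction s using Finset.induction_on with
  | empty => simpa using hasPD_const 0 p
  | insert a s ha ih =>
    simp only [Finset.sum_insert ha]
    exact (h a (by simp)).add (ih fun i hi => h i (by simp [hi]))

lemma HasPD.inv (hf : HasPD f d p) (h0 : f p ≠ 0) :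
    HasPD (fun x => (f x)⁻¹) (fun α => -((f p ^ 2)⁻¹) * d α) p :=
  hf.comp (hasDerivAt_inv h0)

/-! ### Smoothness of partial derivatives -/

lemma contDiffAt_pd (h : ContDiffAt ℝ (⊤ : ℕ∞) f p) (α : Fin 4) :
    ContDiffAt ℝ (⊤ : ℕ∞) (pd α f) p := by
  have h1 : ContDiffAt ℝ (⊤ : ℕ∞) (fderiv ℝ f) p := h.fderiv_right (by simp)
  exact h1.clm_apply contDiffAt_const

lemma contDiff_pd (h : ContDiff ℝ (⊤ : ℕ∞) f) (α : Fin 4) :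
    ContDiff ℝ (⊤ : ℕ∞) (pd α f) :=
  contDiff_iff_contDiffAt.2 fun _ => contDiffAt_pd h.contDiffAt α

lemma diffAt_of_smooth (h : ContDiffAt ℝ (⊤ : ℕ∞) f p) : DifferentiableAt ℝ f p :=
  h.differentiableAt (by simp)

lemma hasPD_of_smooth (h : ContDiffAt ℝ (⊤ : ℕ∞) f p) : HasPD f (fun α => UCP.pd α f p) p :=
  hasPD_of_diff (diffAt_of_smooth h)

lemma pd_comm (h : ContDiffAt ℝ (⊤ : ℕ∞) f p) (α β : Fin 4) :
    pd α (pd β f) p = pd β (pd α f) p := by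
  have hs : IsSymmSndFDerivAt ℝ f p := h.isSymmSndFDerivAt (by
      simp only [minSmoothness_of_isRCLikeNormedField]; exact WithTop.coe_le_coe.2 (le_top : (2 : ℕ∞) ≤ ⊤))
  have h1 : DifferentiableAt ℝ (fderiv ℝ f) p :=
    (h.fderiv_right (m := (⊤ : ℕ∞)) (by simp)).differentiableAt (by simp)
  have key : ∀ a b : Fin 4, pd a (pd b f) p = fderiv ℝ (fderiv ℝ f) p (eVec a) (eVec b) := by
    intro a b
    have : HasFDerivAt (pd b f) ((fderiv ℝ (fderiv ℝ f) p).flip (eVec b)) p := by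
      have := h1.hasFDerivAt.clm_apply (hasFDerivAt_const (eVec b) p)
      simp only [ContinuousLinearMap.comp_zero, zero_add] at this
      exact this
    rw [UCP.pd, this.fderiv]; rfl
  rw [key, key]; exact hs _ _

lemma eta_sq (α : Fin 4) : eta α * eta α = 1 := by
  unfold eta; split_ifs <;> norm_num

@[simp] lemma eta_zero : eta 0 = -1 := by simp [eta]
@[simp] lemma eta_one : eta 1 = 1 := by simp [eta]
@[simp] lemma eta_two : eta 2 = 1 := by simp [eta]
@[simp] lemma eta_three : eta 3 = 1 := by simp [eta]

lemma box_eq (u : Spc → ℝ) (p : Spc) : box u p = ∑ α, eta α * pd α (pd α u) p := by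
  unfold box dt dxi
  rw [Fin.sum_univ_succ (n := 3)]
  simp [eta, Fin.succ_ne_zero]

lemma box_congr (h : f =ᶠ[𝓝 p] g) : box f p = box g p := by
  rw [box_eq, box_eq]
  refine Finset.sum_congr rfl fun α _ => ?_
  rw [pd_congr (pd_eventually_congr h α) α]

lemma continuous_box (h : ContDiff ℝ (⊤ : ℕ∞) f) : Continuous (box f) := by
  have : box f = fun p => ∑ α, eta α * pd α (pd α f) p := by funext p; exact box_eq f p
  rw [this]
  exact continuous_finsetSum _ fun α _ =>
    continuous_const.mul (contDiff_pd (contDiff_pd h α) α).continuous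

/-! ### Divergence theorem -/

lemma hasCompactSupport_pd (h : HasCompactSupport f) (α : Fin 4) : HasCompactSupport (pd α f) :=
  HasCompactSupport.fderiv_apply ℝ h (eVec α)

lemma integral_pd_eq_zero (hf : ContDiff ℝ 1 f) (hc : HasCompactSupport f) (α : Fin 4) :
    ∫ x, pd α f x = 0 := by
  have hcont : Continuous (pd α f) :=
    (hf.continuous_fderiv (by simp)).clm_apply continuous_const
  have hi : Integrable (pd α f) := hcont.integrable_of_hasCompactSupport (hasCompactSupport_pd hc α)
  have hi0 : Integrable f := hf.continuous.integrable_of_hasCompactSupport hc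
  have : (volume : Measure Spc).IsAddHaarMeasure :=
    MeasureTheory.Measure.prod.instIsAddHaarMeasure (volume : Measure ℝ)
      (volume : Measure (EuclideanSpace ℝ (Fin 3)))
  have := integral_mul_fderiv_eq_neg_fderiv_mul_of_integrable (μ := (volume : Measure Spc))
    (f := fun _ => (1 : ℝ)) (g := f) (v := eVec α) (by simp) (by simp only [one_mul]; exact hi)
    (by simpa using hi0) (fun x _ => by fun_prop)
    (fun x _ => (hf.differentiable (by simp)) x)
  simpa [UCP.pd] using this

lemma integral_div_eq_zero {X : Fin 4 → Spc → ℝ} (hf : ∀ α, ContDiff ℝ 1 (X α))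
    (hc : ∀ α, HasCompactSupport (X α)) : ∫ x, ∑ α, pd α (X α) x = 0 := by
  rw [integral_finsetSum]
  · simp [fun α => integral_pd_eq_zero (hf α) (hc α) α]
  · intro α _
    have hcont : Continuous (pd α (X α)) :=
      ((hf α).continuous_fderiv (by simp)).clm_apply continuous_const
    exact hcont.integrable_of_hasCompactSupport (hasCompactSupport_pd (hc α) α)

end

section
/-! ### The Carleman estimate -/

/-- The current used in the Carleman estimate. -/
def Jc (φ : Fin 4 → Spc → ℝ) (ρ z : Spc → ℝ) (l : ℝ) (α : Fin 4) (x : Spc) : ℝ :=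
  eta α * (-((2 * (∑ β, eta β * (φ β x * pd β z x)) + ρ x * z x) * pd α z x)
    + φ α x * (∑ β, eta β * (pd β z x) ^ 2)
    - l ^ 2 * ((∑ β, eta β * (φ β x) ^ 2) * (φ α x * (z x) ^ 2)))

lemma div_Jc {φ : Fin 4 → Spc → ℝ} {ρ z : Spc → ℝ} (l : ℝ) {p : Spc}
    {φ2 : Fin 4 → Fin 4 → ℝ} {ρd : Fin 4 → ℝ}
    (hφ : ∀ α, HasPD (φ α) (φ2 α) p) (hsymm : ∀ α β, φ2 α β = φ2 β α)
    (hρ : HasPD ρ ρd p) (hz : ContDiffAt ℝ (⊤ : ℕ∞) z p) :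
    -(box z p + l ^ 2 * (∑ β, eta β * (φ β p) ^ 2) * z p) *
      (2 * (∑ β, eta β * (φ β p * pd β z p)) + ρ p * z p) =
    (∑ α, pd α (Jc φ ρ z l α) p)
    + 2 * (∑ α, ∑ β, eta α * eta β * φ2 α β * pd α z p * pd β z p)
    + (ρ p - ∑ α, eta α * φ2 α α) * (∑ β, eta β * (pd β z p) ^ 2)
    + z p * (∑ α, eta α * ρd α * pd α z p)
    + l ^ 2 * (2 * (∑ α, ∑ β, eta α * eta β * φ2 α β * φ α p * φ β p)
      + ((∑ α, eta α * φ2 α α) - ρ p) * (∑ β, eta β * (φ β p) ^ 2)) * (z p) ^ 2 := by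
  have hz1 := hasPD_of_smooth hz
  have hz2 : ∀ β, HasPD (pd β z) (fun α => pd α (pd β z) p) p :=
    fun β => hasPD_of_smooth (contDiffAt_pd hz β)
  have hJ : ∀ α, HasPD (Jc φ ρ z l α) _ p := fun α =>
    HasPD.const_mul (eta α) (((((HasPD.const_mul 2 (HasPD.sum Finset.univ fun β _ =>
      ((hφ β).mul (hz2 β)).const_mul (eta β))).add (hρ.mul hz1)).mul (hz2 α)).neg.add
      ((hφ α).mul (HasPD.sum Finset.univ fun β _ => ((hz2 β).sq).const_mul (eta β)))).sub
      (HasPD.const_mul (l ^ 2) ((HasPD.sum Finset.univ fun β _ =>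
        ((hφ β).sq).const_mul (eta β)).mul ((hφ α).mul hz1.sq))))
  rw [Finset.sum_congr rfl fun α _ => (hJ α).2 α, box_eq]
  simp only [Fin.sum_univ_four, eta_zero, eta_one, eta_two, eta_three]
  rw [hsymm 1 0, hsymm 2 0, hsymm 3 0, hsymm 2 1, hsymm 3 1, hsymm 3 2,
    pd_comm hz 1 0, pd_comm hz 2 0, pd_comm hz 3 0, pd_comm hz 2 1, pd_comm hz 3 1,
    pd_comm hz 3 2]
  ring

/-- coefficients of the quadratic form `-a s² + |x|²` -/
def cc (a : ℝ) (α : Fin 4) : ℝ := if α = 0 then -a else 1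
/-- centre -/
def dd (δ : ℝ) (α : Fin 4) : ℝ := if α = 0 then δ else 0

/-- `f = |x|² - a (s-δ)²` -/
def fq (a δ : ℝ) (x : Spc) : ℝ := ∑ α, cc a α * (co α x - dd δ α) ^ 2

/-- gradient of `f` -/
def fd (a δ : ℝ) (α : Fin 4) (x : Spc) : ℝ := 2 * cc a α * (co α x - dd δ α)

/-- the weight -/
def ph (a δ μ : ℝ) (x : Spc) : ℝ := Real.exp (-μ * fq a δ x)

/-- gradient of the weight -/
def phd (a δ μ : ℝ) (α : Fin 4) (x : Spc) : ℝ := -μ * (ph a δ μ x * fd a δ α x)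

/-- Hessian of the weight -/
def phdd (a δ μ : ℝ) (x : Spc) (α β : Fin 4) : ℝ :=
  μ * ph a δ μ x * (μ * fd a δ α x * fd a δ β x - if α = β then 2 * cc a α else 0)

/-- zeroth order multiplier -/
def rh (a δ μ : ℝ) (x : Spc) : ℝ :=
  μ * (ph a δ μ x * (μ * (∑ β, eta β * (fd a δ β x) ^ 2) - 4))

lemma fq_expand (a δ : ℝ) (x : Spc) :
    fq a δ x = -a * (co 0 x - δ) ^ 2 + co 1 x ^ 2 + co 2 x ^ 2 + co 3 x ^ 2 := by
  simp [fq, Fin.sum_univ_four, cc, dd]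

lemma hasPD_fq (a δ : ℝ) (p : Spc) : HasPD (fq a δ) (fun α => fd a δ α p) p := by
  have h : HasPD (fq a δ) _ p := HasPD.sum Finset.univ fun α _ =>
    (((hasPD_co α p).sub (hasPD_const (dd δ α) p)).sq).const_mul (cc a α)
  refine h.congr_d fun α => ?_
  simp [fd]; ring

lemma hasPD_fd (a δ : ℝ) (α : Fin 4) (p : Spc) :
    HasPD (fd a δ α) (fun β => if α = β then 2 * cc a α else 0) p := by
  have h : HasPD (fd a δ α) _ p :=
    ((hasPD_co α p).sub (hasPD_const (dd δ α) p)).const_mul (2 * cc a α)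
  refine h.congr_d fun β => ?_
  simp

lemma hasPD_ph (a δ μ : ℝ) (p : Spc) : HasPD (ph a δ μ) (fun α => phd a δ μ α p) p := by
  have h : HasPD (ph a δ μ) _ p :=
    ((hasPD_fq a δ p).const_mul (-μ)).comp (Real.hasDerivAt_exp _)
  refine h.congr_d fun β => ?_
  simp [phd, ph]; ring

lemma hasPD_phd (a δ μ : ℝ) (α : Fin 4) (p : Spc) :
    HasPD (phd a δ μ α) (phdd a δ μ p α) p := by
  have h : HasPD (phd a δ μ α) _ p :=
    ((hasPD_ph a δ μ p).mul (hasPD_fd a δ α p)).const_mul (-μ)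
  refine h.congr_d fun β => ?_
  simp only [phdd, phd]; ring

lemma phdd_symm (a δ μ : ℝ) (x : Spc) (α β : Fin 4) :
    phdd a δ μ x α β = phdd a δ μ x β α := by
  unfold phdd
  by_cases h : α = β
  · rw [h]
  · rw [if_neg h, if_neg (Ne.symm h)]; ring

lemma contDiff_fq (a δ : ℝ) : ContDiff ℝ (⊤ : ℕ∞) (fq a δ) := by
  unfold fq
  exact ContDiff.sum fun α _ => contDiff_const.mul (((contDiff_co α).sub contDiff_const).pow 2)

lemma contDiff_fd (a δ : ℝ) (α : Fin 4) : ContDiff ℝ (⊤ : ℕ∞) (fd a δ α) := by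
  unfold fd
  exact contDiff_const.mul ((contDiff_co α).sub contDiff_const)

lemma contDiff_ph (a δ μ : ℝ) : ContDiff ℝ (⊤ : ℕ∞) (ph a δ μ) := by
  unfold ph
  exact (contDiff_const.mul (contDiff_fq a δ)).exp

lemma contDiff_phd (a δ μ : ℝ) (α : Fin 4) : ContDiff ℝ (⊤ : ℕ∞) (phd a δ μ α) := by
  unfold phd
  exact contDiff_const.mul ((contDiff_ph a δ μ).mul (contDiff_fd a δ α))

lemma contDiff_rh (a δ μ : ℝ) : ContDiff ℝ (⊤ : ℕ∞) (rh a δ μ) := by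
  unfold rh
  exact contDiff_const.mul ((contDiff_ph a δ μ).mul ((contDiff_const.mul
    (ContDiff.sum fun α _ => contDiff_const.mul ((contDiff_fd a δ α).pow 2))).sub contDiff_const))

lemma contDiff_Jc (a δ μ l : ℝ) {z : Spc → ℝ} (hz : ContDiff ℝ (⊤ : ℕ∞) z) (α : Fin 4) :
    ContDiff ℝ (⊤ : ℕ∞) (Jc (phd a δ μ) (rh a δ μ) z l α) := by
  have h1 := fun β => contDiff_phd a δ μ β
  have h2 := contDiff_rh a δ μ
  have h3 := fun β => contDiff_pd hz β
  unfold Jc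
  fun_prop

lemma hcs_Jc (φ : Fin 4 → Spc → ℝ) (ρ : Spc → ℝ) (l : ℝ) {z : Spc → ℝ}
    (hc : HasCompactSupport z) (α : Fin 4) : HasCompactSupport (Jc φ ρ z l α) := by
  apply hc.mono'
  intro x hx
  by_contra h
  apply hx
  have h0 : z x = 0 := image_eq_zero_of_notMem_tsupport h
  have h1 : ∀ β, pd β z x = 0 := fun β => by
    have : z =ᶠ[𝓝 x] fun _ => 0 := notMem_tsupport_iff_eventuallyEq.1 h
    rw [pd_congr this]; exact (hasPD_const 0 x).2 β
  simp [Jc, h0, h1]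

/-- Algebraic form of the pointwise estimate. -/
lemma pointwise_alg {l c1 c2 C3 Lz B A k z D q ρz H R : ℝ} (hl : 1 ≤ l)
    (hL : Lz = A - l * B + l * k * z)
    (hid : -A * B = D + q + z * ρz + l ^ 2 * H * z ^ 2)
    {E : ℝ} (hE : 0 ≤ E) (hq : 2 * c1 * E ≤ q) (hc1 : 0 < c1) (hρ : ρz ^ 2 ≤ R * E)
    (hR : 0 ≤ R)
    (hH : c2 ≤ H) (hC3 : k ^ 2 / 2 + R / (4 * c1) ≤ C3) :
    D + c1 * E + (l ^ 2 * c2 - l * C3) * z ^ 2 ≤ (1 / (2 * l)) * Lz ^ 2 := by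
  have hl0 : 0 < l := by linarith
  have h1 : -Lz * B ≤ (1 / (2 * l)) * Lz ^ 2 + (l / 2) * B ^ 2 := by
    have : 0 ≤ (1 / (2 * l)) * (Lz + l * B) ^ 2 := by positivity
    have e : (1 / (2 * l)) * (Lz + l * B) ^ 2
      = (1 / (2 * l)) * Lz ^ 2 + Lz * B + (l / 2) * B ^ 2 := by field_simp; ring
    linarith
  have h2 : -Lz * B = -A * B + l * B ^ 2 - l * k * z * B := by rw [hL]; ring
  have h3 : l * k * z * B ≤ (l / 2) * B ^ 2 + l * (k ^ 2 / 2) * z ^ 2 := by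
    nlinarith [mul_nonneg hl0.le (sq_nonneg (B - k * z))]
  have h4 : -(z * ρz) ≤ c1 * E + R / (4 * c1) * z ^ 2 := by
    by_cases hR0 : R = 0
    · have : ρz = 0 := by
        have : ρz ^ 2 ≤ 0 := by simpa [hR0] using hρ
        nlinarith [sq_nonneg ρz]
      rw [this, hR0]; simp; positivity
    · have hRp : 0 < R := lt_of_le_of_ne hR (Ne.symm hR0)
      have : -(z * ρz) ≤ c1 / R * ρz ^ 2 + R / (4 * c1) * z ^ 2 := by
        have : 0 ≤ (c1 / R) * (ρz + R / (2 * c1) * z) ^ 2 := by positivity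
        have e : (c1 / R) * (ρz + R / (2 * c1) * z) ^ 2
          = c1 / R * ρz ^ 2 + z * ρz + R / (4 * c1) * z ^ 2 := by field_simp; ring
        linarith
      have h5 : c1 / R * ρz ^ 2 ≤ c1 / R * (R * E) := by gcongr
      have e : c1 / R * (R * E) = c1 * E := by field_simp
      linarith
  have h6 : l * (k ^ 2 / 2) * z ^ 2 + R / (4 * c1) * z ^ 2 ≤ l * C3 * z ^ 2 := by
    have : R / (4 * c1) ≤ l * (R / (4 * c1)) := by
      have : 0 ≤ R / (4 * c1) := by positivity
      nlinarith
    have h7 : l * (k ^ 2 / 2) + R / (4 * c1) ≤ l * C3 := by nlinarith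
    nlinarith [sq_nonneg z]
  have h8 : l ^ 2 * c2 * z ^ 2 ≤ l ^ 2 * H * z ^ 2 := by gcongr
  nlinarith

lemma sum_phdd (a δ μ : ℝ) (p : Spc) (w : Fin 4 → ℝ) :
    2 * (∑ α, ∑ β, eta α * eta β * phdd a δ μ p α β * w α * w β)
    + (rh a δ μ p - ∑ α, eta α * phdd a δ μ p α α) * (∑ β, eta β * (w β) ^ 2)
    = μ * ph a δ μ p * (2 * (a - 1) * (∑ β, w β ^ 2)
      + 2 * μ * (∑ β, eta β * fd a δ β p * w β) ^ 2) := by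
  simp only [phdd, rh, Fin.sum_univ_four, eta_zero, eta_one, eta_two, eta_three]
  simp [cc]
  ring

lemma kappa_eq (a δ μ : ℝ) (p : Spc) :
    rh a δ μ p - ∑ α, eta α * phdd a δ μ p α α = 2 * (1 + a) * μ * ph a δ μ p := by
  simp only [phdd, rh, Fin.sum_univ_four, eta_zero, eta_one, eta_two, eta_three]
  simp [cc]
  ring

lemma H_lower {a δ μ f0 : ℝ} {p : Spc} (ha : 1 < a) (ha' : a ≤ 5 / 4) (hf0 : 0 < f0)
    (hf : f0 ≤ fq a δ p) (he : (a ^ 2 - a) * (co 0 p - δ) ^ 2 ≤ fq a δ p / 2)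
    (hμ : μ = 5 / f0) :
    μ ^ 3 * ph a δ μ p ^ 3 * (6 * f0) ≤
    2 * (∑ α, ∑ β, eta α * eta β * phdd a δ μ p α β * phd a δ μ α p * phd a δ μ β p)
      + ((∑ α, eta α * phdd a δ μ p α α) - rh a δ μ p) *
        (∑ β, eta β * (phd a δ μ β p) ^ 2) := by
  have hk := kappa_eq a δ μ p
  have hk' : (∑ α, eta α * phdd a δ μ p α α) - rh a δ μ p = -(2 * (1 + a) * μ * ph a δ μ p) := by
    linarith
  rw [hk']
  have hμ0 : 0 < μ := by rw [hμ]; positivity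
  have hph : 0 < ph a δ μ p := Real.exp_pos _
  have hfe := fq_expand a δ p
  set F := fq a δ p with hF
  set s := co 0 p - δ with hs
  set r2 := co 1 p ^ 2 + co 2 p ^ 2 + co 3 p ^ 2 with hr2
  have hr : r2 = F + a * s ^ 2 := by rw [hfe]; ring
  have key : 2 * (∑ α, ∑ β, eta α * eta β * phdd a δ μ p α β * phd a δ μ α p * phd a δ μ β p)
      + -(2 * (1 + a) * μ * ph a δ μ p) * (∑ β, eta β * (phd a δ μ β p) ^ 2)
      = μ ^ 3 * ph a δ μ p ^ 3 * (32 * μ * (r2 - a ^ 2 * s ^ 2) ^ 2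
        - 16 * (r2 - a ^ 3 * s ^ 2) - 8 * (1 + a) * (r2 - a ^ 2 * s ^ 2)) := by
    simp only [phdd, phd, Fin.sum_univ_four, eta_zero, eta_one, eta_two, eta_three, hr2]
    simp [cc, fd, dd, hs]
    ring
  rw [key]
  have hs2 := sq_nonneg s
  have hFp : 0 < F := by linarith
  have hμF : 5 ≤ μ * F := by
    rw [hμ, div_mul_eq_mul_div, le_div_iff₀ hf0]; linarith
  gcongr
  have e1 : r2 - a ^ 2 * s ^ 2 = F - (a ^ 2 - a) * s ^ 2 := by rw [hr]; ring
  have e2 : r2 - a ^ 3 * s ^ 2 ≤ F := by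
    rw [hr]
    have : a ≤ a ^ 3 := le_self_pow₀ ha.le (by norm_num)
    have := mul_le_mul_of_nonneg_right this hs2
    linarith
  set x := r2 - a ^ 2 * s ^ 2 with hx
  have hx1 : F / 2 ≤ x := by rw [e1]; linarith
  have hx2 : x ≤ F := by
    rw [e1]; have : 0 ≤ (a ^ 2 - a) * s ^ 2 := mul_nonneg (by nlinarith only [ha]) hs2
    linarith
  have h1 : F ^ 2 / 4 ≤ x ^ 2 := by
    have : (F / 2) ^ 2 ≤ x ^ 2 := by gcongr
    linarith [show (F / 2) ^ 2 = F ^ 2 / 4 by ring]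
  have h2 : 40 * F ≤ 32 * μ * x ^ 2 := by
    have : 32 * μ * (F ^ 2 / 4) ≤ 32 * μ * x ^ 2 := by gcongr
    have h3 : 5 * F ≤ μ * F * F := by gcongr
    nlinarith only [this, h3]
  have hx0 : 0 ≤ x := by linarith
  have h3 : 8 * (1 + a) * x ≤ 8 * (1 + 5 / 4) * F := by gcongr
  linarith

end

section
lemma norm_sq_snd (p : Spc) : ‖p.2‖ ^ 2 = co 1 p ^ 2 + co 2 p ^ 2 + co 3 p ^ 2 := by
  rw [EuclideanSpace.real_norm_sq_eq, Fin.sum_univ_three]; rfl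

/-- The region of validity of the Carleman estimate. -/
def Bset (a δ S f0 c2 : ℝ) : Set Spc := {x | |co 0 x| ≤ S ∧ f0 ≤ fq a δ x ∧ fq a δ x ≤ c2}

lemma isCompact_Bset {a : ℝ} (δ S f0 c2 : ℝ) (ha : 0 < a) : IsCompact (Bset a δ S f0 c2) := by
  have hc := (contDiff_fq a δ).continuous
  apply Metric.isCompact_of_isClosed_isBounded
  · exact (isClosed_le (continuous_co 0).abs continuous_const).inter
      ((isClosed_le continuous_const hc).inter (isClosed_le hc continuous_const))
  · rw [isBounded_iff_forall_norm_le]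
    refine ⟨|S| + (1 + |c2| + a * (|S| + |δ|) ^ 2), fun x hx => ?_⟩
    obtain ⟨h1, h2, h3⟩ := hx
    have hS : |co 0 x| ≤ |S| := h1.trans (le_abs_self S)
    have hpos : 0 ≤ a * (|S| + |δ|) ^ 2 := by positivity
    rw [Prod.norm_def]
    refine max_le ?_ ?_
    · have : ‖x.1‖ = |co 0 x| := rfl
      rw [this]; linarith [abs_nonneg c2]
    · have hn := norm_sq_snd x
      rw [fq_expand] at h3
      have h4 : (co 0 x - δ) ^ 2 ≤ (|S| + |δ|) ^ 2 := by
        rw [sq_le_sq, abs_of_nonneg (by positivity : 0 ≤ |S| + |δ|)]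
        exact (abs_sub _ _).trans (by linarith)
      have h5 := mul_le_mul_of_nonneg_left h4 ha.le
      have h6 : ‖x.2‖ ^ 2 ≤ |c2| + a * (|S| + |δ|) ^ 2 := by
        rw [hn]; linarith [le_abs_self c2]
      have h7 : ‖x.2‖ ≤ 1 + ‖x.2‖ ^ 2 := by nlinarith [sq_nonneg (‖x.2‖ - 1), norm_nonneg x.2]
      linarith [abs_nonneg S]

lemma conj_box (a δ μ l : ℝ) {v : Spc → ℝ} (hv : ContDiff ℝ (⊤ : ℕ∞) v) (p : Spc) :
    (∀ α, pd α (fun x => Real.exp (l * ph a δ μ x) * v x) p =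
      Real.exp (l * ph a δ μ p) * (pd α v p + l * phd a δ μ α p * v p)) ∧
    box (fun x => Real.exp (l * ph a δ μ x) * v x) p =
      Real.exp (l * ph a δ μ p) * (box v p + 2 * l * (∑ α, eta α * (phd a δ μ α p * pd α v p))
        + l * (∑ α, eta α * phdd a δ μ p α α) * v p
        + l ^ 2 * (∑ α, eta α * phd a δ μ α p ^ 2) * v p) := by
  have hE : ∀ x, HasPD (fun x => Real.exp (l * ph a δ μ x))
      (fun α => Real.exp (l * ph a δ μ x) * (l * phd a δ μ α x)) x := fun x =>
    ((hasPD_ph a δ μ x).const_mul l).comp (Real.hasDerivAt_exp _)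
  have hv1 : ∀ x, HasPD v (fun α => pd α v x) x := fun x => hasPD_of_smooth hv.contDiffAt
  have h1 : ∀ x α, pd α (fun x => Real.exp (l * ph a δ μ x) * v x) x =
      Real.exp (l * ph a δ μ x) * (pd α v x + l * (phd a δ μ α x * v x)) := by
    intro x α
    rw [((hE x).mul (hv1 x)).2 α]; ring
  refine ⟨fun α => by rw [h1]; ring, ?_⟩
  rw [box_eq, box_eq]
  have h2 : ∀ α, pd α (pd α (fun x => Real.exp (l * ph a δ μ x) * v x)) p =
      Real.exp (l * ph a δ μ p) * (pd α (pd α v) p + 2 * l * (phd a δ μ α p * pd α v p)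
        + l * phdd a δ μ p α α * v p + l ^ 2 * phd a δ μ α p ^ 2 * v p) := by
    intro α
    have e : pd α (fun x => Real.exp (l * ph a δ μ x) * v x) = fun x =>
      Real.exp (l * ph a δ μ x) * (pd α v x + l * (phd a δ μ α x * v x)) := by
      funext x; exact h1 x α
    rw [e]
    have := ((hE p).mul ((hasPD_of_smooth (contDiff_pd hv α).contDiffAt).add
      (((hasPD_phd a δ μ α p).mul (hv1 p)).const_mul l))).2 α
    rw [this]; ring
  simp only [h2, Fin.sum_univ_four]
  ring

lemma carl_use {ex vx l M c1 c3 C3 C5 bx Dx : ℝ} {pv pz φ : Fin 4 → ℝ}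
    (hl1 : 1 ≤ l) (hc10 : 0 < c1) (hc30 : 0 < c3) (hM0 : 0 ≤ M)
    (hC5 : C5 = 2 / c1 + 2 * (1 + 2 * M) / c3) (hl2 : C3 ≤ l * c3 / 2)
    (hz1 : ∀ α, pz α = ex * (pv α + l * φ α * vx)) (hM : ∑ α, φ α ^ 2 ≤ M)
    (key : c1 * (∑ α, pz α ^ 2) + (l ^ 2 * c3 - l * C3) * (ex * vx) ^ 2 ≤
      1 / (2 * l) * (ex * bx) ^ 2 - Dx) :
    ex ^ 2 * (vx ^ 2 + ∑ α, pv α ^ 2) ≤ C5 / (2 * l) * (ex ^ 2 * bx ^ 2) - C5 * Dx := by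
  have hl0 : 0 < l := by linarith
  have hC50 : 0 < C5 := by rw [hC5]; positivity
  have h3 : ∀ α, (ex * pv α) ^ 2 ≤ 2 * pz α ^ 2 + 2 * l ^ 2 * φ α ^ 2 * (ex * vx) ^ 2 := by
    intro α
    have : ex * pv α = pz α - l * φ α * (ex * vx) := by
      rw [hz1 α]; ring
    rw [this]
    nlinarith [sq_nonneg (pz α + l * φ α * (ex * vx))]
  have h4 : ∑ α, (ex * pv α) ^ 2 ≤
      2 * ∑ α, pz α ^ 2 + 2 * l ^ 2 * (∑ α, φ α ^ 2) * (ex * vx) ^ 2 := by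
    refine (Finset.sum_le_sum fun α _ => h3 α).trans (le_of_eq ?_)
    rw [Finset.sum_add_distrib, Finset.mul_sum, Finset.mul_sum, Finset.sum_mul]
  have h5 : ex ^ 2 * (vx ^ 2 + ∑ α, pv α ^ 2) = (ex * vx) ^ 2 + ∑ α, (ex * pv α) ^ 2 := by
    rw [mul_add, Finset.mul_sum]; simp only [mul_pow]
  have hE0 : 0 ≤ ∑ α, pz α ^ 2 := Finset.sum_nonneg fun α _ => sq_nonneg _
  generalize (∑ α, pz α ^ 2) = E at *
  generalize (∑ α, (ex * pv α) ^ 2) = E2 at *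
  generalize (∑ α, φ α ^ 2) = P at *
  generalize ex * vx = z at *
  have h6 : 2 * l ^ 2 * P * z ^ 2 ≤ 2 * l ^ 2 * M * z ^ 2 := by gcongr
  have h7 : z ^ 2 ≤ l ^ 2 * z ^ 2 := by
    have : 1 ≤ l ^ 2 := one_le_pow₀ hl1
    nlinarith [sq_nonneg z]
  have h8 : z ^ 2 + E2 ≤ 2 * E + l ^ 2 * (1 + 2 * M) * z ^ 2 := by linarith
  have h9 : 2 * E + l ^ 2 * (1 + 2 * M) * z ^ 2 ≤ C5 * (c1 * E + l ^ 2 * c3 / 2 * z ^ 2) := by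
    have e : C5 * (c1 * E + l ^ 2 * c3 / 2 * z ^ 2) =
      2 * E + l ^ 2 * (1 + 2 * M) * z ^ 2 + (2 * (1 + 2 * M) / c3 * (c1 * E)
       + 2 / c1 * (l ^ 2 * c3 / 2 * z ^ 2)) := by
      rw [hC5]; field_simp; ring
    rw [e]
    have : 0 ≤ 2 * (1 + 2 * M) / c3 * (c1 * E)
       + 2 / c1 * (l ^ 2 * c3 / 2 * z ^ 2) := by positivity
    linarith
  have h10 : l ^ 2 * c3 / 2 * z ^ 2 ≤ (l ^ 2 * c3 - l * C3) * z ^ 2 := by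
    apply mul_le_mul_of_nonneg_right _ (sq_nonneg _)
    have := mul_le_mul_of_nonneg_left hl2 hl0.le
    nlinarith
  have h11 : C5 * (c1 * E + l ^ 2 * c3 / 2 * z ^ 2) ≤ C5 * (1 / (2 * l) * (ex * bx) ^ 2 - Dx) :=
    mul_le_mul_of_nonneg_left (by linarith) hC50.le
  rw [h5]
  refine (h8.trans (h9.trans h11)).trans (le_of_eq ?_)
  field_simp

lemma carl_pt {a δ f0 μ m c1 c3 C3 l : ℝ} {x : Spc} (ha : 1 < a) (ha' : a ≤ 5 / 4) (hf0 : 0 < f0)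
    (hfx : f0 ≤ fq a δ x) (he : (a ^ 2 - a) * (co 0 x - δ) ^ 2 ≤ fq a δ x / 2)
    (hμ : μ = 5 / f0) (hμ0 : 0 < μ) (hm0 : 0 < m) (hph : m ≤ ph a δ μ x)
    (hc1 : c1 = μ * m * (a - 1)) (hc10 : 0 < c1) (hc3 : c3 = μ ^ 3 * m ^ 3 * (6 * f0))
    (hC3 : (2 * (1 + a) * μ * ph a δ μ x) ^ 2 / 2
      + (∑ α, pd α (rh a δ μ) x ^ 2) / (4 * c1) ≤ C3) (hl1 : 1 ≤ l)
    {v : Spc → ℝ} (hv : ContDiff ℝ (⊤ : ℕ∞) v) {z : Spc → ℝ}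
    (hz : z = fun x => Real.exp (l * ph a δ μ x) * v x) :
    c1 * (∑ α, pd α z x ^ 2) + (l ^ 2 * c3 - l * C3) * (Real.exp (l * ph a δ μ x) * v x) ^ 2 ≤
      1 / (2 * l) * (Real.exp (l * ph a δ μ x) * box v x) ^ 2 -
        ∑ α, pd α (Jc (phd a δ μ) (rh a δ μ) z l α) x := by
  have hzs : ContDiff ℝ (⊤ : ℕ∞) z := by
    rw [hz]; exact ((contDiff_const.mul (contDiff_ph a δ μ)).exp).mul hv
  obtain ⟨hz1, hz2⟩ := conj_box a δ μ l hv x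
  rw [← hz] at hz2
  simp only [← hz] at hz1
  have hid := div_Jc (z := z) l (fun α => hasPD_phd a δ μ α x) (phdd_symm a δ μ x)
    (hasPD_of_smooth (contDiff_rh a δ μ).contDiffAt) hzs.contDiffAt
  have hk := kappa_eq a δ μ x
  have hq := sum_phdd a δ μ x (fun α => pd α z x)
  have hH := H_lower ha ha' hf0 hfx he hμ
  have hzx : z x = Real.exp (l * ph a δ μ x) * v x := by rw [hz]
  rw [← hzx]
  set ex := Real.exp (l * ph a δ μ x) with hex
  rw [le_sub_iff_add_le, add_comm, ← add_assoc]
  refine pointwise_alg (l := l) (c1 := c1) (c2 := c3) (C3 := C3) (Lz := ex * box v x)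
    (B := 2 * (∑ β, eta β * (phd a δ μ β x * pd β z x)) + rh a δ μ x * z x)
    (A := box z x + l ^ 2 * (∑ β, eta β * (phd a δ μ β x) ^ 2) * z x)
    (k := 2 * (1 + a) * μ * ph a δ μ x) (z := z x)
    (q := μ * ph a δ μ x * (2 * (a - 1) * (∑ β, pd β z x ^ 2)
    + 2 * μ * (∑ β, eta β * fd a δ β x * pd β z x) ^ 2))
    (ρz := ∑ α, eta α * pd α (rh a δ μ) x * pd α z x)
    (H := 2 * (∑ α, ∑ β, eta α * eta β * phdd a δ μ x α β * phd a δ μ α x * phd a δ μ β x)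
    + ((∑ α, eta α * phdd a δ μ x α α) - rh a δ μ x) *
      (∑ β, eta β * (phd a δ μ β x) ^ 2))
    (R := ∑ α, pd α (rh a δ μ) x ^ 2) (E := ∑ β, pd β z x ^ 2) hl1 ?_ ?_ ?_ ?_ hc10 ?_ ?_ ?_ hC3
  · -- Lz
    have hk' : (∑ α, eta α * phdd a δ μ x α α) = rh a δ μ x - 2 * (1 + a) * μ * ph a δ μ x := by
      linarith
    rw [hz2, hk']
    have : ∑ β, eta β * (phd a δ μ β x * pd β z x) =
        ex * (∑ β, eta β * (phd a δ μ β x * pd β v x))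
          + ex * (l * (∑ β, eta β * phd a δ μ β x ^ 2) * v x) := by
      simp only [hz1, Fin.sum_univ_four]; ring
    rw [this, hzx]
    ring
  · -- identity
    rw [hid, ← hq]; ring
  · exact Finset.sum_nonneg fun α _ => sq_nonneg _
  · have hE0 : 0 ≤ ∑ β, pd β z x ^ 2 := Finset.sum_nonneg fun α _ => sq_nonneg _
    have h1 : 0 < a - 1 := by linarith
    have h2 : μ * m * (2 * (a - 1) * (∑ β, pd β z x ^ 2)) ≤
      μ * ph a δ μ x * (2 * (a - 1) * (∑ β, pd β z x ^ 2)) := by gcongr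
    have h3 : 0 ≤ μ * ph a δ μ x * (2 * μ * (∑ β, eta β * fd a δ β x * pd β z x) ^ 2) := by
      have := hm0.le.trans hph
      positivity
    rw [hc1, mul_add]; linarith
  · have := Finset.sum_mul_sq_le_sq_mul_sq Finset.univ (fun α => pd α (rh a δ μ) x)
      (fun α => eta α * pd α z x)
    have e1 : ∑ α, eta α * pd α (rh a δ μ) x * pd α z x =
      ∑ α, pd α (rh a δ μ) x * (eta α * pd α z x) :=
        Finset.sum_congr rfl fun α _ => by ring
    have e2 : ∑ α, (eta α * pd α z x) ^ 2 = ∑ α, pd α z x ^ 2 :=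
      Finset.sum_congr rfl fun α _ => by rw [mul_pow, pow_two (eta α), eta_sq, one_mul]
    rw [e1, ← e2]; exact this
  · exact Finset.sum_nonneg fun α _ => sq_nonneg _
  · refine le_trans ?_ hH
    rw [hc3]; gcongr

theorem carleman {a δ S f0 c2 : ℝ} (ha : 1 < a) (ha' : a ≤ 5 / 4) (hf0 : 0 < f0)
    (he : ∀ x ∈ Bset a δ S f0 c2, (a ^ 2 - a) * (co 0 x - δ) ^ 2 ≤ fq a δ x / 2) :
    ∃ μ C l0 : ℝ, 0 < μ ∧ 0 < C ∧ 1 ≤ l0 ∧ ∀ l, l0 ≤ l → ∀ v : Spc → ℝ, ContDiff ℝ (⊤ : ℕ∞) v →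
      (∀ x, v x ≠ 0 → x ∈ Bset a δ S f0 c2) →
      l * ∫ x, Real.exp (2 * l * ph a δ μ x) * (v x ^ 2 + ∑ α, pd α v x ^ 2) ≤
        C * ∫ x, Real.exp (2 * l * ph a δ μ x) * box v x ^ 2 := by
  obtain ⟨μ, hμ⟩ : ∃ μ, μ = 5 / f0 := ⟨_, rfl⟩
  have hμ0 : 0 < μ := by rw [hμ]; positivity
  have ha0 : 0 < a := by linarith
  have hB := isCompact_Bset δ S f0 c2 ha0
  obtain ⟨m, hm⟩ : ∃ m, m = Real.exp (-μ * c2) := ⟨_, rfl⟩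
  have hm0 : 0 < m := by rw [hm]; exact Real.exp_pos _
  have hmle : ∀ x ∈ Bset a δ S f0 c2, m ≤ ph a δ μ x := by
    intro x hx
    rw [hm, ph]
    apply Real.exp_le_exp.2
    have := hx.2.2
    nlinarith
  obtain ⟨c1, hc1⟩ : ∃ c1, c1 = μ * m * (a - 1) := ⟨_, rfl⟩
  have hc10 : 0 < c1 := by rw [hc1]; have : 0 < a - 1 := by linarith
                           positivity
  obtain ⟨c3, hc3⟩ : ∃ c3, c3 = μ ^ 3 * m ^ 3 * (6 * f0) := ⟨_, rfl⟩
  have hc30 : 0 < c3 := by rw [hc3]; positivity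
  -- upper bounds
  have hR : Continuous fun x => ∑ α, pd α (rh a δ μ) x ^ 2 :=
    continuous_finsetSum _ fun α _ => ((contDiff_pd (contDiff_rh a δ μ) α).continuous).pow 2
  have hK : Continuous fun x => (2 * (1 + a) * μ * ph a δ μ x) ^ 2 / 2
      + (∑ α, pd α (rh a δ μ) x ^ 2) / (4 * c1) := by
    have := (contDiff_ph a δ μ).continuous
    fun_prop
  have hM : Continuous fun x => ∑ α, phd a δ μ α x ^ 2 :=
    continuous_finsetSum _ fun α _ => ((contDiff_phd a δ μ α).continuous).pow 2
  obtain ⟨C3, hC3⟩ := hB.bddAbove_image hK.continuousOn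
  obtain ⟨M, hM⟩ := hB.bddAbove_image hM.continuousOn
  have hC3' : ∀ x ∈ Bset a δ S f0 c2, (2 * (1 + a) * μ * ph a δ μ x) ^ 2 / 2
      + (∑ α, pd α (rh a δ μ) x ^ 2) / (4 * c1) ≤ C3 := fun x hx =>
    hC3 (mem_image_of_mem _ hx)
  have hM' : ∀ x ∈ Bset a δ S f0 c2, ∑ α, phd a δ μ α x ^ 2 ≤ |M| := fun x hx =>
    (hM (mem_image_of_mem _ hx)).trans (le_abs_self M)
  obtain ⟨C5, hC5⟩ : ∃ C5, C5 = 2 / c1 + 2 * (1 + 2 * |M|) / c3 := ⟨_, rfl⟩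
  have hC50 : 0 < C5 := by rw [hC5]; positivity
  refine ⟨μ, C5 / 2, max 1 (2 * C3 / c3), hμ0, by positivity, le_max_left _ _, ?_⟩
  intro l hl v hv hsupp
  have hl1 : 1 ≤ l := (le_max_left _ _).trans hl
  have hl0 : 0 < l := by linarith
  have hl2 : C3 ≤ l * c3 / 2 := by
    have := (le_max_right 1 (2 * C3 / c3)).trans hl
    rw [div_le_iff₀ hc30] at this; linarith
  have hvc : HasCompactSupport v :=
    HasCompactSupport.intro hB fun x hx => by by_contra h; exact hx (hsupp x h)
  set z : Spc → ℝ := fun x => Real.exp (l * ph a δ μ x) * v x with hz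
  have hzs : ContDiff ℝ (⊤ : ℕ∞) z := ((contDiff_const.mul (contDiff_ph a δ μ)).exp).mul hv
  have hzc : HasCompactSupport z := hvc.mul_left
  have hts : tsupport v ⊆ Bset a δ S f0 c2 :=
    closure_minimal (fun x hx => hsupp x hx) hB.isClosed
  set D : Spc → ℝ := fun x => ∑ α, pd α (Jc (phd a δ μ) (rh a δ μ) z l α) x with hD
  have hpt : ∀ x, Real.exp (2 * l * ph a δ μ x) * (v x ^ 2 + ∑ α, pd α v x ^ 2) ≤
      C5 / (2 * l) * (Real.exp (2 * l * ph a δ μ x) * box v x ^ 2) - C5 * D x := by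
    intro x
    by_cases hx : x ∈ tsupport v
    swap
    · have hev : v =ᶠ[𝓝 x] fun _ => 0 := notMem_tsupport_iff_eventuallyEq.1 hx
      have h0 : v x = 0 := hev.eq_of_nhds
      have h1 : ∀ α, pd α v x = 0 := fun α => by
        rw [pd_congr hev]; exact (hasPD_const 0 x).2 α
      have h2 : D x = 0 := by
        have hzev : z =ᶠ[𝓝 x] fun _ => 0 := by
          filter_upwards [hev] with y hy; simp [hz, hy]
        have : ∀ α, Jc (phd a δ μ) (rh a δ μ) z l α =ᶠ[𝓝 x] fun _ => 0 := by
          intro α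
          have hp : ∀ β, pd β z =ᶠ[𝓝 x] pd β (fun _ => 0) := fun β =>
            pd_eventually_congr hzev β
          filter_upwards [hzev, hp 0, hp 1, hp 2, hp 3, hp α] with y h h0 h1 h2 h3 h4
          simp [Jc, h, Fin.sum_univ_four, h0, h1, h2, h3, h4, fun β => (hasPD_const 0 y).2 β]
        simp only [hD]
        refine Finset.sum_eq_zero fun α _ => ?_
        rw [pd_congr (this α)]; exact (hasPD_const 0 x).2 α
      simp [h0, h1, h2]; positivity
    have hxB := hts hx
    obtain ⟨hz1, hz2⟩ := conj_box a δ μ l hv x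
    have key := carl_pt ha ha' hf0 hxB.2.1 (he x hxB) hμ hμ0 hm0 (hmle x hxB) hc1 hc10 hc3
      (hC3' x hxB) hl1 hv hz
    have hexx : Real.exp (2 * l * ph a δ μ x) = Real.exp (l * ph a δ μ x) ^ 2 := by
      rw [← Real.exp_nat_mul]; congr 1; push_cast; ring
    rw [hexx]
    exact carl_use hl1 hc10 hc30 (abs_nonneg M) hC5 hl2 hz1 (hM' x hxB) key
  -- integrate
  have hJs := fun α => contDiff_Jc a δ μ l hzs α
  have hJc := fun α => hcs_Jc (phd a δ μ) (rh a δ μ) l hzc α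
  have hDint : ∫ x, D x = 0 :=
    integral_div_eq_zero (fun α => (hJs α).of_le (by simp)) hJc
  have hDi : Integrable D := integrable_finsetSum _ fun α _ =>
    ((contDiff_pd (hJs α) α).continuous).integrable_of_hasCompactSupport
      (hasCompactSupport_pd (hJc α) α)
  have hexc : Continuous fun x => Real.exp (2 * l * ph a δ μ x) :=
    (continuous_const.mul (contDiff_ph a δ μ).continuous).rexp
  have hi1 : Integrable fun x => Real.exp (2 * l * ph a δ μ x) * (v x ^ 2 + ∑ α, pd α v x ^ 2) := by
    apply Continuous.integrable_of_hasCompactSupport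
    · exact hexc.mul ((hv.continuous.pow 2).add (continuous_finsetSum _ fun α _ =>
        (contDiff_pd hv α).continuous.pow 2))
    · apply HasCompactSupport.intro hvc
      intro x hx
      have hev : v =ᶠ[𝓝 x] fun _ => 0 := notMem_tsupport_iff_eventuallyEq.1 hx
      simp [hev.eq_of_nhds, fun α => (pd_congr hev α).trans ((hasPD_const 0 x).2 α)]
  have hi2 : Integrable fun x => Real.exp (2 * l * ph a δ μ x) * box v x ^ 2 := by
    apply Continuous.integrable_of_hasCompactSupport
    · exact hexc.mul ((continuous_box hv).pow 2)
    · apply HasCompactSupport.intro hvc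
      intro x hx
      have hev : v =ᶠ[𝓝 x] fun _ => 0 := notMem_tsupport_iff_eventuallyEq.1 hx
      have : box v x = 0 := by
        rw [box_congr hev, box_eq]
        refine Finset.sum_eq_zero fun α _ => ?_
        have : pd α (fun _ : Spc => (0 : ℝ)) = fun _ => 0 := by
          funext y; exact (hasPD_const 0 y).2 α
        rw [this]; simp [(hasPD_const 0 x).2 α]
      simp [this]
  have := integral_mono hi1 ((hi2.const_mul (C5 / (2 * l))).sub (hDi.const_mul C5)) hpt
  have e : ∫ x, (C5 / (2 * l) * (Real.exp (2 * l * ph a δ μ x) * box v x ^ 2) - C5 * D x) =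
      C5 / (2 * l) * ∫ x, Real.exp (2 * l * ph a δ μ x) * box v x ^ 2 := by
    rw [integral_sub (hi2.const_mul _) (hDi.const_mul _), integral_const_mul, integral_const_mul,
      hDint]
    ring
  rw [Pi.sub_def, e] at this
  calc _ ≤ l * (C5 / (2 * l) * ∫ x, Real.exp (2 * l * ph a δ μ x) * box v x ^ 2) := by gcongr
    _ = _ := by field_simp

end

section
/-! ### Smooth cutoffs -/

/-- the standard smooth step function -/
abbrev sg : ℝ → ℝ := Real.smoothTransition

lemma sg_smooth : ContDiff ℝ (⊤ : ℕ∞) sg := Real.smoothTransition.contDiff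

lemma sg_hasDeriv (x : ℝ) : HasDerivAt sg (deriv sg x) x :=
  (sg_smooth.differentiable (by simp) x).hasDerivAt

lemma sg_nonneg (x : ℝ) : 0 ≤ sg x := Real.smoothTransition.nonneg x
lemma sg_le_one (x : ℝ) : sg x ≤ 1 := Real.smoothTransition.le_one x
lemma sg_zero {x : ℝ} (h : x ≤ 0) : sg x = 0 := Real.smoothTransition.zero_of_nonpos h
lemma sg_one {x : ℝ} (h : 1 ≤ x) : sg x = 1 := Real.smoothTransition.one_of_one_le h

lemma dsg_nonneg (x : ℝ) : 0 ≤ deriv sg x := Real.smoothTransition.monotone.deriv_nonneg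

lemma dsg_zero {x : ℝ} (h : x ≤ 0) : deriv sg x = 0 :=
  IsLocalMin.deriv_eq_zero (Eventually.of_forall fun y => by rw [sg_zero h]; exact sg_nonneg y)

lemma dsg_one {x : ℝ} (h : 1 ≤ x) : deriv sg x = 0 :=
  IsLocalMax.deriv_eq_zero (Eventually.of_forall fun y => by rw [sg_one h]; exact sg_le_one y)

lemma dsg_smooth : ContDiff ℝ (⊤ : ℕ∞) (deriv sg) := by
  have := sg_smooth
  exact (contDiff_infty_iff_deriv.1 this).2

lemma dsg_hasDeriv (x : ℝ) : HasDerivAt (deriv sg) (deriv (deriv sg) x) x :=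
  (dsg_smooth.differentiable (by simp) x).hasDerivAt

lemma dsg_bound : ∃ B : ℝ, 0 < B ∧ (∀ x, |deriv sg x| ≤ B) ∧ ∀ x, |deriv (deriv sg) x| ≤ B := by
  have h1 : HasCompactSupport (deriv sg) := HasCompactSupport.intro (isCompact_Icc (a := (0:ℝ)) (b := 1))
    fun x hx => by
      by_cases h : x ≤ 0
      · exact dsg_zero h
      · exact dsg_one (by simp at hx; exact (hx (by linarith)).le)
  obtain ⟨B1, hB1⟩ := h1.exists_bound_of_continuous dsg_smooth.continuous
  obtain ⟨B2, hB2⟩ := h1.deriv.exists_bound_of_continuous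
    (contDiff_infty_iff_deriv.1 dsg_smooth).2.continuous
  refine ⟨max 1 (max B1 B2), by positivity, fun x => (hB1 x).trans ?_, fun x => (hB2 x).trans ?_⟩ <;> simp

/-! ### Energy estimate -/

lemma en_alg {n0 n1 n2 d0 d1 d2 d3 w : ℝ} (hn : n0 ^ 2 + n1 ^ 2 + n2 ^ 2 ≤ 1) :
    |d0 * (n0 * d1 + n1 * d2 + n2 * d3)| ≤ (w ^ 2 + (d0 ^ 2 + d1 ^ 2 + d2 ^ 2 + d3 ^ 2)) / 2 := by
  have h1 : (n0 * d1 + n1 * d2 + n2 * d3) ^ 2 ≤ d1 ^ 2 + d2 ^ 2 + d3 ^ 2 := by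
    have h2 : (n0 * d1 + n1 * d2 + n2 * d3) ^ 2 ≤
        (n0 ^ 2 + n1 ^ 2 + n2 ^ 2) * (d1 ^ 2 + d2 ^ 2 + d3 ^ 2) := by
      nlinarith [sq_nonneg (n0 * d2 - n1 * d1), sq_nonneg (n0 * d3 - n2 * d1),
        sq_nonneg (n1 * d3 - n2 * d2)]
    have h3 := mul_le_mul_of_nonneg_right hn (by positivity : 0 ≤ d1 ^ 2 + d2 ^ 2 + d3 ^ 2)
    linarith
  generalize n0 * d1 + n1 * d2 + n2 * d3 = m at *
  rw [abs_le]
  constructor <;> nlinarith [sq_nonneg (d0 + m), sq_nonneg (d0 - m), sq_nonneg w]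

/-- energy density -/
def enr {N : ℕ} (W : Fin N → Spc → ℝ) (p : Spc) : ℝ :=
  ∑ J, (W J p ^ 2 + ∑ α, pd α (W J) p ^ 2) / 2

/-- the first order size -/
def sz {N : ℕ} (W : Fin N → Spc → ℝ) (p : Spc) : ℝ :=
  ∑ J, (|W J p| + ∑ α, |pd α (W J) p|)

lemma enr_nonneg {N : ℕ} (W : Fin N → Spc → ℝ) (p : Spc) : 0 ≤ enr W p :=
  Finset.sum_nonneg fun J _ => by positivity

lemma sz_nonneg {N : ℕ} (W : Fin N → Spc → ℝ) (p : Spc) : 0 ≤ sz W p :=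
  Finset.sum_nonneg fun J _ => by positivity

lemma sz_sq_le {N : ℕ} (W : Fin N → Spc → ℝ) (p : Spc) : sz W p ^ 2 ≤ 10 * N * enr W p := by
  have h1 : sz W p ^ 2 ≤ N * ∑ J, (|W J p| + ∑ α, |pd α (W J) p|) ^ 2 := by
    have := sq_sum_le_card_mul_sum_sq (s := Finset.univ)
      (f := fun J => |W J p| + ∑ α, |pd α (W J) p|)
    simpa [sz] using this
  have h2 : ∀ J, (|W J p| + ∑ α, |pd α (W J) p|) ^ 2 ≤ 5 * (W J p ^ 2 + ∑ α, pd α (W J) p ^ 2) := by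
    intro J
    simp only [Fin.sum_univ_four]
    rw [← sq_abs (W J p), ← sq_abs (pd 0 (W J) p), ← sq_abs (pd 1 (W J) p),
      ← sq_abs (pd 2 (W J) p), ← sq_abs (pd 3 (W J) p)]
    generalize |W J p| = a; generalize |pd 0 (W J) p| = b; generalize |pd 1 (W J) p| = c
    generalize |pd 2 (W J) p| = d; generalize |pd 3 (W J) p| = e
    nlinarith [sq_nonneg (a - b), sq_nonneg (a - c), sq_nonneg (a - d), sq_nonneg (a - e),
      sq_nonneg (b - c), sq_nonneg (b - d), sq_nonneg (b - e), sq_nonneg (c - d),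
      sq_nonneg (c - e), sq_nonneg (d - e)]
  calc sz W p ^ 2 ≤ N * ∑ J, 5 * (W J p ^ 2 + ∑ α, pd α (W J) p ^ 2) := by
        refine h1.trans (mul_le_mul_of_nonneg_left (Finset.sum_le_sum fun J _ => h2 J) (by positivity))
    _ = 10 * N * enr W p := by
        rw [enr, Finset.mul_sum, Finset.mul_sum]
        refine Finset.sum_congr rfl fun J _ => by ring

/-- the energy current -/
def Yc {N : ℕ} (W : Fin N → Spc → ℝ) (α : Fin 4) (p : Spc) : ℝ :=
  if α = 0 then enr W p else - ∑ J, pd 0 (W J) p * pd α (W J) p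

lemma hasPD_Yc {N : ℕ} {W : Fin N → Spc → ℝ} (hW : ∀ J, ContDiff ℝ (⊤ : ℕ∞) (W J)) (p : Spc) :
    (∀ α, HasPD (Yc W α) (fun β => pd β (Yc W α) p) p) ∧
    ∑ α, pd α (Yc W α) p = ∑ J, pd 0 (W J) p * (W J p - box (W J) p) := by
  have h1 := fun J α (x : Spc) => hasPD_of_smooth (p := x) (contDiff_pd (hW J) α).contDiffAt
  have h0 := fun J (x : Spc) => hasPD_of_smooth (p := x) (hW J).contDiffAt
  have hY0 : HasPD (Yc W 0) (fun β => ∑ J, (W J p * pd β (W J) p +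
      ∑ α, pd α (W J) p * pd β (pd α (W J)) p)) p := by
    have : HasPD (Yc W 0) _ p := HasPD.sum Finset.univ fun J _ =>
      (((h0 J p).sq.add (HasPD.sum Finset.univ fun α _ => (h1 J α p).sq)).const_mul (1/2)).congr_f
        (g := fun p => (W J p ^ 2 + ∑ α, pd α (W J) p ^ 2) / 2)
        (Eventually.of_forall fun x => by ring)
    refine this.congr_d fun β => Finset.sum_congr rfl fun J _ => ?_
    simp only [Fin.sum_univ_four]; ring
  have hYi : ∀ i, i ≠ 0 → HasPD (Yc W i) (fun β => - ∑ J, (pd β (pd 0 (W J)) p * pd i (W J) p +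
      pd 0 (W J) p * pd β (pd i (W J)) p)) p := by
    intro i hi
    have : HasPD (fun p => - ∑ J, pd 0 (W J) p * pd i (W J) p) _ p :=
      (HasPD.sum Finset.univ fun J _ => (h1 J 0 p).mul (h1 J i p)).neg
    have e : Yc W i = (fun p => - ∑ J, pd 0 (W J) p * pd i (W J) p) := by
      funext x; simp [Yc, hi]
    rw [e]; exact this
  refine ⟨fun α => ?_, ?_⟩
  · by_cases h : α = 0
    · rw [h]; exact hasPD_of_diff hY0.1
    · exact hasPD_of_diff (hYi α h).1
  · rw [Fin.sum_univ_four, hY0.2, (hYi 1 (by decide)).2, (hYi 2 (by decide)).2,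
      (hYi 3 (by decide)).2]
    beta_reduce
    rw [← Finset.sum_neg_distrib, ← Finset.sum_neg_distrib,
      ← Finset.sum_neg_distrib, ← Finset.sum_add_distrib, ← Finset.sum_add_distrib,
      ← Finset.sum_add_distrib]
    refine Finset.sum_congr rfl fun J _ => ?_
    rw [box_eq]
    simp only [Fin.sum_univ_four, eta_zero, eta_one, eta_two, eta_three]
    have hc := fun α => pd_comm (p := p) (hW J).contDiffAt α 0
    rw [hc 1, hc 2, hc 3]
    ring

lemma contDiff_Yc {N : ℕ} {W : Fin N → Spc → ℝ} (hW : ∀ J, ContDiff ℝ (⊤ : ℕ∞) (W J)) (α : Fin 4) :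
    ContDiff ℝ (⊤ : ℕ∞) (Yc W α) := by
  have h1 := fun J α => contDiff_pd (hW J) α
  have h2 := hW
  have e : ContDiff ℝ (⊤ : ℕ∞) (enr W) := by
    unfold enr; fun_prop
  unfold Yc
  split_ifs
  · exact e
  · fun_prop

end

section
/-- smoothed distance to the centre -/
def SS (η : ℝ) (P : Spc) (p : Spc) : ℝ :=
  Real.sqrt (η ^ 2 + ((co 1 p - co 1 P) ^ 2 + (co 2 p - co 2 P) ^ 2 + (co 3 p - co 3 P) ^ 2))

lemma SS_arg_pos {η : ℝ} (hη : 0 < η) (P p : Spc) :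
    0 < η ^ 2 + ((co 1 p - co 1 P) ^ 2 + (co 2 p - co 2 P) ^ 2 + (co 3 p - co 3 P) ^ 2) := by
  positivity

lemma SS_pos {η : ℝ} (hη : 0 < η) (P p : Spc) : 0 < SS η P p := Real.sqrt_pos.2 (SS_arg_pos hη P p)

lemma SS_sq {η : ℝ} (hη : 0 < η) (P p : Spc) : SS η P p ^ 2 =
    η ^ 2 + ((co 1 p - co 1 P) ^ 2 + (co 2 p - co 2 P) ^ 2 + (co 3 p - co 3 P) ^ 2) :=
  Real.sq_sqrt (SS_arg_pos hη P p).le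

lemma contDiff_SS {η : ℝ} (hη : 0 < η) (P : Spc) : ContDiff ℝ (⊤ : ℕ∞) (SS η P) := by
  have h := fun α => contDiff_co (n := (⊤ : ℕ∞)) α
  unfold SS
  apply ContDiff.sqrt
  · fun_prop
  · exact fun x => (SS_arg_pos hη P x).ne'

lemma hasPD_SS {η : ℝ} (hη : 0 < η) (P p : Spc) :
    HasPD (SS η P) (fun α => if α = 0 then 0 else (co α p - co α P) / SS η P p) p := by
  have h : ∀ α, HasPD (fun p => (co α p - co α P) ^ 2) _ p := fun α =>
    ((hasPD_co α p).sub (hasPD_const (co α P) p)).sq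
  have h2 := (hasPD_const (η ^ 2) p).add (((h 1).add (h 2)).add (h 3))
  have h3 : HasPD (SS η P) _ p := h2.comp (Real.hasDerivAt_sqrt (SS_arg_pos hη P p).ne')
  refine h3.congr_d fun α => ?_
  rw [← SS]
  have := (SS_pos hη P p).ne'
  fin_cases α <;> simp <;> field_simp

/-- the energy weight -/
def GG (ς ρ η l ε : ℝ) (P : Spc) (p : Spc) : ℝ :=
  sg (ε⁻¹ * (ς * (co 0 p - co 0 P)) - 1) *
    (Real.exp (-l * (ς * (co 0 p - co 0 P))) * sg (ρ - ς * (co 0 p - co 0 P) - SS η P p))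

lemma contDiff_GG {η : ℝ} (hη : 0 < η) (ς ρ l ε : ℝ) (P : Spc) :
    ContDiff ℝ (⊤ : ℕ∞) (GG ς ρ η l ε P) := by
  have h0 : ContDiff ℝ (⊤ : ℕ∞) (co 0) := contDiff_co 0
  have h1 := contDiff_SS hη P
  unfold GG
  refine (sg_smooth.comp ?_).mul (ContDiff.mul (ContDiff.exp ?_) (sg_smooth.comp ?_)) <;> fun_prop

lemma hasPD_GG {η : ℝ} (hη : 0 < η) (ς ρ l ε : ℝ) (P p : Spc) :
    HasPD (GG ς ρ η l ε P) (fun α => if α = 0 then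
      ς * (deriv sg (ε⁻¹ * (ς * (co 0 p - co 0 P)) - 1) * ε⁻¹ *
        (Real.exp (-l * (ς * (co 0 p - co 0 P))) * sg (ρ - ς * (co 0 p - co 0 P) - SS η P p))
       - l * GG ς ρ η l ε P p - sg (ε⁻¹ * (ς * (co 0 p - co 0 P)) - 1) *
       (Real.exp (-l * (ς * (co 0 p - co 0 P))) * deriv sg (ρ - ς * (co 0 p - co 0 P) - SS η P p)))
      else - (sg (ε⁻¹ * (ς * (co 0 p - co 0 P)) - 1) *
       (Real.exp (-l * (ς * (co 0 p - co 0 P))) * deriv sg (ρ - ς * (co 0 p - co 0 P) - SS η P p)))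
        * ((co α p - co α P) / SS η P p)) p := by
  have hτ : HasPD (fun p => ς * (co 0 p - co 0 P)) _ p :=
    ((hasPD_co 0 p).sub (hasPD_const (co 0 P) p)).const_mul ς
  have h1 := ((hτ.const_mul ε⁻¹).sub (hasPD_const 1 p)).comp (sg_hasDeriv _)
  have h2 := (hτ.const_mul (-l)).comp (Real.hasDerivAt_exp _)
  have h3 := (((hasPD_const ρ p).sub hτ).sub (hasPD_SS hη P p)).comp (sg_hasDeriv _)
  have h4 : HasPD (GG ς ρ η l ε P) _ p := h1.mul (h2.mul h3)
  refine h4.congr_d fun α => ?_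
  by_cases h : α = 0
  · subst h; simp [GG]; ring
  · simp [h, Ne.symm h]; ring

/-- pointwise energy inequality -/
lemma en_pt {N : ℕ} {W : Fin N → Spc → ℝ} (hW : ∀ J, ContDiff ℝ (⊤ : ℕ∞) (W J))
    {η ς ρ l ε C : ℝ} {P p : Spc} (hη : 0 < η) (hς : ς * ς = 1)
    (hG : GG ς ρ η l ε P p ≠ 0 → ∀ I, |box (W I) p| ≤ C * sz W p)
    (hC : 0 ≤ C) (hl : l = 2 + 10 * N * C) :
    ς * ∑ α, pd α (fun x => GG ς ρ η l ε P x * Yc W α x) p ≤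
      deriv sg (ε⁻¹ * (ς * (co 0 p - co 0 P)) - 1) * ε⁻¹ *
        (Real.exp (-l * (ς * (co 0 p - co 0 P))) * sg (ρ - ς * (co 0 p - co 0 P) - SS η P p))
        * enr W p - GG ς ρ η l ε P p * enr W p := by
  obtain ⟨hY, hYd⟩ := hasPD_Yc hW p
  have hGp := hasPD_GG hη ς ρ l ε P p
  have e1 : ∑ α, pd α (fun x => GG ς ρ η l ε P x * Yc W α x) p =
      ∑ α, pd α (GG ς ρ η l ε P) p * Yc W α p + GG ς ρ η l ε P p * ∑ α, pd α (Yc W α) p := by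
    rw [Finset.mul_sum, ← Finset.sum_add_distrib]
    refine Finset.sum_congr rfl fun α _ => ?_
    rw [(hGp.mul (hY α)).2 α, hGp.2 α]
  rw [e1, hYd]
  have hG0 : 0 ≤ GG ς ρ η l ε P p :=
    mul_nonneg (sg_nonneg _) (mul_nonneg (Real.exp_pos _).le (sg_nonneg _))
  -- source term
  have hsrc : ς * (GG ς ρ η l ε P p * ∑ J, pd 0 (W J) p * (W J p - box (W J) p)) ≤
      GG ς ρ η l ε P p * ((l - 1) * enr W p) := by
    by_cases hg : GG ς ρ η l ε P p = 0
    · simp [hg]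
    have hb := hG hg
    have hςa : |ς| = 1 := by
      have : |ς| * |ς| = 1 := by rw [← abs_mul, hς, abs_one]
      nlinarith [abs_nonneg ς]
    have h1 : |∑ J, pd 0 (W J) p * (W J p - box (W J) p)| ≤ (l - 1) * enr W p := by
      have h2 : ∀ J, |pd 0 (W J) p * (W J p - box (W J) p)| ≤
          (W J p ^ 2 + ∑ α, pd α (W J) p ^ 2) / 2 + C * sz W p *
            (|W J p| + ∑ α, |pd α (W J) p|) := by
        intro J
        rw [abs_mul]
        have h3 : |W J p - box (W J) p| ≤ |W J p| + C * sz W p :=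
          (abs_sub _ _).trans (by linarith [hb J])
        have h4 := mul_le_mul_of_nonneg_left h3 (abs_nonneg (pd 0 (W J) p))
        have h5 : |pd 0 (W J) p| * |W J p| ≤ (W J p ^ 2 + ∑ α, pd α (W J) p ^ 2) / 2 := by
          have : 0 ≤ pd 1 (W J) p ^ 2 + pd 2 (W J) p ^ 2 + pd 3 (W J) p ^ 2 := by positivity
          rw [Fin.sum_univ_four, ← sq_abs (W J p), ← sq_abs (pd 0 (W J) p)]
          nlinarith [sq_nonneg (|pd 0 (W J) p| - |W J p|)]
        have h6 : C * sz W p * |pd 0 (W J) p| ≤ C * sz W p * (|W J p| + ∑ α, |pd α (W J) p|) := by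
          apply mul_le_mul_of_nonneg_left _ (mul_nonneg hC (sz_nonneg W p))
          rw [Fin.sum_univ_four]
          linarith [abs_nonneg (W J p), abs_nonneg (pd 1 (W J) p), abs_nonneg (pd 2 (W J) p),
            abs_nonneg (pd 3 (W J) p)]
        linarith
      have h7 := (Finset.abs_sum_le_sum_abs (fun J => pd 0 (W J) p * (W J p - box (W J) p))
        Finset.univ).trans (Finset.sum_le_sum fun J _ => h2 J)
      rw [Finset.sum_add_distrib, ← Finset.mul_sum] at h7
      have h8 : C * sz W p * sz W p ≤ C * (10 * N * enr W p) := by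
        have := mul_le_mul_of_nonneg_left (sz_sq_le W p) hC
        linarith
      change _ ≤ enr W p + C * sz W p * sz W p at h7
      rw [hl]; linarith
    calc ς * (GG ς ρ η l ε P p * ∑ J, pd 0 (W J) p * (W J p - box (W J) p))
        ≤ |ς * (GG ς ρ η l ε P p * ∑ J, pd 0 (W J) p * (W J p - box (W J) p))| := le_abs_self _
      _ = GG ς ρ η l ε P p * |∑ J, pd 0 (W J) p * (W J p - box (W J) p)| := by
          rw [abs_mul, abs_mul, hςa, abs_of_nonneg hG0, one_mul]
      _ ≤ _ := mul_le_mul_of_nonneg_left h1 hG0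
  -- boundary term
  have hS := SS_pos hη P p
  have hn : ((co 1 p - co 1 P) / SS η P p) ^ 2 + ((co 2 p - co 2 P) / SS η P p) ^ 2 +
      ((co 3 p - co 3 P) / SS η P p) ^ 2 ≤ 1 := by
    rw [div_pow, div_pow, div_pow, ← add_div, ← add_div, div_le_one (by positivity), SS_sq hη]
    nlinarith
  have hb0 : 0 ≤ sg (ε⁻¹ * (ς * (co 0 p - co 0 P)) - 1) *
       (Real.exp (-l * (ς * (co 0 p - co 0 P))) * deriv sg (ρ - ς * (co 0 p - co 0 P) - SS η P p)) :=
    mul_nonneg (sg_nonneg _) (mul_nonneg (Real.exp_pos _).le (dsg_nonneg _))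
  rw [Fin.sum_univ_four (fun α => pd α (GG ς ρ η l ε P) p * Yc W α p), hGp.2, hGp.2, hGp.2, hGp.2]
  simp only [Yc, if_true, one_ne_zero, if_false, show (2 : Fin 4) ≠ 0 by decide,
    show (3 : Fin 4) ≠ 0 by decide]
  generalize sg (ε⁻¹ * (ς * (co 0 p - co 0 P)) - 1) *
       (Real.exp (-l * (ς * (co 0 p - co 0 P))) * deriv sg (ρ - ς * (co 0 p - co 0 P) - SS η P p))
       = b at *
  generalize deriv sg (ε⁻¹ * (ς * (co 0 p - co 0 P)) - 1) * ε⁻¹ *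
        (Real.exp (-l * (ς * (co 0 p - co 0 P))) * sg (ρ - ς * (co 0 p - co 0 P) - SS η P p)) = k at *
  generalize GG ς ρ η l ε P p = g at *
  generalize (co 1 p - co 1 P) / SS η P p = n1 at *
  generalize (co 2 p - co 2 P) / SS η P p = n2 at *
  generalize (co 3 p - co 3 P) / SS η P p = n3 at *
  have hm : ς * (n1 * (∑ J, pd 0 (W J) p * pd 1 (W J) p) + n2 * (∑ J, pd 0 (W J) p * pd 2 (W J) p)
      + n3 * ∑ J, pd 0 (W J) p * pd 3 (W J) p) ≤ enr W p := by
    rw [Finset.mul_sum, Finset.mul_sum, Finset.mul_sum, ← Finset.sum_add_distrib,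
      ← Finset.sum_add_distrib, Finset.mul_sum, enr]
    refine Finset.sum_le_sum fun J _ => ?_
    have := en_alg (d0 := ς * pd 0 (W J) p) (d1 := pd 1 (W J) p) (d2 := pd 2 (W J) p)
      (d3 := pd 3 (W J) p) (w := W J p) hn
    rw [Fin.sum_univ_four]
    have e : (ς * pd 0 (W J) p) ^ 2 = pd 0 (W J) p ^ 2 := by
      rw [mul_pow, pow_two ς, hς, one_mul]
    rw [e] at this
    refine le_trans (le_of_eq ?_) ((le_abs_self _).trans (this.trans (le_of_eq ?_))) <;> ring
  have hm2 := mul_le_mul_of_nonneg_left hm hb0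
  generalize enr W p = en at *
  generalize (∑ J, pd 0 (W J) p * pd 1 (W J) p) = m1 at *
  generalize (∑ J, pd 0 (W J) p * pd 2 (W J) p) = m2 at *
  generalize (∑ J, pd 0 (W J) p * pd 3 (W J) p) = m3 at *
  generalize (∑ J, pd 0 (W J) p * (W J p - box (W J) p)) = src at *
  have e3 : ς * (ς * (k - l * g - b) * en + -b * n1 * -m1 + -b * n2 * -m2 + -b * n3 * -m3 + g * src)
     = (ς * ς) * ((k - l * g - b) * en) + b * (ς * (n1 * m1 + n2 * m2 + n3 * m3)) + ς * (g * src) := by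
    ring
  rw [e3, hς]
  linarith

end

section
lemma norm_sub_sq (P p : Spc) : ‖p.2 - P.2‖ ^ 2 =
    (co 1 p - co 1 P) ^ 2 + (co 2 p - co 2 P) ^ 2 + (co 3 p - co 3 P) ^ 2 := by
  have := norm_sq_snd (p - P)
  rw [co_sub, co_sub, co_sub] at this
  exact this

lemma le_SS {η : ℝ} (hη : 0 < η) (P p : Spc) : ‖p.2 - P.2‖ ≤ SS η P p := by
  apply Real.le_sqrt_of_sq_le
  rw [norm_sub_sq]; nlinarith

lemma SS_le {η : ℝ} (hη : 0 < η) (P p : Spc) : SS η P p ≤ η + ‖p.2 - P.2‖ := by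
  have h := norm_nonneg (p.2 - P.2)
  apply Real.sqrt_le_iff.2 ⟨by positivity, ?_⟩
  rw [← norm_sub_sq]; nlinarith

lemma slice_hasDeriv {f : Spc → ℝ} (hf : ContDiff ℝ (⊤ : ℕ∞) f) (t : ℝ) (x : EuclideanSpace ℝ (Fin 3)) :
    HasDerivAt (fun s : ℝ => f (s, x)) (pd 0 f (t, x)) t := by
  have h1 : HasDerivAt (fun s : ℝ => ((s, x) : Spc)) (eVec 0) t :=
    (hasDerivAt_id t).prodMk (hasDerivAt_const t x)
  exact (diffAt_of_smooth (p := (t, x)) hf.contDiffAt).hasFDerivAt.comp_hasDerivAt t h1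

lemma lin_bound {f : Spc → ℝ} (hf : ContDiff ℝ (⊤ : ℕ∞) f) {ς ρ : ℝ} {P : Spc} (hς : |ς| = 1)
    (h0 : ∀ x, ‖x - P.2‖ < ρ → f (P.1, x) = 0) :
    ∃ B, 0 ≤ B ∧ ∀ p : Spc, 0 ≤ ς * (co 0 p - co 0 P) → ‖p.2 - P.2‖ < ρ - ς * (co 0 p - co 0 P) →
      |f p| ≤ B * (ς * (co 0 p - co 0 P)) := by
  obtain ⟨B, hB⟩ := (isCompact_closedBall P ρ).exists_bound_of_continuousOn
    (contDiff_pd hf 0).continuous.continuousOn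
  refine ⟨|B|, abs_nonneg B, fun p h1 h2 => ?_⟩
  have habs : |co 0 p - co 0 P| = ς * (co 0 p - co 0 P) := by
    rw [← abs_of_nonneg h1, abs_mul, hς, one_mul]
  have hlt : |p.1 - P.1| < ρ := by
    have : |p.1 - P.1| = ς * (co 0 p - co 0 P) := habs
    linarith [norm_nonneg (p.2 - P.2)]
  have hx : ‖p.2 - P.2‖ < ρ := by linarith
  have hmem : ∀ s ∈ uIcc P.1 p.1, ((s, p.2) : Spc) ∈ Metric.closedBall P ρ := by
    intro s hs
    rw [Metric.mem_closedBall, dist_eq_norm, Prod.norm_def]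
    refine max_le ?_ hx.le
    have := abs_sub_left_of_mem_uIcc hs
    exact this.trans (le_of_lt hlt)
  have := Convex.norm_image_sub_le_of_norm_deriv_le (f := fun s : ℝ => f (s, p.2))
    (s := uIcc P.1 p.1) (x := P.1) (y := p.1) (C := |B|)
    (fun s _ => (slice_hasDeriv hf s p.2).differentiableAt)
    (fun s hs => by
      rw [(slice_hasDeriv hf s p.2).deriv]
      exact (hB _ (hmem s hs)).trans (le_abs_self B)) (convex_uIcc _ _) left_mem_uIcc right_mem_uIcc
  rw [h0 _ hx, sub_zero] at this
  rw [← habs]; exact this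

lemma pd_slice_zero {f : Spc → ℝ} (hf : ContDiff ℝ (⊤ : ℕ∞) f) {ρ : ℝ} {P : Spc}
    (h0 : ∀ x, ‖x - P.2‖ < ρ → f (P.1, x) = 0) (i : Fin 3) :
    ∀ x, ‖x - P.2‖ < ρ → pd i.succ f (P.1, x) = 0 := by
  intro x hx
  have h1 : HasDerivAt (fun s : ℝ => ((P.1, x + s • EuclideanSpace.single i (1:ℝ)) : Spc))
      (eVec i.succ) 0 := by
    have := (hasDerivAt_const (0:ℝ) P.1).prodMk
      (((hasDerivAt_id (0:ℝ)).smul_const (EuclideanSpace.single i (1:ℝ))).const_add x)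
    simpa [eVec] using this
  have h2 : HasDerivAt (fun s : ℝ => f ((P.1, x + s • EuclideanSpace.single i (1:ℝ)) : Spc))
      (pd i.succ f (P.1, x)) 0 := by
    have h3 := (diffAt_of_smooth (p := (P.1, x + (0:ℝ) • EuclideanSpace.single i (1:ℝ)))
      hf.contDiffAt).hasFDerivAt.comp_hasDerivAt 0 h1
    simp only [zero_smul, add_zero] at h3
    exact h3
  have h4 : (fun s : ℝ => f ((P.1, x + s • EuclideanSpace.single i (1:ℝ)) : Spc)) =ᶠ[𝓝 0]
      fun _ => 0 := by
    have hc : Continuous fun s : ℝ => ‖x + s • EuclideanSpace.single i (1:ℝ) - P.2‖ := by fun_prop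
    have := hc.continuousAt.eventually_lt (x₀ := (0:ℝ)) (continuousAt_const (y := ρ)) (by simpa using hx)
    filter_upwards [this] with s hs using h0 _ hs
  exact h2.unique ((hasDerivAt_const (0:ℝ) (0:ℝ)).congr_of_eventuallyEq h4)

lemma enr_bound {N : ℕ} {W : Fin N → Spc → ℝ} (hW : ∀ J, ContDiff ℝ (⊤ : ℕ∞) (W J))
    {ς ρ : ℝ} {P : Spc} (hς : |ς| = 1)
    (h0 : ∀ x, ‖x - P.2‖ < ρ → ∀ I, W I (P.1, x) = 0 ∧ dt (W I) (P.1, x) = 0) :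
    ∃ B, 0 ≤ B ∧ ∀ p : Spc, 0 ≤ ς * (co 0 p - co 0 P) → ‖p.2 - P.2‖ < ρ - ς * (co 0 p - co 0 P) →
      enr W p ≤ B * (ς * (co 0 p - co 0 P)) ^ 2 := by
  choose B hB0 hB using fun J => lin_bound (hW J) hς (fun x hx => (h0 x hx J).1)
  have hz : ∀ J α x, ‖x - P.2‖ < ρ → pd α (W J) (P.1, x) = 0 := by
    intro J α
    refine Fin.cases ?_ (fun i => ?_) α
    · exact fun x hx => (h0 x hx J).2
    · exact pd_slice_zero (hW J) (fun x hx => (h0 x hx J).1) i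
  choose B' hB0' hB' using fun J α => lin_bound (contDiff_pd (hW J) α) hς (hz J α)
  refine ⟨∑ J, (B J ^ 2 + ∑ α, B' J α ^ 2) / 2, Finset.sum_nonneg fun J _ => by positivity,
    fun p h1 h2 => ?_⟩
  rw [enr, Finset.sum_mul]
  refine Finset.sum_le_sum fun J _ => ?_
  have a1 : W J p ^ 2 ≤ B J ^ 2 * (ς * (co 0 p - co 0 P)) ^ 2 := by
    rw [← mul_pow, ← sq_abs]; exact pow_le_pow_left₀ (abs_nonneg _) (hB J p h1 h2) 2
  have a2 : ∑ α, pd α (W J) p ^ 2 ≤ (∑ α, B' J α ^ 2) * (ς * (co 0 p - co 0 P)) ^ 2 := by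
    rw [Finset.sum_mul]
    refine Finset.sum_le_sum fun α _ => ?_
    rw [← mul_pow, ← sq_abs]; exact pow_le_pow_left₀ (abs_nonneg _) (hB' J α p h1 h2) 2
  linarith

theorem energy {N : ℕ} {W : Fin N → Spc → ℝ} (hW : ∀ J, ContDiff ℝ (⊤ : ℕ∞) (W J))
    {ς ρ C : ℝ} {P : Spc} (hς : |ς| = 1) (hC : 0 ≤ C)
    (h0 : ∀ x, ‖x - P.2‖ < ρ → ∀ I, W I (P.1, x) = 0 ∧ dt (W I) (P.1, x) = 0)
    (hbox : ∀ p : Spc, 0 ≤ ς * (p.1 - P.1) → ‖p.2 - P.2‖ < ρ - ς * (p.1 - P.1) →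
      ∀ I, |box (W I) p| ≤ C * sz W p) :
    ∀ p : Spc, 0 ≤ ς * (p.1 - P.1) → ‖p.2 - P.2‖ < ρ - ς * (p.1 - P.1) → ∀ I, W I p = 0 := by
  intro p hp1 hp2 I
  have hςς : ς * ς = 1 := by rw [← abs_mul_abs_self, hς, one_mul]
  have hς0 : ς ≠ 0 := by rintro rfl; simp at hςς
  rcases hp1.eq_or_lt with h | hpos
  · have : p.1 = P.1 := by
      rcases mul_eq_zero.1 h.symm with h | h
      · exact absurd h hς0
      · linarith
    rw [this] at hp2
    simp only [sub_self, mul_zero, sub_zero] at hp2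
    have := (h0 _ hp2 I).1
    rwa [← ‹p.1 = P.1›] at this
  obtain ⟨η, hηd⟩ : ∃ η, η = (ρ - ς * (p.1 - P.1) - ‖p.2 - P.2‖) / 2 := ⟨_, rfl⟩
  have hη : 0 < η := by rw [hηd]; linarith
  obtain ⟨l, hl⟩ : ∃ l, l = 2 + 10 * N * C := ⟨_, rfl⟩
  have hl0 : 0 ≤ l := by rw [hl]; positivity
  obtain ⟨B, hB0, hB⟩ := enr_bound hW hς h0
  obtain ⟨b, hb0, hb, -⟩ := dsg_bound
  -- support facts
  have hpsi : ∀ x, sg (ρ - ς * (co 0 x - co 0 P) - SS η P x) ≠ 0 →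
      ‖x.2 - P.2‖ < ρ - ς * (co 0 x - co 0 P) := by
    intro x hx
    by_contra h
    exact hx (sg_zero (by linarith [le_SS hη P x]))
  have hball : ∀ x : Spc, 0 ≤ ς * (co 0 x - co 0 P) → ‖x.2 - P.2‖ < ρ - ς * (co 0 x - co 0 P) →
      x ∈ Metric.closedBall P ρ := by
    intro x h1 h2
    rw [Metric.mem_closedBall, dist_eq_norm, Prod.norm_def]
    refine max_le ?_ (by change ‖x.2 - P.2‖ ≤ ρ; linarith)
    have : |x.1 - P.1| = ς * (co 0 x - co 0 P) := by
      rw [← abs_of_nonneg h1, abs_mul, hς, one_mul]; rfl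
    change |x.1 - P.1| ≤ ρ
    linarith [norm_nonneg (x.2 - P.2)]
  have hGs : ∀ ε, 0 < ε → ∀ x, GG ς ρ η l ε P x ≠ 0 → 0 ≤ ς * (co 0 x - co 0 P) ∧
      ‖x.2 - P.2‖ < ρ - ς * (co 0 x - co 0 P) := by
    intro ε hε x hx
    have h1 := left_ne_zero_of_mul hx
    have h2 := right_ne_zero_of_mul (right_ne_zero_of_mul hx)
    refine ⟨?_, hpsi x h2⟩
    by_contra h
    apply h1
    apply sg_zero
    have := mul_neg_of_pos_of_neg (inv_pos.2 hε) (not_le.1 h)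
    linarith
  have hGc : ∀ ε, 0 < ε → HasCompactSupport (GG ς ρ η l ε P) := fun ε hε =>
    HasCompactSupport.intro (isCompact_closedBall P ρ) fun x hx => by
      by_contra h
      exact hx (hball x (hGs ε hε x h).1 (hGs ε hε x h).2)
  have hec : Continuous (enr W) := by
    have := (contDiff_Yc hW 0).continuous
    exact this
  have hGe : ∀ ε, 0 < ε → Continuous (fun x => GG ς ρ η l ε P x * enr W x) ∧
      HasCompactSupport (fun x => GG ς ρ η l ε P x * enr W x) := fun ε hε =>
    ⟨(contDiff_GG hη ς ρ l ε P).continuous.mul hec, (hGc ε hε).mul_right⟩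
  -- main estimate
  have main : ∀ ε, 0 < ε → ∫ x, GG ς ρ η l ε P x * enr W x ≤
      (b * (4 * B) * volume.real (Metric.closedBall P ρ)) * ε := by
    intro ε hε
    have hsm := fun α => (contDiff_GG hη ς ρ l ε P).mul (contDiff_Yc hW α)
    have hcs := fun α => (hGc ε hε).mul_right (f' := Yc W α)
    have hdiv : ∫ x, ∑ α, pd α (fun x => GG ς ρ η l ε P x * Yc W α x) x = 0 :=
      integral_div_eq_zero (fun α => (hsm α).of_le (by simp)) hcs
    have hdi : Integrable fun x => ∑ α, pd α (fun x => GG ς ρ η l ε P x * Yc W α x) x :=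
      integrable_finsetSum _ fun α _ => ((contDiff_pd (hsm α) α).continuous).integrable_of_hasCompactSupport
      (hasCompactSupport_pd (hcs α) α)
    set k : Spc → ℝ := fun p => deriv sg (ε⁻¹ * (ς * (co 0 p - co 0 P)) - 1) * ε⁻¹ *
        (Real.exp (-l * (ς * (co 0 p - co 0 P))) * sg (ρ - ς * (co 0 p - co 0 P) - SS η P p))
        * enr W p with hk
    have hks : ∀ x, k x ≠ 0 → 0 ≤ ς * (co 0 x - co 0 P) ∧ ς * (co 0 x - co 0 P) ≤ 2 * ε ∧
        ‖x.2 - P.2‖ < ρ - ς * (co 0 x - co 0 P) := by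
      intro x hx
      have h1 := left_ne_zero_of_mul hx
      have h2 := left_ne_zero_of_mul (left_ne_zero_of_mul h1)
      have h3 := right_ne_zero_of_mul (right_ne_zero_of_mul h1)
      have h4 : 0 < ε⁻¹ * (ς * (co 0 x - co 0 P)) - 1 := by
        by_contra h; exact h2 (dsg_zero (not_lt.1 h))
      have h5 : ε⁻¹ * (ς * (co 0 x - co 0 P)) - 1 < 1 := by
        by_contra h; exact h2 (dsg_one (not_lt.1 h))
      have h6 : ς * (co 0 x - co 0 P) = ε * (ε⁻¹ * (ς * (co 0 x - co 0 P))) := by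
        field_simp
      refine ⟨?_, ?_, hpsi x h3⟩
      · rw [h6]; exact mul_nonneg hε.le (by linarith)
      · rw [h6]; nlinarith
    have hkc : Continuous k := by
      have c0 := continuous_co 0
      have c1 := (contDiff_SS hη P).continuous
      have c2 := dsg_smooth.continuous
      have c3 := sg_smooth.continuous
      rw [hk]
      refine (((c2.comp ?_).mul continuous_const).mul (Continuous.mul (Continuous.rexp ?_) (c3.comp ?_))).mul hec <;>
      fun_prop
    have hkcs : HasCompactSupport k := HasCompactSupport.intro (isCompact_closedBall P ρ) fun x hx => by
      by_contra h
      exact hx (hball x (hks x h).1 (hks x h).2.2)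
    have hki := hkc.integrable_of_hasCompactSupport (μ := volume) hkcs
    have hGi := (hGe ε hε).1.integrable_of_hasCompactSupport (μ := volume) (hGe ε hε).2
    have hmono := integral_mono (hdi.const_mul ς) (hki.sub hGi) fun x =>
      en_pt hW (ρ := ρ) (l := l) (ε := ε) (P := P) hη hςς
        (fun hg I => hbox x (hGs ε hε x hg).1 (hGs ε hε x hg).2 I) hC hl
    rw [integral_const_mul, hdiv, mul_zero, Pi.sub_def, integral_sub hki hGi] at hmono
    have hkb : ∫ x, k x ≤ (b * (4 * B) * ε) * volume.real (Metric.closedBall P ρ) := by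
      rw [← setIntegral_eq_integral_of_forall_compl_eq_zero (s := Metric.closedBall P ρ)
        (fun x hx => by by_contra h; exact hx (hball x (hks x h).1 (hks x h).2.2))]
      refine (le_abs_self _).trans ?_
      rw [← Real.norm_eq_abs]
      refine norm_setIntegral_le_of_norm_le_const (isCompact_closedBall P ρ).measure_lt_top
        fun x _ => ?_
      by_cases hx : k x = 0
      · rw [hx, norm_zero]; positivity
      obtain ⟨h1, h2, h3⟩ := hks x hx
      have he := hB x h1 h3
      have he2 : enr W x ≤ 4 * B * ε ^ 2 := by
        have : (ς * (co 0 x - co 0 P)) ^ 2 ≤ (2 * ε) ^ 2 := pow_le_pow_left₀ h1 h2 2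
        nlinarith
      have hex : Real.exp (-l * (ς * (co 0 x - co 0 P))) ≤ 1 := by
        apply Real.exp_le_one_iff.2
        have := mul_nonneg hl0 h1
        linarith
      have hE : |Real.exp (-l * (ς * (co 0 x - co 0 P))) * sg (ρ - ς * (co 0 x - co 0 P) - SS η P x)| ≤ 1 := by
        rw [abs_of_nonneg (mul_nonneg (Real.exp_pos _).le (sg_nonneg _))]
        exact mul_le_one₀ hex (sg_nonneg _) (sg_le_one _)
      have hbx := hb (ε⁻¹ * (ς * (co 0 x - co 0 P)) - 1)
      rw [hk, Real.norm_eq_abs, abs_mul, abs_mul, abs_mul, abs_of_nonneg (enr_nonneg W x),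
        abs_of_pos (inv_pos.2 hε)]
      calc _ ≤ b * ε⁻¹ * 1 * (4 * B * ε ^ 2) := by
            gcongr
            exact enr_nonneg W x
        _ = b * (4 * B) * ε := by field_simp
    linarith
  -- conclusion
  obtain ⟨ε0, hε0d⟩ : ∃ ε0, ε0 = ς * (p.1 - P.1) / 2 := ⟨_, rfl⟩
  have hε0 : 0 < ε0 := by rw [hε0d]; linarith
  have hle : ∀ ε, 0 < ε → ε ≤ ε0 → ∫ x, GG ς ρ η l ε0 P x * enr W x ≤
      (b * (4 * B) * volume.real (Metric.closedBall P ρ)) * ε := by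
    intro ε hε hεle
    refine le_trans (integral_mono
      ((hGe ε0 hε0).1.integrable_of_hasCompactSupport (hGe ε0 hε0).2)
      ((hGe ε hε).1.integrable_of_hasCompactSupport (hGe ε hε).2) fun x => ?_) (main ε hε)
    apply mul_le_mul_of_nonneg_right _ (enr_nonneg W x)
    have hr : 0 ≤ Real.exp (-l * (ς * (co 0 x - co 0 P))) * sg (ρ - ς * (co 0 x - co 0 P) - SS η P x) :=
      mul_nonneg (Real.exp_pos _).le (sg_nonneg _)
    apply mul_le_mul_of_nonneg_right _ hr
    by_cases hτ : 0 ≤ ς * (co 0 x - co 0 P)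
    · apply Real.smoothTransition.monotone
      have : ε0⁻¹ ≤ ε⁻¹ := inv_anti₀ hε hεle
      have := mul_le_mul_of_nonneg_right this hτ
      linarith
    · rw [sg_zero]
      · exact sg_nonneg _
      · have := mul_neg_of_pos_of_neg (inv_pos.2 hε0) (not_le.1 hτ)
        linarith
  have hz : ∫ x, GG ς ρ η l ε0 P x * enr W x ≤ 0 := by
    have ht : Tendsto (fun ε : ℝ => (b * (4 * B) * volume.real (Metric.closedBall P ρ)) * ε)
        (𝓝[>] 0) (𝓝 0) := by
      have : Continuous fun ε : ℝ => (b * (4 * B) * volume.real (Metric.closedBall P ρ)) * ε := by fun_prop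
      have h := this.tendsto 0
      rw [mul_zero] at h
      exact h.mono_left nhdsWithin_le_nhds
    refine ge_of_tendsto ht ?_
    filter_upwards [Ioc_mem_nhdsGT hε0] with ε hε using hle ε hε.1 hε.2
  have hzero : GG ς ρ η l ε0 P p * enr W p = 0 := by
    by_contra h
    have := Continuous.integral_pos_of_hasCompactSupport_nonneg_nonzero (μ := volume) (hGe ε0 hε0).1
      (hGe ε0 hε0).2 (fun x => mul_nonneg (mul_nonneg (sg_nonneg _) (mul_nonneg (Real.exp_pos _).le
        (sg_nonneg _))) (enr_nonneg W x)) h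
    linarith
  have hGp : 0 < GG ς ρ η l ε0 P p := by
    unfold GG
    refine mul_pos ?_ (mul_pos (Real.exp_pos _) (Real.smoothTransition.pos_of_pos ?_))
    · rw [sg_one]
      · exact one_pos
      · change 1 ≤ ε0⁻¹ * (ς * (p.1 - P.1)) - 1
        have : ς * (p.1 - P.1) = 2 * ε0 := by rw [hε0d]; ring
        rw [this]; field_simp; norm_num
    · have := SS_le hη P p
      change 0 < ρ - ς * (p.1 - P.1) - SS η P p
      linarith
  have he0 : enr W p = 0 := by
    rcases mul_eq_zero.1 hzero with h | h
    · exact absurd h hGp.ne'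
    · exact h
  have := (Finset.sum_eq_zero_iff_of_nonneg (fun J _ => by positivity)).1 he0 I (Finset.mem_univ I)
  have h2 : 0 ≤ ∑ α, pd α (W I) p ^ 2 := by positivity
  have h3 : W I p ^ 2 = 0 := by nlinarith [sq_nonneg (W I p)]
  exact pow_eq_zero_iff (two_ne_zero) |>.1 h3

end

section
lemma box_mul {f g : Spc → ℝ} {p : Spc} (hf : ContDiffAt ℝ (⊤ : ℕ∞) f p)
    (hg : ContDiffAt ℝ (⊤ : ℕ∞) g p) :
    (∀ α, pd α (fun x => f x * g x) p = pd α f p * g p + f p * pd α g p) ∧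
    box (fun x => f x * g x) p = f p * box g p + 2 * (∑ α, eta α * (pd α f p * pd α g p))
      + box f p * g p := by
  have ev : ∀ {h : Spc → ℝ}, ContDiffAt ℝ (⊤ : ℕ∞) h p → ∀ᶠ x in 𝓝 p, DifferentiableAt ℝ h x := by
    intro h hh
    filter_upwards [(hh.of_le (m := 1) (by simp)).eventually (by simp)] with x hx
      using hx.differentiableAt (by simp)
  have e1 : ∀ α, pd α (fun x => f x * g x) =ᶠ[𝓝 p] fun x => pd α f x * g x + f x * pd α g x := by
    intro α
    filter_upwards [ev hf, ev hg] with x h1 h2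
    exact ((hasPD_of_diff h1).mul (hasPD_of_diff h2)).2 α
  refine ⟨fun α => (e1 α).eq_of_nhds, ?_⟩
  simp only [box_eq]
  have h2 : ∀ α, pd α (pd α (fun x => f x * g x)) p =
      f p * pd α (pd α g) p + 2 * (pd α f p * pd α g p) + pd α (pd α f) p * g p := by
    intro α
    rw [pd_congr (e1 α) α]
    have := (((hasPD_of_smooth (contDiffAt_pd hf α)).mul (hasPD_of_smooth hg)).add
      ((hasPD_of_smooth hf).mul (hasPD_of_smooth (contDiffAt_pd hg α)))).2 α
    rw [this]; ring
  simp only [h2, Fin.sum_univ_four]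
  ring

/-- the scaling field in coordinates -/
def Sx (w : Spc → ℝ) (p : Spc) : ℝ := ∑ α, co α p * pd α w p

lemma kap_facts (ε : ℝ) (p : Spc) :
    ContDiffAt ℝ (⊤ : ℕ∞) (fun y => sg (ε⁻¹ * fq 1 0 y - 1)) p ∧
    (∀ α, pd α (fun y => sg (ε⁻¹ * fq 1 0 y - 1)) p =
      deriv sg (ε⁻¹ * fq 1 0 p - 1) * ε⁻¹ * (2 * eta α * co α p)) ∧
    box (fun y => sg (ε⁻¹ * fq 1 0 y - 1)) p =
      deriv (deriv sg) (ε⁻¹ * fq 1 0 p - 1) * ε⁻¹ ^ 2 * (4 * fq 1 0 p)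
      + 8 * deriv sg (ε⁻¹ * fq 1 0 p - 1) * ε⁻¹ := by
  have hfd : ∀ α x, fd 1 0 α x = 2 * eta α * co α x := by
    intro α x; simp [fd, cc, dd, eta]
  have h1 : ∀ x, HasPD (fun y => ε⁻¹ * fq 1 0 y - 1) (fun α => ε⁻¹ * (2 * eta α * co α x)) x :=
    fun x => (((hasPD_fq 1 0 x).const_mul ε⁻¹).sub (hasPD_const 1 x)).congr_d fun α => by
      rw [hfd]; ring
  have hs : ContDiff ℝ (⊤ : ℕ∞) (fun y => sg (ε⁻¹ * fq 1 0 y - 1)) :=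
    sg_smooth.comp ((contDiff_const.mul (contDiff_fq 1 0)).sub contDiff_const)
  have h2 : ∀ x α, pd α (fun y => sg (ε⁻¹ * fq 1 0 y - 1)) x =
      deriv sg (ε⁻¹ * fq 1 0 x - 1) * (ε⁻¹ * (2 * eta α * co α x)) := by
    intro x α
    rw [((h1 x).comp (sg_hasDeriv _)).2 α]
  refine ⟨hs.contDiffAt, fun α => by rw [h2]; ring, ?_⟩
  rw [box_eq]
  have h3 : ∀ α, pd α (pd α (fun y => sg (ε⁻¹ * fq 1 0 y - 1))) p =
      deriv (deriv sg) (ε⁻¹ * fq 1 0 p - 1) * (ε⁻¹ * (2 * eta α * co α p)) ^ 2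
      + deriv sg (ε⁻¹ * fq 1 0 p - 1) * (ε⁻¹ * (2 * eta α)) := by
    intro α
    have e : pd α (fun y => sg (ε⁻¹ * fq 1 0 y - 1)) = fun x =>
      deriv sg (ε⁻¹ * fq 1 0 x - 1) * (ε⁻¹ * (2 * eta α * co α x)) := by funext x; exact h2 x α
    rw [e, (((h1 p).comp (dsg_hasDeriv _)).mul (((hasPD_co α p).const_mul (2 * eta α)).const_mul ε⁻¹)).2 α]
    simp; ring
  simp only [h3, Fin.sum_univ_four, eta_zero, eta_one, eta_two, eta_three]
  generalize deriv (deriv sg) (ε⁻¹ * fq 1 0 p - 1) = d2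
  generalize deriv sg (ε⁻¹ * fq 1 0 p - 1) = d1
  rw [fq_expand]
  ring

lemma box_kap_le {ε C b : ℝ} {v : Spc → ℝ} {p : Spc} (hε : 0 < ε) (hC : 0 ≤ C) (hb0 : 0 ≤ b)
    (hX : 0 < fq 1 0 p)
    (hb : ∀ x, |deriv sg x| ≤ b) (hb2 : ∀ x, |deriv (deriv sg) x| ≤ b)
    (hv : ContDiffAt ℝ (⊤ : ℕ∞) v p) (h1 : |v p| ≤ C * fq 1 0 p) (h2 : |Sx v p| ≤ C * fq 1 0 p)
    (h3 : |box v p| ≤ C) :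
    |box (fun y => sg (ε⁻¹ * fq 1 0 y - 1) * v y) p| ≤ C * (1 + 40 * b) := by
  obtain ⟨k1, k2, k3⟩ := kap_facts ε p
  rw [(box_mul k1 hv).2, k3]
  have e : ∑ α, eta α * (pd α (fun y => sg (ε⁻¹ * fq 1 0 y - 1)) p * pd α v p) =
      2 * deriv sg (ε⁻¹ * fq 1 0 p - 1) * ε⁻¹ * Sx v p := by
    simp only [k2, Sx, Fin.sum_univ_four, eta_zero, eta_one, eta_two, eta_three]; ring
  rw [e]
  have hk1 : |sg (ε⁻¹ * fq 1 0 p - 1) * box v p| ≤ C := by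
    rw [abs_mul, abs_of_nonneg (sg_nonneg _)]
    exact (mul_le_of_le_one_left (abs_nonneg _) (sg_le_one _)).trans h3
  by_cases hr : fq 1 0 p ≤ 2 * ε
  · have hi : 0 < ε⁻¹ := inv_pos.2 hε
    have hie : ε⁻¹ * ε = 1 := inv_mul_cancel₀ hε.ne'
    have a1 : ε⁻¹ * |v p| ≤ 2 * C := by
      have : |v p| ≤ C * (2 * ε) := h1.trans (by gcongr)
      calc ε⁻¹ * |v p| ≤ ε⁻¹ * (C * (2 * ε)) := by gcongr
        _ = 2 * C * (ε⁻¹ * ε) := by ring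
        _ = 2 * C := by rw [hie, mul_one]
    have a2 : ε⁻¹ * |Sx v p| ≤ 2 * C := by
      have : |Sx v p| ≤ C * (2 * ε) := h2.trans (by gcongr)
      calc ε⁻¹ * |Sx v p| ≤ ε⁻¹ * (C * (2 * ε)) := by gcongr
        _ = 2 * C * (ε⁻¹ * ε) := by ring
        _ = 2 * C := by rw [hie, mul_one]
    have a3 : ε⁻¹ * fq 1 0 p ≤ 2 := by
      calc ε⁻¹ * fq 1 0 p ≤ ε⁻¹ * (2 * ε) := by gcongr
        _ = 2 * (ε⁻¹ * ε) := by ring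
        _ = 2 := by rw [hie, mul_one]
    have b1 : |2 * (2 * deriv sg (ε⁻¹ * fq 1 0 p - 1) * ε⁻¹ * Sx v p)| ≤ 8 * b * C := by
      have : |2 * (2 * deriv sg (ε⁻¹ * fq 1 0 p - 1) * ε⁻¹ * Sx v p)| =
          4 * (|deriv sg (ε⁻¹ * fq 1 0 p - 1)| * (ε⁻¹ * |Sx v p|)) := by
        simp only [abs_mul, abs_of_pos hi, abs_two]; ring
      rw [this]
      have : |deriv sg (ε⁻¹ * fq 1 0 p - 1)| * (ε⁻¹ * |Sx v p|) ≤ b * (2 * C) := by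
        gcongr; exact hb _
      linarith
    have b2 : |(deriv (deriv sg) (ε⁻¹ * fq 1 0 p - 1) * ε⁻¹ ^ 2 * (4 * fq 1 0 p)
      + 8 * deriv sg (ε⁻¹ * fq 1 0 p - 1) * ε⁻¹) * v p| ≤ 32 * b * C := by
      have e1 : (deriv (deriv sg) (ε⁻¹ * fq 1 0 p - 1) * ε⁻¹ ^ 2 * (4 * fq 1 0 p)
        + 8 * deriv sg (ε⁻¹ * fq 1 0 p - 1) * ε⁻¹) * v p =
        (4 * (deriv (deriv sg) (ε⁻¹ * fq 1 0 p - 1) * (ε⁻¹ * fq 1 0 p))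
          + 8 * deriv sg (ε⁻¹ * fq 1 0 p - 1)) * (ε⁻¹ * v p) := by ring
      rw [e1, abs_mul, abs_mul, abs_of_pos hi]
      have c1 : |deriv (deriv sg) (ε⁻¹ * fq 1 0 p - 1) * (ε⁻¹ * fq 1 0 p)| ≤ b * 2 := by
        rw [abs_mul, abs_of_pos (mul_pos hi hX)]
        gcongr; exact hb2 _
      have c2 : |4 * (deriv (deriv sg) (ε⁻¹ * fq 1 0 p - 1) * (ε⁻¹ * fq 1 0 p))
          + 8 * deriv sg (ε⁻¹ * fq 1 0 p - 1)| ≤ 16 * b := by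
        have c3 := hb (ε⁻¹ * fq 1 0 p - 1)
        rw [abs_le] at c1 c3 ⊢
        constructor <;> linarith [c1.1, c1.2, c3.1, c3.2]
      calc _ ≤ 16 * b * (2 * C) := by gcongr
        _ = _ := by ring
    refine (abs_add_three _ _ _).trans ?_
    linarith
  · have hy : 1 ≤ ε⁻¹ * fq 1 0 p - 1 := by
      have : ε⁻¹ * (2 * ε) ≤ ε⁻¹ * fq 1 0 p := by
        have := inv_pos.2 hε
        gcongr; exact (not_le.1 hr).le
      have h : ε⁻¹ * (2 * ε) = 2 := by field_simp
      linarith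
    have hd2 : deriv (deriv sg) (ε⁻¹ * fq 1 0 p - 1) = 0 := by
      have : 1 < ε⁻¹ * fq 1 0 p - 1 := by
        have h5 : ε⁻¹ * (2 * ε) < ε⁻¹ * fq 1 0 p :=
          mul_lt_mul_of_pos_left (not_le.1 hr) (inv_pos.2 hε)
        have h : ε⁻¹ * (2 * ε) = 2 := by field_simp
        linarith
      have he : deriv sg =ᶠ[𝓝 (ε⁻¹ * fq 1 0 p - 1)] fun _ => 0 := by
        filter_upwards [lt_mem_nhds this] with y hy using dsg_one hy.le
      rw [he.deriv_eq]; simp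
    rw [dsg_one hy, hd2]
    simp only [mul_zero, zero_mul, add_zero]
    refine hk1.trans ?_
    nlinarith [mul_nonneg hC hb0]

/-- bounds for a product with a smooth function -/
lemma mul_bounds {χ w : Spc → ℝ} {p : Spc} {B C R : ℝ} (hχ : ContDiffAt ℝ (⊤ : ℕ∞) χ p)
    (hw : ContDiffAt ℝ (⊤ : ℕ∞) w p) (hB : 0 ≤ B) (hC : 0 ≤ C) (hR : 0 ≤ R)
    (c0 : |χ p| ≤ B) (c1 : ∀ α, |pd α χ p| ≤ B) (c2 : |box χ p| ≤ B) (hco : ∀ α, |co α p| ≤ R)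
    {X : ℝ} (hX : 0 ≤ X) (hXR : X ≤ R)
    (h1 : |w p| ≤ C * X) (h2 : |Sx w p| ≤ C * X) (h3 : |box w p| ≤ C) (h4 : ∀ α, |pd α w p| ≤ C) :
    |χ p * w p| ≤ (9 + 5 * R) * B * C * X ∧ |Sx (fun x => χ x * w x) p| ≤ (9 + 5 * R) * B * C * X ∧
      |box (fun x => χ x * w x) p| ≤ (9 + 5 * R) * B * C := by
  obtain ⟨m1, m2⟩ := box_mul hχ hw
  have hBC : 0 ≤ B * C := mul_nonneg hB hC
  have hBCX : 0 ≤ B * C * X := mul_nonneg hBC hX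
  have hBCR : 0 ≤ B * C * R := mul_nonneg hBC hR
  have hBCRX : 0 ≤ B * C * R * X := mul_nonneg hBCR hX
  have a1 : |χ p * w p| ≤ B * (C * X) := by rw [abs_mul]; gcongr
  refine ⟨by linarith, ?_, ?_⟩
  · have e : Sx (fun x => χ x * w x) p = χ p * Sx w p + (∑ α, co α p * pd α χ p) * w p := by
      simp only [Sx, m1, Fin.sum_univ_four]; ring
    rw [e]
    have s1 : |χ p * Sx w p| ≤ B * (C * X) := by rw [abs_mul]; gcongr
    have s2 : |∑ α, co α p * pd α χ p| ≤ 4 * (R * B) := by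
      refine (Finset.abs_sum_le_sum_abs _ _).trans ?_
      have : ∀ α ∈ (Finset.univ : Finset (Fin 4)), |co α p * pd α χ p| ≤ R * B := by
        intro α _; rw [abs_mul]; gcongr; exact hco α; exact c1 α
      refine (Finset.sum_le_sum this).trans ?_
      simp
    have s3 : |(∑ α, co α p * pd α χ p) * w p| ≤ 4 * (R * B) * (C * X) := by
      rw [abs_mul]; gcongr
    refine (abs_add_le _ _).trans ?_
    linarith
  · rw [m2]
    have s1 : |χ p * box w p| ≤ B * C := by rw [abs_mul]; gcongr
    have s2 : |2 * ∑ α, eta α * (pd α χ p * pd α w p)| ≤ 8 * (B * C) := by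
      have : |∑ α, eta α * (pd α χ p * pd α w p)| ≤ 4 * (B * C) := by
        refine (Finset.abs_sum_le_sum_abs _ _).trans ?_
        have : ∀ α ∈ (Finset.univ : Finset (Fin 4)), |eta α * (pd α χ p * pd α w p)| ≤ B * C := by
          intro α _
          have : |eta α| = 1 := by unfold eta; split_ifs <;> simp
          rw [abs_mul, this, one_mul, abs_mul]; gcongr; exact c1 α; exact h4 α
        refine (Finset.sum_le_sum this).trans ?_
        simp
      rw [abs_mul, abs_two]; linarith
    have s3 : |box χ p * w p| ≤ B * (C * R) := by
      rw [abs_mul]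
      have : |w p| ≤ C * R := h1.trans (by gcongr)
      gcongr
    refine (abs_add_three _ _ _).trans ?_
    linarith

end

section
lemma contDiff_enr {N : ℕ} {W : Fin N → Spc → ℝ} (hW : ∀ J, ContDiff ℝ (⊤ : ℕ∞) (W J)) :
    ContDiff ℝ (⊤ : ℕ∞) (enr W) := by
  have := contDiff_Yc hW 0
  have e : Yc W 0 = enr W := by funext x; simp [Yc]
  rwa [e] at this

lemma carl_step {N : ℕ} {a δ S f0 c2 c1 μ C0 l : ℝ} (ha : 1 < a) (hf0 : 0 < f0) (hμ : 0 < μ)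
    (hC0 : 0 < C0) (hl : 1 ≤ l) {v : Fin N → Spc → ℝ}
    (hcar : ∀ I, l * ∫ x, Real.exp (2 * l * ph a δ μ x) * (v I x ^ 2 + ∑ α, pd α (v I) x ^ 2) ≤
      C0 * ∫ x, Real.exp (2 * l * ph a δ μ x) * box (v I) x ^ 2)
    (hv : ∀ I, ContDiff ℝ (⊤ : ℕ∞) (v I))
    (hsup : ∀ I x, v I x ≠ 0 → x ∈ Bset a δ S f0 c2) {C C1 : ℝ} (hC : 0 ≤ C)
    (h1 : ∀ I x, |box (v I) x| ≤ C1) {Ns : Set Spc} (hNm : MeasurableSet Ns)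
    (hNK : Ns ⊆ Bset a δ S f0 c2)
    (h2 : ∀ I x, x ∉ Ns → fq a δ x < c1 → |box (v I) x| ≤ C * sz v x)
    (hl2 : C0 * (10 * N ^ 2 * C ^ 2) ≤ l) :
    ∫ x, Real.exp (2 * l * ph a δ μ x) * enr v x ≤
      C0 * N * C1 ^ 2 * (Real.exp (2 * l * Real.exp (-μ * c1)) * volume.real (Bset a δ S f0 c2)
        + Real.exp (2 * l) * volume.real Ns) := by
  set K := Bset a δ S f0 c2 with hK
  have hKc : IsCompact K := isCompact_Bset δ S f0 c2 (by linarith)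
  have hl0 : 0 < l := by linarith
  have hph : Continuous (ph a δ μ) := (contDiff_ph a δ μ).continuous
  have hEc : Continuous fun x => Real.exp (2 * l * ph a δ μ x) := by fun_prop
  have hcs : ∀ I, HasCompactSupport (v I) := fun I =>
    HasCompactSupport.intro hKc fun x hx => by
      by_contra h; exact hx (hsup I x h)
  have hcpd : ∀ I α, HasCompactSupport (pd α (v I)) := fun I α => hasCompactSupport_pd (hcs I) α
  have hloc : ∀ x, x ∉ K → ∀ I, v I =ᶠ[𝓝 x] fun _ => 0 := by
    intro x hx I
    filter_upwards [hKc.isClosed.isOpen_compl.mem_nhds hx] with y hy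
    by_contra h; exact hy (hsup I y h)
  have hboxK : ∀ x, x ∉ K → ∀ I, box (v I) x = 0 := by
    intro x hx I
    rw [box_congr (hloc x hx I), box_eq]
    have : ∀ α, pd α (fun _ : Spc => (0:ℝ)) = fun _ => 0 := by
      intro α; funext y; exact (hasPD_const 0 y).2 α
    simp [this]
  have hI1 : ∀ I, Integrable fun x => Real.exp (2 * l * ph a δ μ x) *
      (v I x ^ 2 + ∑ α, pd α (v I) x ^ 2) := by
    intro I
    have hc : Continuous fun x => (v I x ^ 2 + ∑ α, pd α (v I) x ^ 2) :=
      ((hv I).continuous.pow 2).add (continuous_finsetSum _ fun α _ =>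
        (contDiff_pd (hv I) α).continuous.pow 2)
    refine (hEc.mul hc).integrable_of_hasCompactSupport (HasCompactSupport.intro hKc fun x hx => ?_)
    have := (hloc x hx I).eq_of_nhds
    have h3 : ∀ α, pd α (v I) x = 0 := fun α => by
      rw [pd_congr (hloc x hx I) α]; exact (hasPD_const 0 x).2 α
    simp [this, h3]
  have hI2 : ∀ I, Integrable fun x => Real.exp (2 * l * ph a δ μ x) * box (v I) x ^ 2 := by
    intro I
    refine (hEc.mul ((continuous_box (hv I)).pow 2)).integrable_of_hasCompactSupport
      (HasCompactSupport.intro hKc fun x hx => ?_)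
    simp [hboxK x hx I]
  have hE1 : ∀ x, Real.exp (2 * l * ph a δ μ x) * enr v x =
      ∑ I, (1/2) * (Real.exp (2 * l * ph a δ μ x) * (v I x ^ 2 + ∑ α, pd α (v I) x ^ 2)) := by
    intro x; rw [enr, Finset.mul_sum]
    refine Finset.sum_congr rfl fun J _ => by ring
  have hIE : Integrable fun x => Real.exp (2 * l * ph a δ μ x) * enr v x := by
    simp only [hE1]
    exact integrable_finsetSum _ fun I _ => (hI1 I).const_mul _
  have hKf : volume K ≠ ⊤ := hKc.measure_lt_top.ne
  have hNf : volume Ns ≠ ⊤ := (lt_of_le_of_lt (measure_mono hNK) hKc.measure_lt_top).ne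
  set EN := ∫ x, Real.exp (2 * l * ph a δ μ x) * enr v x with hEN
  have hsum : 2 * l * EN ≤ C0 * ∫ x, ∑ I, Real.exp (2 * l * ph a δ μ x) * box (v I) x ^ 2 := by
    rw [integral_finsetSum _ fun I _ => hI2 I, Finset.mul_sum]
    calc 2 * l * EN = ∑ I, l * ∫ x, Real.exp (2 * l * ph a δ μ x) *
          (v I x ^ 2 + ∑ α, pd α (v I) x ^ 2) := by
          rw [hEN]; simp only [hE1]
          rw [integral_finsetSum _ fun I _ => (hI1 I).const_mul _, Finset.mul_sum]
          refine Finset.sum_congr rfl fun I _ => ?_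
          rw [integral_const_mul]; ring
      _ ≤ _ := Finset.sum_le_sum fun I _ => hcar I
  set e1 := Real.exp (2 * l * Real.exp (-μ * c1))
  set e2 := Real.exp (2 * l)
  have hpt : ∀ x, ∑ I, Real.exp (2 * l * ph a δ μ x) * box (v I) x ^ 2 ≤
      10 * N ^ 2 * C ^ 2 * (Real.exp (2 * l * ph a δ μ x) * enr v x) +
      (N * C1 ^ 2 * e1 * K.indicator (fun _ => 1) x + N * C1 ^ 2 * e2 * Ns.indicator (fun _ => 1) x) := by
    intro x
    have i1 : 0 ≤ K.indicator (fun _ => (1:ℝ)) x := Set.indicator_nonneg (fun _ _ => by norm_num) x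
    have i2 : 0 ≤ Ns.indicator (fun _ => (1:ℝ)) x := Set.indicator_nonneg (fun _ _ => by norm_num) x
    have e1p : 0 < e1 := Real.exp_pos _
    have e2p : 0 < e2 := Real.exp_pos _
    have en0 := enr_nonneg v x
    have t1 : 0 ≤ 10 * N ^ 2 * C ^ 2 * (Real.exp (2 * l * ph a δ μ x) * enr v x) := by positivity
    have t2 : 0 ≤ N * C1 ^ 2 * e1 * K.indicator (fun _ => 1) x := by positivity
    have t3 : 0 ≤ N * C1 ^ 2 * e2 * Ns.indicator (fun _ => 1) x := by positivity
    by_cases hx : x ∈ K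
    · have hbnd : ∀ B : ℝ, (∀ I, box (v I) x ^ 2 ≤ B) →
          ∑ I, Real.exp (2 * l * ph a δ μ x) * box (v I) x ^ 2 ≤
            N * (Real.exp (2 * l * ph a δ μ x) * B) := by
        intro B hB
        calc _ ≤ ∑ I : Fin N, Real.exp (2 * l * ph a δ μ x) * B :=
              Finset.sum_le_sum fun I _ => by gcongr; exact hB I
          _ = _ := by simp
      have hbC : ∀ I, box (v I) x ^ 2 ≤ C1 ^ 2 := fun I =>
        sq_le_sq' (by linarith [(abs_le.1 (h1 I x)).1]) (abs_le.1 (h1 I x)).2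
      by_cases hN : x ∈ Ns
      · have : Real.exp (2 * l * ph a δ μ x) ≤ e2 := by
          apply Real.exp_le_exp.2
          have : ph a δ μ x ≤ 1 := by
            unfold ph
            rw [Real.exp_le_one_iff]
            have := hx.2.1
            nlinarith
          nlinarith
        have h := hbnd _ hbC
        simp only [Set.indicator_of_mem hN, mul_one] at t3 ⊢
        have h5 : N * (Real.exp (2 * l * ph a δ μ x) * C1 ^ 2) ≤ N * (e2 * C1 ^ 2) := by gcongr
        linarith
      · by_cases hc : fq a δ x < c1
        · have h := hbnd (C ^ 2 * (10 * N * enr v x)) fun I => by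
            have h3 := h2 I x hN hc
            have h4 : box (v I) x ^ 2 ≤ (C * sz v x) ^ 2 :=
              sq_le_sq' (by linarith [(abs_le.1 h3).1]) (abs_le.1 h3).2
            have h5 := sz_sq_le v x
            calc _ ≤ C ^ 2 * sz v x ^ 2 := by rw [← mul_pow]; exact h4
              _ ≤ _ := by gcongr
          have e5 : N * (Real.exp (2 * l * ph a δ μ x) * (C ^ 2 * (10 * N * enr v x))) =
            10 * N ^ 2 * C ^ 2 * (Real.exp (2 * l * ph a δ μ x) * enr v x) := by ring
          linarith
        · have : Real.exp (2 * l * ph a δ μ x) ≤ e1 := by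
            apply Real.exp_le_exp.2
            have : ph a δ μ x ≤ Real.exp (-μ * c1) := by
              unfold ph
              apply Real.exp_le_exp.2
              have := not_lt.1 hc
              nlinarith
            gcongr
          have h := hbnd _ hbC
          simp only [Set.indicator_of_mem hx, mul_one] at t2 ⊢
          have h5 : N * (Real.exp (2 * l * ph a δ μ x) * C1 ^ 2) ≤ N * (e1 * C1 ^ 2) := by gcongr
          linarith
    · simp only [hboxK x hx]
      simp only [ne_eq, OfNat.ofNat_ne_zero, not_false_eq_true, zero_pow, mul_zero,
        Finset.sum_const_zero]
      linarith
  have hiK : Integrable (K.indicator fun _ => (1:ℝ)) :=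
    (integrable_indicator_iff hKc.measurableSet).2 (integrableOn_const hKf)
  have hiN : Integrable (Ns.indicator fun _ => (1:ℝ)) :=
    (integrable_indicator_iff hNm).2 (integrableOn_const hNf)
  have hint := integral_mono (integrable_finsetSum _ fun I _ => hI2 I)
    ((hIE.const_mul (10 * N ^ 2 * C ^ 2)).add ((hiK.const_mul (N * C1 ^ 2 * e1)).add
      (hiN.const_mul (N * C1 ^ 2 * e2)))) hpt
  have hr : ∫ x, (10 * N ^ 2 * C ^ 2 * (Real.exp (2 * l * ph a δ μ x) * enr v x) +
      (N * C1 ^ 2 * e1 * K.indicator (fun _ => 1) x + N * C1 ^ 2 * e2 * Ns.indicator (fun _ => 1) x))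
      = 10 * N ^ 2 * C ^ 2 * EN + (N * C1 ^ 2 * e1 * volume.real K + N * C1 ^ 2 * e2 * volume.real Ns) := by
    have hiS : Integrable fun x => (N * C1 ^ 2 * e1 * K.indicator (fun _ => (1:ℝ)) x +
        N * C1 ^ 2 * e2 * Ns.indicator (fun _ => (1:ℝ)) x) := (hiK.const_mul _).add (hiN.const_mul _)
    rw [integral_add (hIE.const_mul _) hiS,
      integral_add (hiK.const_mul _) (hiN.const_mul _), integral_const_mul, integral_const_mul,
      integral_const_mul, integral_indicator_const _ hKc.measurableSet, integral_indicator_const _ hNm]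
    simp only [smul_eq_mul, mul_one, hEN]
  have hint2 := hint.trans_eq hr
  have hEN0 : 0 ≤ EN := integral_nonneg fun x => by
    have := enr_nonneg v x
    positivity
  have h7 := mul_le_mul_of_nonneg_left hint2 hC0.le
  have h8 : C0 * (10 * N ^ 2 * C ^ 2) * EN ≤ l * EN := by gcongr
  have h9 : 1 * EN ≤ l * EN := by gcongr
  have : C0 * N * C1 ^ 2 * (e1 * volume.real K + e2 * volume.real Ns) =
    C0 * (N * C1 ^ 2 * e1 * volume.real K + N * C1 ^ 2 * e2 * volume.real Ns) := by ring
  rw [this]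
  linarith

lemma carl_uniq {N : ℕ} {a δ S f0 c2 c1 : ℝ} (ha : 1 < a) (ha' : a ≤ 5 / 4) (hf0 : 0 < f0)
    (he : ∀ x ∈ Bset a δ S f0 c2, (a ^ 2 - a) * (co 0 x - δ) ^ 2 ≤ fq a δ x / 2)
    {v : ℕ → Fin N → Spc → ℝ} (hv : ∀ n I, ContDiff ℝ (⊤ : ℕ∞) (v n I))
    (hsup : ∀ n I x, v n I x ≠ 0 → x ∈ Bset a δ S f0 c2) {C C1 : ℝ} (hC : 0 ≤ C)
    (h1 : ∀ n I x, |box (v n I) x| ≤ C1) {Ns : ℕ → Set Spc} (hNm : ∀ n, MeasurableSet (Ns n))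
    (hNK : ∀ n, Ns n ⊆ Bset a δ S f0 c2)
    (hN : Tendsto (fun n => volume.real (Ns n)) atTop (𝓝 0))
    (h2 : ∀ n I x, x ∉ Ns n → fq a δ x < c1 → |box (v n I) x| ≤ C * sz (v n) x)
    {X0 : Spc} (hX0 : fq a δ X0 < c1) {W : Spc → ℝ} {I : Fin N} (hW : ContinuousAt W X0)
    {ρ : ℝ} (hρ : 0 < ρ) (hU : ∀ᶠ n in atTop, ∀ x ∈ Metric.ball X0 ρ, v n I x = W x) :
    W X0 = 0 := by
  obtain ⟨μ, C0, l0, hμ, hC0, hl0, hcar⟩ := carleman ha ha' hf0 he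
  by_contra hne
  set η := W X0 ^ 2 / 2 with hη
  have hηp : 0 < η := by positivity
  obtain ⟨c, hc1, hc2⟩ := exists_between hX0
  have hev : ∀ᶠ x in 𝓝 X0, x ∈ Metric.ball X0 ρ ∧ fq a δ x < c ∧ η < W x ^ 2 := by
    have hc := (contDiff_fq a δ).continuous.continuousAt (x := X0)
    have e1 := hc.eventually_lt continuousAt_const hc1
    have e2 := continuousAt_const.eventually_lt (hW.pow 2) (show η < W X0 ^ 2 by rw [hη]; linarith)
    filter_upwards [Metric.ball_mem_nhds X0 hρ, e1, e2] with x h1 h2 h3 using ⟨h1, h2, h3⟩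
  obtain ⟨ρ', hρ', hball⟩ := Metric.eventually_nhds_iff_ball.1 hev
  set U := Metric.ball X0 ρ'
  have hUf : volume U ≠ ⊤ := measure_ball_lt_top.ne
  have hUp : 0 < volume.real U := ENNReal.toReal_pos (Metric.measure_ball_pos volume X0 hρ').ne' hUf
  set m1 := Real.exp (-μ * c1)
  set m2 := Real.exp (-μ * c)
  have hm : m1 < m2 := Real.exp_lt_exp.2 (by nlinarith)
  set D := C0 * N * C1 ^ 2
  set VK := volume.real (Bset a δ S f0 c2)
  have key : ∀ l, l0 ≤ l → C0 * (10 * N ^ 2 * C ^ 2) ≤ l →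
      Real.exp (2 * l * m2) * (η / 2) * volume.real U ≤ D * (Real.exp (2 * l * m1) * VK) := by
    intro l hl hl2
    have step : ∀ᶠ n in atTop, Real.exp (2 * l * m2) * (η / 2) * volume.real U ≤
        D * (Real.exp (2 * l * m1) * VK + Real.exp (2 * l) * volume.real (Ns n)) := by
      filter_upwards [hU] with n hn
      refine le_trans ?_ (carl_step ha hf0 hμ hC0 (hl0.trans hl)
        (fun I => hcar l hl (v n I) (hv n I) (hsup n I)) (hv n) (hsup n) hC (h1 n) (hNm n) (hNK n)
        (h2 n) hl2)
      have hph : Continuous (ph a δ μ) := (contDiff_ph a δ μ).continuous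
      have hEc : Continuous fun x => Real.exp (2 * l * ph a δ μ x) := by fun_prop
      have hKc : IsCompact (Bset a δ S f0 c2) := isCompact_Bset δ S f0 c2 (by linarith)
      have hIE : Integrable fun x => Real.exp (2 * l * ph a δ μ x) * enr (v n) x := by
        refine (hEc.mul (contDiff_enr (hv n)).continuous).integrable_of_hasCompactSupport
          (HasCompactSupport.intro hKc fun x hx => ?_)
        have hl : ∀ J, v n J =ᶠ[𝓝 x] fun _ => 0 := by
          intro J
          filter_upwards [hKc.isClosed.isOpen_compl.mem_nhds hx] with y hy
          by_contra h; exact hy (hsup n J y h)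
        have h3 : ∀ J α, pd α (v n J) x = 0 := fun J α => by
          rw [pd_congr (hl J) α]; exact (hasPD_const 0 x).2 α
        simp [enr, h3, fun J => (hl J).eq_of_nhds]
      have hle := setIntegral_mono_on (μ := volume) (s := U)
        (f := fun _ => Real.exp (2 * l * m2) * (η / 2))
        (integrableOn_const hUf) hIE.integrableOn Metric.isOpen_ball.measurableSet (fun x hx => by
          obtain ⟨b1, b2, b3⟩ := hball x hx
          have q1 : Real.exp (2 * l * m2) ≤ Real.exp (2 * l * ph a δ μ x) := by
            apply Real.exp_le_exp.2
            have : m2 ≤ ph a δ μ x := by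
              unfold ph
              apply Real.exp_le_exp.2
              nlinarith
            have : 0 < l := by linarith
            gcongr
          have q2 : η / 2 ≤ enr (v n) x := by
            have : (v n I x ^ 2 + ∑ α, pd α (v n I) x ^ 2) / 2 ≤ enr (v n) x :=
              Finset.single_le_sum (f := fun J => (v n J x ^ 2 + ∑ α, pd α (v n J) x ^ 2) / 2)
                (fun J _ => by positivity) (Finset.mem_univ I)
            rw [hn x b1] at this
            have : 0 ≤ ∑ α, pd α (v n I) x ^ 2 := by positivity
            linarith
          gcongr)
      have hle2 : ∫ x in U, Real.exp (2 * l * ph a δ μ x) * enr (v n) x ≤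
          ∫ x, Real.exp (2 * l * ph a δ μ x) * enr (v n) x :=
        setIntegral_le_integral hIE (Eventually.of_forall fun x => by
          have := enr_nonneg (v n) x
          positivity)
      rw [setIntegral_const] at hle
      have := hle.trans hle2
      simp only [smul_eq_mul] at this
      linarith
    have lim : Tendsto (fun n => D * (Real.exp (2 * l * m1) * VK + Real.exp (2 * l) * volume.real (Ns n)))
        atTop (𝓝 (D * (Real.exp (2 * l * m1) * VK + Real.exp (2 * l) * 0))) :=
      (tendsto_const_nhds.add (hN.const_mul _)).const_mul _
    have := ge_of_tendsto lim step
    simpa using this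
  have key2 : ∀ᶠ l : ℝ in atTop, (η / 2) * volume.real U ≤ D * VK * Real.exp (-(2 * (m2 - m1) * l)) := by
    filter_upwards [eventually_ge_atTop l0, eventually_ge_atTop (C0 * (10 * N ^ 2 * C ^ 2))] with l k1 k2
    have := key l k1 k2
    have e : Real.exp (-(2 * (m2 - m1) * l)) = Real.exp (2 * l * m1) * (Real.exp (2 * l * m2))⁻¹ := by
      rw [← Real.exp_neg, ← Real.exp_add]; congr 1; ring
    rw [e]
    have hp := Real.exp_pos (2 * l * m2)
    have e2 : D * VK * (Real.exp (2 * l * m1) * (Real.exp (2 * l * m2))⁻¹) =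
      (D * (Real.exp (2 * l * m1) * VK)) / Real.exp (2 * l * m2) := by field_simp
    rw [e2, le_div_iff₀ hp]
    linarith
  have lim : Tendsto (fun l : ℝ => D * VK * Real.exp (-(2 * (m2 - m1) * l))) atTop (𝓝 (D * VK * 0)) := by
    refine Tendsto.const_mul _ (Real.tendsto_exp_neg_atTop_nhds_zero.comp ?_)
    exact tendsto_id.const_mul_atTop (by linarith)
  have := ge_of_tendsto lim key2
  have h : 0 < η / 2 * volume.real U := by positivity
  linarith

end

section
lemma abs_co_le (α : Fin 4) (p : Spc) : |co α p| ≤ ‖p‖ := by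
  refine Fin.cases ?_ (fun i => ?_) α
  · simpa using norm_fst_le p
  · have h1 := norm_snd_le p
    have h2 := PiLp.norm_apply_le p.2 i
    rw [co_succ]; exact (by simpa using h2 : |p.2 i| ≤ ‖p.2‖).trans h1

lemma fq_norm (a δ : ℝ) (p : Spc) : fq a δ p = -a * (p.1 - δ) ^ 2 + ‖p.2‖ ^ 2 := by
  rw [fq_expand, norm_sq_snd, co_zero]; ring

lemma fq_ten (p : Spc) : fq 1 0 p = ‖p.2‖ ^ 2 - p.1 ^ 2 := by
  rw [fq_norm]; ring

lemma geo1 {r s δ M : ℝ} (hr : 0 ≤ r) (hδ : 0 < δ) (hX : 0 < r ^ 2 - s ^ 2) (hp : 2 * δ ≤ r + s) :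
    δ ^ 2 ≤ r ^ 2 - (s - δ) ^ 2 ∧ (r ^ 2 - (s - δ) ^ 2 ≤ M → |s| ≤ δ + M / δ) := by
  have hab : |s| < r := abs_lt_of_sq_lt_sq (by linarith) hr
  have h1 := (abs_lt.1 hab).1
  have h2 := (abs_lt.1 hab).2
  refine ⟨by nlinarith, fun h => ?_⟩
  have e : M = δ * (M / δ) := by field_simp
  have k1 : (r + s - δ) ≤ M / δ := by
    rw [le_div_iff₀ hδ]; nlinarith
  have k2 : (r - s + δ) ≤ M / δ := by
    rw [le_div_iff₀ hδ]; nlinarith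
  rw [abs_le]; constructor <;> linarith

lemma box_zero_loc {f : Spc → ℝ} {x : Spc} (h : f =ᶠ[𝓝 x] fun _ => 0) :
    f x = 0 ∧ (∀ α, pd α f x = 0) ∧ box f x = 0 := by
  refine ⟨h.eq_of_nhds, fun α => ?_, ?_⟩
  · rw [pd_congr h α]; exact (hasPD_const 0 x).2 α
  · rw [box_congr h, box_eq]
    have : ∀ α, pd α (fun _ : Spc => (0:ℝ)) = fun _ => 0 := by
      intro α; funext y; exact (hasPD_const 0 y).2 α
    simp [this]

lemma chi_bound (a δ c2 : ℝ) {K : Set Spc} (hK : IsCompact K) :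
    ContDiff ℝ (⊤ : ℕ∞) (fun x => sg (c2 - fq a δ x)) ∧
    ∃ B : ℝ, 0 ≤ B ∧ ∀ x ∈ K, |sg (c2 - fq a δ x)| ≤ B ∧
      (∀ α, |pd α (fun x => sg (c2 - fq a δ x)) x| ≤ B) ∧ |box (fun x => sg (c2 - fq a δ x)) x| ≤ B := by
  have hs : ContDiff ℝ (⊤ : ℕ∞) (fun x => sg (c2 - fq a δ x)) :=
    sg_smooth.comp (contDiff_const.sub (contDiff_fq a δ))
  refine ⟨hs, ?_⟩
  obtain ⟨B1, h1⟩ := hK.exists_bound_of_continuousOn (f := fun x => sg (c2 - fq a δ x)) hs.continuous.continuousOn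
  obtain ⟨B2, h2⟩ := hK.exists_bound_of_continuousOn (f := box (fun x => sg (c2 - fq a δ x))) (continuous_box hs).continuousOn
  have h3 : ∀ α, ∃ B, ∀ x ∈ K, ‖pd α (fun x => sg (c2 - fq a δ x)) x‖ ≤ B := fun α =>
    hK.exists_bound_of_continuousOn (contDiff_pd hs α).continuous.continuousOn
  choose B3 h3 using h3
  refine ⟨|B1| + |B2| + ∑ α, |B3 α|, by positivity, fun x hx => ⟨?_, fun α => ?_, ?_⟩⟩
  · have := h1 x hx
    rw [Real.norm_eq_abs] at this
    have h5 : 0 ≤ ∑ α, |B3 α| := by positivity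
    linarith [le_abs_self B1, abs_nonneg B2]
  · have := h3 α x hx
    rw [Real.norm_eq_abs] at this
    have h5 : |B3 α| ≤ ∑ α, |B3 α| := Finset.single_le_sum (f := fun α => |B3 α|) (fun _ _ => abs_nonneg _) (Finset.mem_univ α)
    linarith [le_abs_self (B3 α), abs_nonneg B2, abs_nonneg B1]
  · have := h2 x hx
    rw [Real.norm_eq_abs] at this
    have h5 : 0 ≤ ∑ α, |B3 α| := by positivity
    linarith [le_abs_self B2, abs_nonneg B1]

lemma vol_tend (K : Set Spc) (hK : IsCompact K) :
    (∀ n : ℕ, MeasurableSet (K ∩ {x | 0 < fq 1 0 x ∧ fq 1 0 x ≤ 2 * (1 / ((n:ℝ) + 1))})) ∧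
    Tendsto (fun n : ℕ => volume.real (K ∩ {x | 0 < fq 1 0 x ∧ fq 1 0 x ≤ 2 * (1 / ((n:ℝ) + 1))}))
      atTop (𝓝 0) := by
  have hc := (contDiff_fq 1 0).continuous
  have hm : ∀ n : ℕ, MeasurableSet (K ∩ {x | 0 < fq 1 0 x ∧ fq 1 0 x ≤ 2 * (1 / ((n:ℝ) + 1))}) := fun n =>
    hK.measurableSet.inter ((isOpen_lt continuous_const hc).measurableSet.inter
      (isClosed_le hc continuous_const).measurableSet)
  refine ⟨hm, ?_⟩
  have := tendsto_measure_iInter_atTop (μ := volume) (fun n => (hm n).nullMeasurableSet)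
    (fun m n h x hx => ⟨hx.1, hx.2.1, hx.2.2.trans (by gcongr)⟩)
    ⟨0, (lt_of_le_of_lt (measure_mono inter_subset_left) hK.measure_lt_top).ne⟩
  have he : (⋂ n : ℕ, K ∩ {x | 0 < fq 1 0 x ∧ fq 1 0 x ≤ 2 * (1 / ((n:ℝ) + 1))}) = ∅ := by
    rw [eq_empty_iff_forall_notMem]
    intro x hx
    rw [mem_iInter] at hx
    have h0 := (hx 0).2.1
    obtain ⟨n, hn⟩ := exists_nat_one_div_lt (show 0 < fq 1 0 x / 2 by linarith)
    have := (hx n).2.2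
    linarith
  rw [he, measure_empty] at this
  exact (ENNReal.tendsto_toReal ENNReal.zero_ne_top).comp this

end

section
lemma fq_le_sq {x : Spc} {R : ℝ} (h : ‖x‖ ≤ R) : fq 1 0 x ≤ R ^ 2 := by
  rw [fq_ten]
  have h1 : ‖x.2‖ ≤ R := (norm_snd_le x).trans h
  have h2 : ‖x.2‖ ^ 2 ≤ R ^ 2 := by gcongr
  linarith [sq_nonneg x.1]

set_option maxHeartbeats 1000000 in
theorem Mhat {N : ℕ} {w : Fin N → Spc → ℝ} {b : ℝ} (hb : 0 < b)
    (hs : ∀ I p, 0 < fq 1 0 p → ContDiffAt ℝ (⊤ : ℕ∞) (w I) p)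
    (h0 : ∀ I p, 0 < fq 1 0 p → ‖p.2‖ + p.1 ≤ b → w I p = 0)
    (hbd : ∀ R : ℝ, ∃ C : ℝ, 0 ≤ C ∧ ∀ p : Spc, 0 < fq 1 0 p → b ≤ ‖p.2‖ + p.1 → ‖p‖ ≤ R → ∀ I,
      |box (w I) p| ≤ C * sz w p ∧ |w I p| ≤ C * fq 1 0 p ∧ |Sx (w I) p| ≤ C * fq 1 0 p ∧
      ∀ α, |pd α (w I) p| ≤ C) :
    ∀ I p, 0 < fq 1 0 p → w I p = 0 := by
  intro I0 X0 hX0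
  rcases le_or_gt (‖X0.2‖ + X0.1) b with hle | hgt
  · exact h0 I0 X0 hX0 hle
  have hX2c : Continuous (fq 1 0) := (contDiff_fq 1 0).continuous
  -- bounds everywhere in the exterior region
  have hbd2 : ∀ R : ℝ, 0 ≤ R → ∃ C : ℝ, 0 ≤ C ∧ ∀ p : Spc, 0 < fq 1 0 p → ‖p‖ ≤ R → ∀ I,
      |box (w I) p| ≤ C * sz w p ∧ |box (w I) p| ≤ C ∧ |w I p| ≤ C * fq 1 0 p ∧
      |Sx (w I) p| ≤ C * fq 1 0 p ∧ ∀ α, |pd α (w I) p| ≤ C := by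
    intro R hR
    obtain ⟨C, hC, h⟩ := hbd R
    refine ⟨C + C * (N * (C * R ^ 2 + 4 * C)), by positivity, fun p hp hpR I => ?_⟩
    have hCC : C ≤ C + C * (N * (C * R ^ 2 + 4 * C)) := by
      have : 0 ≤ C * (N * (C * R ^ 2 + 4 * C)) := by positivity
      linarith
    rcases lt_or_ge (‖p.2‖ + p.1) b with hlt | hge
    · have hz : w I =ᶠ[𝓝 p] fun _ => 0 := by
        have o1 : ∀ᶠ x : Spc in 𝓝 p, ‖x.2‖ + x.1 < b :=
          (continuous_snd.norm.add continuous_fst).continuousAt.eventually_lt continuousAt_const hlt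
        have o2 : ∀ᶠ x : Spc in 𝓝 p, 0 < fq 1 0 x :=
          continuousAt_const.eventually_lt hX2c.continuousAt hp
        filter_upwards [o1, o2] with x h1 h2 using h0 I x h2 h1.le
      obtain ⟨z1, z2, z3⟩ := box_zero_loc hz
      have hsz := sz_nonneg w p
      have hCn : 0 ≤ C + C * (N * (C * R ^ 2 + 4 * C)) := hC.trans hCC
      simp only [Sx, z1, z2, z3, abs_zero, mul_zero, Finset.sum_const_zero]
      exact ⟨by positivity, hCn, by positivity, by positivity, fun _ => hCn⟩
    · have hp2 : fq 1 0 p ≤ R ^ 2 := fq_le_sq hpR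
      have hszb : sz w p ≤ N * (C * R ^ 2 + 4 * C) := by
        unfold sz
        have : ∀ J ∈ (Finset.univ : Finset (Fin N)), |w J p| + ∑ α, |pd α (w J) p| ≤ C * R ^ 2 + 4 * C := by
          intro J _
          obtain ⟨_, k2, _, k4⟩ := h p hp hge hpR J
          have s1 : ∑ α, |pd α (w J) p| ≤ ∑ _α : Fin 4, C := Finset.sum_le_sum fun α _ => k4 α
          have s2 : |w J p| ≤ C * R ^ 2 := k2.trans (by gcongr)
          simp at s1
          linarith
        refine (Finset.sum_le_sum this).trans (le_of_eq ?_)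
        simp; ring
      obtain ⟨k1, k2, k3, k4⟩ := h p hp hge hpR I
      have hsz := sz_nonneg w p
      refine ⟨k1.trans (by gcongr), ?_, k2.trans (by gcongr), k3.trans (by gcongr),
        fun α => (k4 α).trans hCC⟩
      have : C * sz w p ≤ C * (N * (C * R ^ 2 + 4 * C)) := by gcongr
      linarith
  -- parameters
  set δ := b / 2 with hδ
  have hδp : 0 < δ := by positivity
  have hbδ : b = 2 * δ := by rw [hδ]; ring
  set c0 := ‖X0.2‖ ^ 2 - (X0.1 - δ) ^ 2 with hc0
  have hX0' : 0 < ‖X0.2‖ ^ 2 - X0.1 ^ 2 := by rw [← fq_ten]; exact hX0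
  have hc0p : δ ^ 2 ≤ c0 := (geo1 (M := 0) (norm_nonneg _) hδp hX0' (by linarith)).1
  set c1 := c0 + 1 with hc1
  set c2 := c0 + 2 with hc2
  set M := c0 + 3 with hM
  set S1 := δ + M / δ with hS1
  have hM0 : 0 < M := by have := sq_nonneg δ; linarith
  have hS1p : 0 < S1 := by positivity
  set S := S1 + 2 with hS
  obtain ⟨a, ha1, ha2, ha3, ha4⟩ : ∃ a : ℝ, 1 < a ∧ a ≤ 5 / 4 ∧ (a - 1) * (S + δ) ^ 2 ≤ 1 ∧
      (a - 1) * (S + δ) ^ 2 ≤ δ ^ 2 / 5 := by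
    have hSδ : 0 < (S + δ) ^ 2 := by positivity
    refine ⟨1 + min (1/4) (min 1 (δ ^ 2 / 5) / (S + δ) ^ 2), ?_, ?_, ?_, ?_⟩
    · have : 0 < min (1/4) (min 1 (δ ^ 2 / 5) / (S + δ) ^ 2) := by positivity
      linarith
    · linarith [min_le_left (1/4) (min 1 (δ ^ 2 / 5) / (S + δ) ^ 2)]
    · have h := min_le_right (1/4) (min 1 (δ ^ 2 / 5) / (S + δ) ^ 2)
      rw [le_div_iff₀ hSδ] at h
      linarith [min_le_left 1 (δ ^ 2 / 5)]
    · have h := min_le_right (1/4) (min 1 (δ ^ 2 / 5) / (S + δ) ^ 2)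
      rw [le_div_iff₀ hSδ] at h
      linarith [min_le_right 1 (δ ^ 2 / 5)]
  have hsd : ∀ {s : ℝ}, |s| ≤ S → (a - 1) * (s - δ) ^ 2 ≤ (a - 1) * (S + δ) ^ 2 := by
    intro s h
    have h3 : (s - δ) ^ 2 ≤ (S + δ) ^ 2 := by
      apply sq_le_sq'
      · linarith [(abs_le.1 h).1]
      · linarith [(abs_le.1 h).2]
    have : 0 ≤ a - 1 := by linarith
    gcongr
  set f0 := δ ^ 2 / 2 with hf0
  have hf0p : 0 < f0 := by positivity
  set K := Bset a δ S f0 c2 with hKdef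
  have hKc : IsCompact K := isCompact_Bset δ S f0 c2 (by linarith)
  have he : ∀ x ∈ K, (a ^ 2 - a) * (co 0 x - δ) ^ 2 ≤ fq a δ x / 2 := by
    intro x hx
    have h1 := hsd hx.1
    have h2 := hx.2.1
    have e : (a ^ 2 - a) * (co 0 x - δ) ^ 2 = a * ((a - 1) * (co 0 x - δ) ^ 2) := by ring
    rw [e]
    have h3 : 0 ≤ (a - 1) * (co 0 x - δ) ^ 2 := by
      have : 0 ≤ a - 1 := by linarith
      positivity
    have : a * ((a - 1) * (co 0 x - δ) ^ 2) ≤ 5 / 4 * (δ ^ 2 / 5) := by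
      have h4 := h1.trans ha4
      gcongr
    rw [hf0] at h2
    linarith
  have hfc : Continuous (fq a δ) := (contDiff_fq a δ).continuous
  have hcc : Continuous fun x : Spc => |x.1| := continuous_fst.abs
  -- geometric consequences
  have hgeo : ∀ x : Spc, 0 < fq 1 0 x → |x.1| ≤ S → b ≤ ‖x.2‖ + x.1 → fq a δ x ≤ c2 →
      |x.1| ≤ S1 ∧ x ∈ K := by
    intro x h1 h2 h3 h4
    have hx2 : 0 < ‖x.2‖ ^ 2 - x.1 ^ 2 := by rw [← fq_ten]; exact h1
    obtain ⟨g1, g2⟩ := geo1 (M := M) (norm_nonneg _) hδp hx2 (by linarith)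
    have hf := fq_norm a δ x
    have h5 := hsd h2
    have e : fq a δ x = ‖x.2‖ ^ 2 - (x.1 - δ) ^ 2 - (a - 1) * (x.1 - δ) ^ 2 := by rw [hf]; ring
    refine ⟨g2 (by rw [hM]; rw [hc2] at h4; linarith), h2, ?_, h4⟩
    rw [hf0]
    have := sq_nonneg δ
    linarith
  -- the cut-off functions
  set ε : ℕ → ℝ := fun n => 1 / ((n:ℝ) + 1) with hε
  have hεp : ∀ n, 0 < ε n := fun n => by rw [hε]; positivity
  set v : ℕ → Fin N → Spc → ℝ := fun n I x =>
    if 0 < fq 1 0 x ∧ |x.1| < S then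
      sg ((ε n)⁻¹ * fq 1 0 x - 1) * (sg (c2 - fq a δ x) * w I x) else 0 with hv
  have hvn : ∀ n I x, v n I x ≠ 0 → ε n < fq 1 0 x ∧ |x.1| ≤ S1 ∧ fq a δ x < c2 ∧ x ∈ K := by
    intro n I x hx
    simp only [hv] at hx
    split_ifs at hx with hc
    · have k1 : 0 < (ε n)⁻¹ * fq 1 0 x - 1 := by
        by_contra h; exact hx (by rw [sg_zero (not_lt.1 h), zero_mul])
      have k2 : fq a δ x < c2 := by
        by_contra h
        have h9 : sg (c2 - fq a δ x) = 0 := sg_zero (by linarith [not_lt.1 h])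
        exact hx (by rw [h9, zero_mul, mul_zero])
      have k3 : b ≤ ‖x.2‖ + x.1 := by
        by_contra h; exact hx (by rw [h0 I x hc.1 (not_le.1 h).le]; simp)
      have k4 := hgeo x hc.1 hc.2.le k3 k2.le
      refine ⟨?_, k4.1, k2, k4.2⟩
      have h5 : (ε n)⁻¹ * ε n = 1 := inv_mul_cancel₀ (hεp n).ne'
      have h6 := inv_pos.2 (hεp n)
      by_contra h
      have : (ε n)⁻¹ * fq 1 0 x ≤ (ε n)⁻¹ * ε n := by gcongr; exact not_lt.1 h
      linarith
    · exact absurd rfl hx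
  have hz1 : ∀ n I x, fq 1 0 x < ε n → v n I =ᶠ[𝓝 x] fun _ => 0 := by
    intro n I x hx
    filter_upwards [hX2c.continuousAt.eventually_lt continuousAt_const hx] with y hy
    by_contra h; exact absurd (hvn n I y h).1 (not_lt.2 hy.le)
  have hz2 : ∀ n I x, S1 < |x.1| → v n I =ᶠ[𝓝 x] fun _ => 0 := by
    intro n I x hx
    filter_upwards [continuousAt_const.eventually_lt hcc.continuousAt hx] with y hy
    by_contra h; exact absurd (hvn n I y h).2.1 (not_le.2 hy)
  have hz3 : ∀ n I x, c2 < fq a δ x → v n I =ᶠ[𝓝 x] fun _ => 0 := by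
    intro n I x hx
    filter_upwards [continuousAt_const.eventually_lt hfc.continuousAt hx] with y hy
    by_contra h; exact absurd (hvn n I y h).2.2.1 (not_lt.2 hy.le)
  have hz4 : ∀ n I x, x ∉ K → v n I =ᶠ[𝓝 x] fun _ => 0 := by
    intro n I x hx
    filter_upwards [hKc.isClosed.isOpen_compl.mem_nhds hx] with y hy
    by_contra h; exact hy (hvn n I y h).2.2.2
  have hreg : ∀ x : Spc, 0 < fq 1 0 x → |x.1| < S → ∀ᶠ y in 𝓝 x, 0 < fq 1 0 y ∧ |y.1| < S := by
    intro x h1 h2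
    exact (continuousAt_const.eventually_lt hX2c.continuousAt h1).and
      (hcc.continuousAt.eventually_lt continuousAt_const h2)
  have hloc : ∀ n I x, 0 < fq 1 0 x → |x.1| < S → v n I =ᶠ[𝓝 x] fun y =>
      sg ((ε n)⁻¹ * fq 1 0 y - 1) * (sg (c2 - fq a δ y) * w I y) := by
    intro n I x h1 h2
    filter_upwards [hreg x h1 h2] with y hy
    simp only [hv, if_pos hy]
  -- the compact set with chi bounds
  set K2 := Bset a δ S (-(5 / 4) * (S + δ) ^ 2) c2 with hK2
  have hK2c : IsCompact K2 := isCompact_Bset δ S _ c2 (by linarith)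
  have hK2m : ∀ x : Spc, |x.1| < S → fq a δ x ≤ c2 → x ∈ K2 := by
    intro x h1 h2
    refine ⟨h1.le, ?_, h2⟩
    rw [fq_norm]
    have h5 := hsd h1.le
    have h3 : (x.1 - δ) ^ 2 ≤ (S + δ) ^ 2 := by
      apply sq_le_sq'
      · linarith [(abs_le.1 h1.le).1]
      · linarith [(abs_le.1 h1.le).2]
    have h4 : a * (x.1 - δ) ^ 2 ≤ 5 / 4 * (S + δ) ^ 2 := by gcongr
    have := sq_nonneg ‖x.2‖
    linarith
  obtain ⟨hχs, B, hB0, hB⟩ := chi_bound a δ c2 hK2c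
  obtain ⟨R0, hR0⟩ := hK2c.isBounded.exists_norm_le
  set R := |R0| with hR
  have hRn : ∀ x ∈ K2, ‖x‖ ≤ R := fun x hx => (hR0 x hx).trans (le_abs_self _)
  have hRp : 0 ≤ R := abs_nonneg _
  obtain ⟨C, hC, hw⟩ := hbd2 R hRp
  obtain ⟨bb, hbb, hbb1, hbb2⟩ := dsg_bound
  have hvs : ∀ n I, ContDiff ℝ (⊤ : ℕ∞) (v n I) := by
    intro n I
    rw [contDiff_iff_contDiffAt]
    intro x
    rcases lt_or_ge (fq 1 0 x) (ε n) with h1 | h1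
    · exact contDiffAt_const.congr_of_eventuallyEq (hz1 n I x h1)
    · rcases lt_or_ge S1 |x.1| with h2 | h2
      · exact contDiffAt_const.congr_of_eventuallyEq (hz2 n I x h2)
      · have hp : 0 < fq 1 0 x := (hεp n).trans_le h1
        refine ContDiffAt.congr_of_eventuallyEq ?_ (hloc n I x hp (by linarith))
        exact (kap_facts (ε n) x).1.mul (hχs.contDiffAt.mul (hs I x hp))
  set R3 := R + R ^ 2 with hR3
  have hR3p : 0 ≤ R3 := by positivity
  have hb1 : ∀ n I x, |box (v n I) x| ≤ (9 + 5 * R3) * B * C * (1 + 40 * bb) := by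
    intro n I x
    have hpos : 0 ≤ (9 + 5 * R3) * B * C * (1 + 40 * bb) := by positivity
    rcases lt_or_ge (fq 1 0 x) (ε n) with h1 | h1
    · rw [(box_zero_loc (hz1 n I x h1)).2.2, abs_zero]; exact hpos
    · rcases lt_or_ge S1 |x.1| with h2 | h2
      · rw [(box_zero_loc (hz2 n I x h2)).2.2, abs_zero]; exact hpos
      · rcases lt_or_ge c2 (fq a δ x) with h3 | h3
        · rw [(box_zero_loc (hz3 n I x h3)).2.2, abs_zero]; exact hpos
        · have hp : 0 < fq 1 0 x := (hεp n).trans_le h1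
          have hxS : |x.1| < S := by linarith
          have hxK := hK2m x hxS h3
          have hxR := hRn x hxK
          rw [box_congr (hloc n I x hp hxS)]
          obtain ⟨w1, w2, w3, w4, w5⟩ := hw x hp hxR I
          obtain ⟨q1, q2, q3⟩ := hB x hxK
          have hX2R : fq 1 0 x ≤ R3 := (fq_le_sq hxR).trans (by rw [hR3]; linarith)
          obtain ⟨m1, m2, m3⟩ := mul_bounds hχs.contDiffAt (hs I x hp) hB0 hC hR3p q1 q2 q3
            (fun α => (abs_co_le α x).trans (hxR.trans (by rw [hR3]; linarith [sq_nonneg R]))) hp.le hX2R w3 w4 w2 w5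
          exact box_kap_le (v := fun y => sg (c2 - fq a δ y) * w I y) (hεp n) (by positivity) hbb.le hp hbb1 hbb2
            (hχs.contDiffAt.mul (hs I x hp)) m1 m2 m3
  have hwl : ∀ n I x, 2 * ε n < fq 1 0 x → |x.1| < S → fq a δ x < c1 → v n I x = w I x := by
    intro n I x h1 h2 h3
    have hp : 0 < fq 1 0 x := by linarith [hεp n]
    simp only [hv, if_pos (And.intro hp h2)]
    have h5 : (ε n)⁻¹ * ε n = 1 := inv_mul_cancel₀ (hεp n).ne'
    have h6 := inv_pos.2 (hεp n)
    have h7 : (ε n)⁻¹ * (2 * ε n) ≤ (ε n)⁻¹ * fq 1 0 x := by gcongr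
    rw [sg_one (by linarith), sg_one (by rw [hc2]; rw [hc1] at h3; linarith)]
    ring
  obtain ⟨hNm, hNt⟩ := vol_tend K hKc
  have hX0S : |X0.1| ≤ S1 := (geo1 (M := M) (norm_nonneg _) hδp hX0' (by linarith)).2
    (by rw [hM]; linarith)
  have hX0f : fq a δ X0 < c1 := by
    rw [fq_norm, hc1, hc0]
    nlinarith [sq_nonneg (X0.1 - δ)]
  have hsm : ∀ᶠ x in 𝓝 X0, fq 1 0 X0 / 2 < fq 1 0 x ∧ |x.1| < S ∧ fq a δ x < c1 :=
    (continuousAt_const.eventually_lt hX2c.continuousAt (by linarith)).and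
      ((hcc.continuousAt.eventually_lt continuousAt_const (by linarith)).and
        (hfc.continuousAt.eventually_lt continuousAt_const hX0f))
  obtain ⟨ρ, hρ, hball⟩ := Metric.eventually_nhds_iff_ball.1 hsm
  have hεt : Tendsto ε atTop (𝓝 0) := tendsto_one_div_add_atTop_nhds_zero_nat
  refine carl_uniq (c1 := c1) (v := v) (I := I0) ha1 ha2 hf0p he hvs
    (fun n I x h => (hvn n I x h).2.2.2) hC hb1 hNm (fun n => inter_subset_left) hNt ?_ hX0f
    (hs I0 X0 hX0).continuousAt hρ ?_
  · intro n I x hxN hxc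
    have hsz := sz_nonneg (v n) x
    have hpos : 0 ≤ C * sz (v n) x := by positivity
    by_cases hxK : x ∈ K
    · rcases lt_or_ge (fq 1 0 x) (ε n) with h1 | h1
      · rw [(box_zero_loc (hz1 n I x h1)).2.2, abs_zero]; exact hpos
      · have hp : 0 < fq 1 0 x := (hεp n).trans_le h1
        have h2 : 2 * ε n < fq 1 0 x := by
          by_contra h; exact hxN ⟨hxK, hp, not_lt.1 h⟩
        rcases lt_or_ge S1 |x.1| with h3 | h3
        · rw [(box_zero_loc (hz2 n I x h3)).2.2, abs_zero]; exact hpos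
        · have hxS : |x.1| < S := by linarith
          have hev : ∀ J, v n J =ᶠ[𝓝 x] w J := by
            intro J
            filter_upwards [continuousAt_const.eventually_lt hX2c.continuousAt h2,
              hcc.continuousAt.eventually_lt continuousAt_const hxS,
              hfc.continuousAt.eventually_lt continuousAt_const hxc] with y k1 k2 k3
              using hwl n J y k1 k2 k3
          have hszz : sz (v n) x = sz w x := by
            unfold sz
            refine Finset.sum_congr rfl fun J _ => ?_
            rw [(hev J).eq_of_nhds]
            simp only [pd_congr (hev J)]
          rw [box_congr (hev I), hszz]
          exact (hw x hp (hRn x (hK2m x hxS hxK.2.2)) I).1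
    · rw [(box_zero_loc (hz4 n I x hxK)).2.2, abs_zero]; exact hpos
  · have : ∀ᶠ n in atTop, ε n < fq 1 0 X0 / 4 := hεt.eventually_lt_const (by linarith)
    filter_upwards [this] with n hn x hx
    obtain ⟨k1, k2, k3⟩ := hball x hx
    exact hwl n I0 x (by linarith) k2 k3

end

section
lemma HasPD.chain {g : Spc → ℝ} {Ψ : Spc → Spc} {D : Fin 4 → Fin 4 → ℝ} {x : Spc}
    (hΨ : ∀ β, HasPD (fun y => co β (Ψ y)) (D β) x) (hg : DifferentiableAt ℝ g (Ψ x)) :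
    HasPD (fun y => g (Ψ y)) (fun α => ∑ β, D β α * UCP.pd β g (Ψ x)) x := by
  have hd : HasFDerivAt Ψ (∑ β, (fderiv ℝ (fun y => co β (Ψ y)) x).smulRight (eVec β)) x := by
    have : HasFDerivAt (fun y => ∑ β, co β (Ψ y) • eVec β)
        (∑ β, (fderiv ℝ (fun y => co β (Ψ y)) x).smulRight (eVec β)) x :=
      HasFDerivAt.fun_sum fun β _ => (hΨ β).1.hasFDerivAt.smul_const (eVec β)
    exact this.congr_of_eventuallyEq (Eventually.of_forall fun y => spc_sum _)
  refine (HasPD.of_hasFDerivAt (hg.hasFDerivAt.comp x hd)).congr_d fun α => ?_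
  simp only [ContinuousLinearMap.comp_apply, _root_.sum_apply,
    ContinuousLinearMap.smulRight_apply, map_sum, map_smul, smul_eq_mul]
  refine Finset.sum_congr rfl fun β _ => ?_
  rw [← (hΨ β).2 α]; rfl

/-- base point -/
def Vp (R : ℝ) : Spc := (R, 0)

/-- inversion -/
def Psi (R : ℝ) (X : Spc) : Spc := Vp R + (fq 1 0 X)⁻¹ • X

lemma co_Psi (R : ℝ) (X : Spc) (β : Fin 4) :
    co β (Psi R X) = co β (Vp R) + (fq 1 0 X)⁻¹ * co β X := by
  rw [Psi, co_add, co_smul]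

lemma co_Vp (R : ℝ) : co 0 (Vp R) = R ∧ co 1 (Vp R) = 0 ∧ co 2 (Vp R) = 0 ∧ co 3 (Vp R) = 0 := by
  simp [Vp, co_one, co_two, co_three]

lemma fq_Psi (R : ℝ) {X : Spc} (hX : 0 < fq 1 0 X) : fq 1 R (Psi R X) = (fq 1 0 X)⁻¹ := by
  obtain ⟨h0, h1, h2, h3⟩ := co_Vp R
  have e : fq 1 R (Psi R X) = (fq 1 0 X)⁻¹ ^ 2 * fq 1 0 X := by
    rw [fq_expand 1 R]; simp only [co_Psi, h0, h1, h2, h3]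
    have := fq_expand 1 0 X
    generalize (fq 1 0 X)⁻¹ = i
    rw [this]; ring
  rw [e]; field_simp

lemma hasPD_q (X : Spc) : HasPD (fq 1 0) (fun α => 2 * eta α * co α X) X :=
  (hasPD_fq 1 0 X).congr_d fun α => by simp [fd, cc, dd, eta]

lemma hasPD_i {X : Spc} (hX : 0 < fq 1 0 X) :
    HasPD (fun x => (fq 1 0 x)⁻¹) (fun α => -2 * (eta α * co α X) * (fq 1 0 X)⁻¹ ^ 2) X :=
  ((hasPD_q X).inv hX.ne').congr_d fun α => by rw [inv_pow]; ring

lemma hasPD_Psi (R : ℝ) {X : Spc} (hX : 0 < fq 1 0 X) (β : Fin 4) :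
    HasPD (fun x => co β (Psi R x)) (fun α => (if β = α then (fq 1 0 X)⁻¹ else 0)
      - 2 * (eta α * co α X) * (fq 1 0 X)⁻¹ ^ 2 * co β X) X := by
  have h := ((hasPD_const (co β (Vp R)) X).add ((hasPD_i hX).mul (hasPD_co β X)))
  refine (h.congr_f (Eventually.of_forall fun x => co_Psi R x β)).congr_d fun α => ?_
  split_ifs <;> ring

lemma hasPD_gPsi (R : ℝ) {X : Spc} (hX : 0 < fq 1 0 X) {g : Spc → ℝ}
    (hg : DifferentiableAt ℝ g (Psi R X)) :
    HasPD (fun x => g (Psi R x)) (fun α => (fq 1 0 X)⁻¹ * pd α g (Psi R X)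
      - 2 * (eta α * co α X) * (fq 1 0 X)⁻¹ ^ 2 * ∑ β, co β X * pd β g (Psi R X)) X := by
  refine (HasPD.chain (fun β => hasPD_Psi R hX β) hg).congr_d fun α => ?_
  simp only [sub_mul, Finset.sum_sub_distrib, ite_mul, zero_mul, Finset.sum_ite_eq',
    Finset.mem_univ, if_true, Finset.sum_ite_eq, Finset.mul_sum]
  congr 1
  exact Finset.sum_congr rfl fun β _ => by ring

/-- Kelvin transform -/
def kel (R : ℝ) (g : Spc → ℝ) (X : Spc) : ℝ := (fq 1 0 X)⁻¹ * g (Psi R X)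

lemma contDiffAt_Psi (R : ℝ) {X : Spc} (hX : 0 < fq 1 0 X) :
    ContDiffAt ℝ (⊤ : ℕ∞) (Psi R) X :=
  contDiffAt_const.add (((contDiff_fq 1 0).contDiffAt.inv hX.ne').smul contDiffAt_id)

lemma kel_smooth (R : ℝ) {X : Spc} (hX : 0 < fq 1 0 X) {g : Spc → ℝ}
    (hg : ContDiffAt ℝ (⊤ : ℕ∞) g (Psi R X)) : ContDiffAt ℝ (⊤ : ℕ∞) (kel R g) X :=
  ((contDiff_fq 1 0).contDiffAt.inv hX.ne').mul (hg.comp X (contDiffAt_Psi R hX))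

lemma kel_pd (R : ℝ) {X : Spc} (hX : 0 < fq 1 0 X) {g : Spc → ℝ}
    (hg : DifferentiableAt ℝ g (Psi R X)) (α : Fin 4) :
    pd α (kel R g) X = -2 * (eta α * co α X) * (fq 1 0 X)⁻¹ ^ 2 * g (Psi R X)
      + (fq 1 0 X)⁻¹ ^ 2 * pd α g (Psi R X)
      - 2 * (eta α * co α X) * (fq 1 0 X)⁻¹ ^ 3 * ∑ β, co β X * pd β g (Psi R X) := by
  have h := ((hasPD_i hX).mul (hasPD_gPsi R hX hg)).2 α
  unfold kel
  rw [h]; ring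

lemma kel_box (R : ℝ) {X : Spc} (hX : 0 < fq 1 0 X) {g : Spc → ℝ}
    (hg : ContDiffAt ℝ (⊤ : ℕ∞) g (Psi R X)) :
    box (kel R g) X = (fq 1 0 X)⁻¹ ^ 3 * box g (Psi R X) := by
  have hq : Continuous (fq 1 0) := (contDiff_fq 1 0).continuous
  have hev : ∀ᶠ x in 𝓝 X, 0 < fq 1 0 x ∧ DifferentiableAt ℝ g (Psi R x) := by
    refine (continuousAt_const.eventually_lt hq.continuousAt hX).and ?_
    have h1 : ∀ᶠ y in 𝓝 (Psi R X), DifferentiableAt ℝ g y := by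
      filter_upwards [(hg.of_le (m := 1) (by simp)).eventually (by simp)] with x hx
        using hx.differentiableAt (by simp)
    exact (contDiffAt_Psi R hX).continuousAt.eventually h1
  have e1 : ∀ α, pd α (kel R g) =ᶠ[𝓝 X] fun x =>
      -2 * (eta α * co α x) * (fq 1 0 x)⁻¹ ^ 2 * g (Psi R x)
      + (fq 1 0 x)⁻¹ ^ 2 * pd α g (Psi R x)
      - 2 * (eta α * co α x) * (fq 1 0 x)⁻¹ ^ 3 * ∑ β, co β x * pd β g (Psi R x) := by
    intro α
    filter_upwards [hev] with x hx using kel_pd R hx.1 hx.2 α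
  have hA := hasPD_gPsi R hX (diffAt_of_smooth hg)
  have hB := fun β => hasPD_gPsi R hX (diffAt_of_smooth (contDiffAt_pd hg β))
  have hi := hasPD_i hX
  have hE := HasPD.sum Finset.univ fun β _ => (hasPD_co β X).mul (hB β)
  rw [box_eq, box_eq]
  set i := (fq 1 0 X)⁻¹ with hidef
  set A := g (Psi R X)
  set E := ∑ β, co β X * pd β g (Psi R X) with hEdef
  set K : Fin 4 → ℝ := fun β => ∑ γ, co γ X * pd γ (pd β g) (Psi R X) with hK
  set L := ∑ β, co β X * K β with hL
  have hiq : i * fq 1 0 X = 1 := inv_mul_cancel₀ hX.ne'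
  have h2 : ∀ α, pd α (pd α (kel R g)) X =
      (-2 * eta α * i ^ 2 * A + 8 * (eta α * co α X) ^ 2 * i ^ 3 * A
        - 2 * (eta α * co α X) * i ^ 2 * (i * pd α g (Psi R X) - 2 * (eta α * co α X) * i ^ 2 * E))
      + (-4 * (eta α * co α X) * i ^ 3 * pd α g (Psi R X)
        + i ^ 2 * (i * pd α (pd α g) (Psi R X) - 2 * (eta α * co α X) * i ^ 2 * K α))
      + (-2 * eta α * i ^ 3 * E + 12 * (eta α * co α X) ^ 2 * i ^ 4 * E
        - 2 * (eta α * co α X) * i ^ 3 * (pd α g (Psi R X) +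
          i * (∑ β, co β X * pd α (pd β g) (Psi R X)) - 2 * (eta α * co α X) * i ^ 2 * L)) := by
    intro α
    rw [pd_congr (e1 α) α]
    have hcα := (hasPD_co α X).const_mul (eta α)
    have hi2 := hi.sq
    have hi3 := hi.mul hi2
    have t1 := ((hcα.const_mul (-2)).mul hi2).mul hA
    have t2 := hi2.mul (hB α)
    have t3 := ((hcα.const_mul 2).mul hi3).mul hE
    have t := (t1.add t2).sub t3
    have t' := (t.congr_f (g := fun x =>
      -2 * (eta α * co α x) * (fq 1 0 x)⁻¹ ^ 2 * g (Psi R x)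
      + (fq 1 0 x)⁻¹ ^ 2 * pd α g (Psi R x)
      - 2 * (eta α * co α x) * (fq 1 0 x)⁻¹ ^ 3 * ∑ β, co β x * pd β g (Psi R x))
      (Eventually.of_forall fun x => by ring)).2 α
    rw [t']
    beta_reduce
    have hsum : ∑ β, ((if β = α then (1:ℝ) else 0) * pd β g (Psi R X) + co β X *
        (i * pd α (pd β g) (Psi R X) - 2 * (eta α * co α X) * i ^ 2 *
          ∑ γ, co γ X * pd γ (pd β g) (Psi R X))) =
        pd α g (Psi R X) + i * (∑ β, co β X * pd α (pd β g) (Psi R X))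
          - 2 * (eta α * co α X) * i ^ 2 * L := by
      rw [hL, hK, Finset.sum_add_distrib, Finset.mul_sum, Finset.mul_sum, add_sub_assoc,
        ← Finset.sum_sub_distrib]
      congr 1
      · simp
      · exact Finset.sum_congr rfl fun β _ => by ring
    rw [← hidef, hsum]
    simp only [if_true]
    rw [← hEdef]
    ring
  have e2 : ∑ α, eta α * pd α (pd α (kel R g)) X = i ^ 3 * ∑ α, eta α * pd α (pd α g) (Psi R X)
      + (i * fq 1 0 X - 1) * (8 * i ^ 2 * A + 16 * i ^ 3 * E + 4 * i ^ 4 * L) := by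
    simp only [h2]
    have hL2 : L = ∑ α, co α X * ∑ β, co β X * pd α (pd β g) (Psi R X) := by
      rw [hL, hK]
      simp only [Finset.mul_sum]
      rw [Finset.sum_comm]
      exact Finset.sum_congr rfl fun β _ => Finset.sum_congr rfl fun γ _ => by ring
    have hq4 := fq_expand 1 0 X
    have hE4 : E = co 0 X * pd 0 g (Psi R X) + co 1 X * pd 1 g (Psi R X) + co 2 X * pd 2 g (Psi R X)
        + co 3 X * pd 3 g (Psi R X) := by rw [hEdef, Fin.sum_univ_four]
    have hL4 : L = co 0 X * K 0 + co 1 X * K 1 + co 2 X * K 2 + co 3 X * K 3 := by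
      rw [hL, Fin.sum_univ_four]
    clear_value i A E K L
    generalize hZ : (fun α => ∑ β, co β X * pd α (pd β g) (Psi R X)) = Z at *
    have hZ' : ∀ α, ∑ β, co β X * pd α (pd β g) (Psi R X) = Z α := fun α => by rw [← hZ]
    simp only [hZ'] at hL2 ⊢
    rw [Fin.sum_univ_four] at hL2
    simp only [Fin.sum_univ_four, eta_zero, eta_one, eta_two, eta_three]
    linear_combination (8 * i ^ 3 * A + 16 * i ^ 4 * E + 4 * i ^ 5 * L) * (-hq4) + 8 * i ^ 3 * hE4
      + 2 * i ^ 4 * hL4 + 2 * i ^ 4 * hL2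
  rw [e2, hiq]; ring

end

section
/-- shifted scaling field -/
def Sp (R : ℝ) (g : Spc → ℝ) (Y : Spc) : ℝ := ∑ α, co α (Y - Vp R) * pd α g Y

/-- tangential derivative -/
def Tg (i : Fin 3) (g : Spc → ℝ) (Y : Spc) : ℝ := pd i.succ g Y + Y.2 i / ‖Y.2‖ * pd 0 g Y

lemma kel_inv (R : ℝ) {X : Spc} (hX : 0 < fq 1 0 X) {g : Spc → ℝ}
    (hg : DifferentiableAt ℝ g (Psi R X)) :
    g (Psi R X) = fq 1 0 X * kel R g X ∧
    (fq 1 0 X)⁻¹ * (∑ β, co β X * pd β g (Psi R X)) = Sp R g (Psi R X) ∧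
    Sx (kel R g) X = -2 * kel R g X - (fq 1 0 X)⁻¹ * Sp R g (Psi R X) ∧
    (∀ α, pd α g (Psi R X) = fq 1 0 X ^ 2 * pd α (kel R g) X
      - 2 * fq 1 0 X * (eta α * co α X) * (kel R g X + Sx (kel R g) X)) := by
  have h1 : g (Psi R X) = fq 1 0 X * kel R g X := by unfold kel; field_simp
  have h2 : (fq 1 0 X)⁻¹ * (∑ β, co β X * pd β g (Psi R X)) = Sp R g (Psi R X) := by
    rw [Sp, Finset.mul_sum]
    refine Finset.sum_congr rfl fun β _ => ?_
    rw [co_sub, co_Psi]; ring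
  have hp := kel_pd R hX hg
  have hk : kel R g X = (fq 1 0 X)⁻¹ * g (Psi R X) := rfl
  have hiq : (fq 1 0 X)⁻¹ * fq 1 0 X = 1 := inv_mul_cancel₀ hX.ne'
  have h3 : Sx (kel R g) X = -2 * kel R g X - (fq 1 0 X)⁻¹ * Sp R g (Psi R X) := by
    rw [← h2, hk, Sx]
    simp only [hp]
    have hq4 := fq_expand 1 0 X
    set q := fq 1 0 X
    set i := q⁻¹
    clear_value i q
    set E := ∑ β, co β X * pd β g (Psi R X) with hE
    rw [Fin.sum_univ_four] at hE
    clear_value E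
    simp only [Fin.sum_univ_four, eta_zero, eta_one, eta_two, eta_three]
    linear_combination (-2 * i ^ 2 * g (Psi R X) - 2 * i ^ 3 * E) * (-hq4) - i ^ 2 * hE
      + (-2 * i * g (Psi R X) - 2 * i ^ 2 * E) * hiq
  refine ⟨h1, h2, h3, fun α => ?_⟩
  rw [h3, ← h2, hp α, hk]
  set q := fq 1 0 X
  set i := q⁻¹
  clear_value i q
  generalize ∑ β, co β X * pd β g (Psi R X) = E
  linear_combination (-(i * q + 1) * pd α g (Psi R X)
    + (2 * (eta α * co α X) * (i * q + 1) * g (Psi R X) - 2 * (eta α * co α X) * g (Psi R X))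
    + 2 * (eta α * co α X) * i * E * (i * q + 1) - 2 * (eta α * co α X) * i * E) * hiq

lemma kel_T (R : ℝ) {X : Spc} (hX : 0 < fq 1 0 X) {g : Spc → ℝ}
    (hg : DifferentiableAt ℝ g (Psi R X)) (i : Fin 3) :
    Tg i g (Psi R X) = fq 1 0 X ^ 2 * Tg i (kel R g) X
      - 2 * fq 1 0 X * (X.2 i / ‖X.2‖ * (‖X.2‖ - X.1)) * (kel R g X + Sx (kel R g) X) := by
  obtain ⟨_, _, _, h4⟩ := kel_inv R hX hg
  have hr : 0 < ‖X.2‖ := by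
    rw [fq_ten] at hX
    have : 0 ≤ ‖X.2‖ := norm_nonneg _
    rcases this.eq_or_lt with h | h
    · rw [← h] at hX; nlinarith [sq_nonneg X.1]
    · exact h
  have hi := inv_pos.2 hX
  have e : (Psi R X).2 i / ‖(Psi R X).2‖ = X.2 i / ‖X.2‖ := by
    have : (Psi R X).2 = (fq 1 0 X)⁻¹ • X.2 := by simp [Psi, Vp]
    rw [this, norm_smul, Real.norm_eq_abs, abs_of_pos hi]
    simp only [PiLp.smul_apply, smul_eq_mul]
    rw [mul_div_mul_left _ _ hi.ne']
  have hes : eta i.succ = 1 := by simp [eta, Fin.succ_ne_zero]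
  unfold Tg
  rw [e, h4, h4, hes, eta_zero, co_succ, co_zero]
  have hx : X.2 i = X.2 i / ‖X.2‖ * ‖X.2‖ := by field_simp
  generalize X.2 i / ‖X.2‖ = o at hx ⊢
  rw [hx]; ring

lemma Sx_le {k : Spc → ℝ} {X : Spc} {R : ℝ} (h : ‖X‖ ≤ R) : |Sx k X| ≤ R * ∑ α, |pd α k X| := by
  unfold Sx
  refine (Finset.abs_sum_le_sum_abs _ _).trans ?_
  rw [Finset.mul_sum]
  refine Finset.sum_le_sum fun α _ => ?_
  rw [abs_mul]
  gcongr
  exact (abs_co_le α X).trans h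

lemma abs_om_le (X : Spc) (i : Fin 3) : |X.2 i / ‖X.2‖| ≤ 1 := by
  rw [abs_div, abs_norm]
  apply div_le_one_of_le₀ _ (norm_nonneg _)
  simpa using PiLp.norm_apply_le X.2 i

lemma abs_eta (α : Fin 4) : |eta α| = 1 := by unfold eta; split_ifs <;> simp

/-- first order bounds of `g` in terms of its Kelvin transform -/
lemma kel_sz {R₁ R b : ℝ} {X : Spc} (hX : 0 < fq 1 0 X) {g : Spc → ℝ} (hR : 1 ≤ R) (hXR : ‖X‖ ≤ R)
    (hb : 0 < b) (hp : b ≤ ‖X.2‖ + X.1)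
    (hg : DifferentiableAt ℝ g (Psi R₁ X)) :
    (|g (Psi R₁ X)| + ∑ α, |pd α g (Psi R₁ X)|) ≤
      13 * R ^ 2 * fq 1 0 X * (|kel R₁ g X| + ∑ α, |pd α (kel R₁ g) X|) ∧
    ∑ i, |Tg i g (Psi R₁ X)| ≤ 3 * (fq 1 0 X ^ 2 * (2 + 2 * R / b)) *
      (|kel R₁ g X| + ∑ α, |pd α (kel R₁ g) X|) := by
  obtain ⟨h1, h2, h3, h4⟩ := kel_inv R₁ hX hg
  have hS := Sx_le (k := kel R₁ g) hXR
  set q := fq 1 0 X with hq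
  set a0 := |kel R₁ g X| with ha0
  set a1 := ∑ α, |pd α (kel R₁ g) X| with ha1
  have a0n : 0 ≤ a0 := abs_nonneg _
  have a1n : 0 ≤ a1 := Finset.sum_nonneg fun _ _ => abs_nonneg _
  have hpa : ∀ α, |pd α (kel R₁ g) X| ≤ a1 := fun α =>
    Finset.single_le_sum (f := fun α => |pd α (kel R₁ g) X|) (fun _ _ => abs_nonneg _) (Finset.mem_univ α)
  have hqR : q ≤ R ^ 2 := fq_le_sq hXR
  have hKS : |kel R₁ g X + Sx (kel R₁ g) X| ≤ R * (a0 + a1) := by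
    refine (abs_add_le _ _).trans ?_
    nlinarith
  constructor
  · have hd : ∀ α, |pd α g (Psi R₁ X)| ≤ 3 * R ^ 2 * q * (a0 + a1) := by
      intro α
      rw [h4 α]
      refine (abs_sub _ _).trans ?_
      rw [abs_mul, abs_mul, abs_mul, abs_mul, abs_mul, abs_eta, abs_two, abs_of_pos hX,
        abs_of_pos (pow_pos hX 2)]
      have t1 : q ^ 2 * |pd α (kel R₁ g) X| ≤ (R ^ 2 * q) * (a0 + a1) := by
        have := hpa α
        calc q ^ 2 * |pd α (kel R₁ g) X| = (q * q) * |pd α (kel R₁ g) X| := by ring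
          _ ≤ (R ^ 2 * q) * (a0 + a1) := by gcongr; linarith
      have t2 : 2 * q * (1 * |co α X|) * |kel R₁ g X + Sx (kel R₁ g) X| ≤
          2 * q * (1 * R) * (R * (a0 + a1)) := by
        have := (abs_co_le α X).trans hXR
        gcongr
      linarith
    have hsum : ∑ α, |pd α g (Psi R₁ X)| ≤ ∑ _α : Fin 4, 3 * R ^ 2 * q * (a0 + a1) :=
      Finset.sum_le_sum fun α _ => hd α
    simp only [Finset.sum_const, Finset.card_univ, Fintype.card_fin, nsmul_eq_mul] at hsum
    have h0 : |g (Psi R₁ X)| ≤ R ^ 2 * q * (a0 + a1) := by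
      rw [h1, abs_mul, abs_of_pos hX]
      have : (1:ℝ) ≤ R ^ 2 := one_le_pow₀ hR
      calc q * |kel R₁ g X| = 1 * q * a0 := by ring
        _ ≤ R ^ 2 * q * (a0 + a1) := by gcongr; linarith
    push_cast at hsum
    linarith
  · have hd : ∀ i, |Tg i g (Psi R₁ X)| ≤ (q ^ 2 * (2 + 2 * R / b)) * (a0 + a1) := by
      intro i
      rw [kel_T R₁ hX hg i]
      have ho := abs_om_le X i
      have hm0 : 0 ≤ ‖X.2‖ - X.1 := by
        by_contra h
        have h5 : fq 1 0 X = (‖X.2‖ - X.1) * (‖X.2‖ + X.1) := by rw [fq_ten]; ring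
        nlinarith
      have hm : ‖X.2‖ - X.1 ≤ q / b := by
        rw [le_div_iff₀ hb]
        have h5 : q = (‖X.2‖ - X.1) * (‖X.2‖ + X.1) := by rw [hq, fq_ten]; ring
        rw [h5]; gcongr
      refine (abs_sub _ _).trans ?_
      have hT : |Tg i (kel R₁ g) X| ≤ 2 * (a0 + a1) := by
        unfold Tg
        refine (abs_add_le _ _).trans ?_
        rw [abs_mul]
        have k1 := hpa i.succ
        have k2 := hpa 0
        have : |X.2 i / ‖X.2‖| * |pd 0 (kel R₁ g) X| ≤ 1 * a1 := by gcongr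
        linarith
      rw [abs_mul, abs_mul, abs_mul, abs_mul, abs_mul, abs_two, ← hq, abs_of_pos hX,
        abs_of_pos (pow_pos hX 2), abs_of_nonneg hm0]
      have t1 : q ^ 2 * |Tg i (kel R₁ g) X| ≤ q ^ 2 * (2 * (a0 + a1)) := by gcongr
      have t2 : 2 * q * (|X.2 i / ‖X.2‖| * (‖X.2‖ - X.1)) * |kel R₁ g X + Sx (kel R₁ g) X| ≤
          2 * q * (1 * (q / b)) * (R * (a0 + a1)) := by gcongr
      have e : 2 * q * (1 * (q / b)) * (R * (a0 + a1)) = q ^ 2 * (2 * R / b) * (a0 + a1) := by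
        field_simp
      linarith
    have hsum : ∑ i, |Tg i g (Psi R₁ X)| ≤ ∑ _i : Fin 3, (q ^ 2 * (2 + 2 * R / b)) * (a0 + a1) :=
      Finset.sum_le_sum fun i _ => hd i
    simp only [Finset.sum_const, Finset.card_univ, Fintype.card_fin, nsmul_eq_mul] at hsum
    push_cast at hsum
    linarith

end

section
lemma kgeo {R₁ : ℝ} (hR₁ : 0 < R₁) {X : Spc} (hX : 0 < fq 1 0 X) :
    (‖X.2‖ + X.1 ≤ 1 / (2 * R₁) → (Psi R₁ X).1 + R₁ ≤ ‖(Psi R₁ X).2‖) ∧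
    (1 / (2 * R₁) ≤ ‖X.2‖ + X.1 → ‖(Psi R₁ X).2‖ ≤ (Psi R₁ X).1 + R₁ ∧ 0 < (Psi R₁ X).1 ∧
      (1 + (Psi R₁ X).1)⁻¹ ≤ 4 * R₁ * fq 1 0 X) := by
  have hi := inv_pos.2 hX
  have e2 : ‖(Psi R₁ X).2‖ = ‖X.2‖ / fq 1 0 X := by
    have : (Psi R₁ X).2 = (fq 1 0 X)⁻¹ • X.2 := by simp [Psi, Vp]
    rw [this, norm_smul, Real.norm_eq_abs, abs_of_pos hi]; field_simp
  have e1 : (Psi R₁ X).1 = R₁ + X.1 / fq 1 0 X := by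
    simp [Psi, Vp]; field_simp
  rw [e1, e2]
  have hq := fq_ten X
  have hr : 0 ≤ ‖X.2‖ := norm_nonneg _
  generalize fq 1 0 X = q at *
  generalize ‖X.2‖ = r at *
  generalize X.1 = s at *
  have hpm : |s| < r := abs_lt_of_sq_lt_sq (by linarith) hr
  have hp : 0 < r + s := by linarith [neg_abs_le s]
  have hm : 0 < r - s := by linarith [le_abs_self s]
  have hq2 : q = (r - s) * (r + s) := by rw [hq]; ring
  constructor
  · intro h
    rw [le_div_iff₀ (by positivity)] at h
    rw [le_div_iff₀ hX]
    have : (R₁ + s / q + R₁) * q = 2 * R₁ * q + s := by field_simp; ring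
    rw [this, hq2]; nlinarith
  · intro h
    rw [div_le_iff₀ (by positivity)] at h
    have hqt : (r + s) / 2 ≤ (R₁ + s / q) * q := by
      have : (R₁ + s / q) * q = R₁ * q + s := by field_simp
      rw [this, hq2]; nlinarith
    have ht : 0 < R₁ + s / q := by
      by_contra hc
      nlinarith
    refine ⟨?_, ht, ?_⟩
    · rw [div_le_iff₀ hX]
      have : (R₁ + s / q + R₁) * q = 2 * R₁ * q + s := by field_simp; ring
      rw [this, hq2]; nlinarith
    · rw [inv_le_iff_one_le_mul₀ (by linarith)]
      have : 0 ≤ 4 * R₁ * q := by positivity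
      nlinarith

set_option maxHeartbeats 800000 in
theorem kelvin_uniq {N : ℕ} {g : Fin N → Spc → ℝ} {R₁ : ℝ} (hR₁ : 0 < R₁)
    (hs : ∀ I Y, 0 < fq 1 R₁ Y → ContDiffAt ℝ (⊤ : ℕ∞) (g I) Y)
    (h0 : ∀ I Y, 0 < fq 1 R₁ Y → Y.1 + R₁ ≤ ‖Y.2‖ → g I Y = 0)
    (hbd : ∃ C : ℝ, 0 ≤ C ∧ ∀ Y : Spc, 0 < fq 1 R₁ Y → ‖Y.2‖ ≤ Y.1 + R₁ → 0 < Y.1 → ∀ I,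
      |g I Y| ≤ C * (1 + Y.1)⁻¹ ^ 2 ∧ |Sp R₁ (g I) Y| ≤ C * (1 + Y.1)⁻¹ ^ 2 ∧
      (∀ α, |pd α (g I) Y| ≤ C * (1 + Y.1)⁻¹ ^ 2) ∧
      |box (g I) Y| ≤ C * ((1 + Y.1)⁻¹ ^ 2 * sz g Y
        + (1 + Y.1)⁻¹ * ∑ J, ∑ i, |Tg i (g J) Y|)) :
    ∀ I Y, 0 < fq 1 R₁ Y → g I Y = 0 := by
  obtain ⟨C, hC, hbd⟩ := hbd
  have hpos : ∀ X, 0 < fq 1 0 X → 0 < fq 1 R₁ (Psi R₁ X) := fun X hX => by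
    rw [fq_Psi R₁ hX]; exact inv_pos.2 hX
  have key : ∀ I X, 0 < fq 1 0 X → kel R₁ (g I) X = 0 := by
    refine Mhat (w := fun I => kel R₁ (g I)) (b := 1 / (2 * R₁)) (by positivity) ?_ ?_ ?_
    · intro I X hX
      exact kel_smooth R₁ hX (hs I _ (hpos X hX))
    · intro I X hX hle
      simp [kel, h0 I _ (hpos X hX) ((kgeo hR₁ hX).1 hle)]
    · intro R
      set R' := |R| + 1 with hR'
      have hR1 : 1 ≤ R' := by have := abs_nonneg R; linarith
      set b := 1 / (2 * R₁) with hb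
      have hb0 : 0 < b := by positivity
      set κ := 4 * R₁ with hκ
      have hκ0 : 0 < κ := by positivity
      set M := C * (13 * R' ^ 2 * κ ^ 2 + 3 * κ * (2 + 2 * R' / b)) + C * κ ^ 2 * (4 * R' + 3) with hM
      have hM0 : 0 ≤ M := by positivity
      refine ⟨M, hM0, ?_⟩
      intro X hX hbX hXR I
      have hXR' : ‖X‖ ≤ R' := hXR.trans (by have := le_abs_self R; linarith)
      obtain ⟨g1, g2, g3⟩ := (kgeo hR₁ hX).2 hbX
      have hY := hpos X hX
      have hd : ∀ J, DifferentiableAt ℝ (g J) (Psi R₁ X) := fun J =>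
        (hs J _ hY).differentiableAt (by simp)
      obtain ⟨b1, b2, b3, b4⟩ := hbd _ hY g1 g2 I
      have hbox := kel_box R₁ hX (hs I _ hY)
      obtain ⟨k1, k2, k3, k4⟩ := kel_inv R₁ hX (hd I)
      have hkp := kel_pd R₁ hX (hd I)
      have hsz := fun J => kel_sz hX hR1 hXR' hb0 hbX (hd J)
      have hkk : kel R₁ (g I) X = (fq 1 0 X)⁻¹ * g I (Psi R₁ X) := rfl
      have hcX := fun α => (abs_co_le α X).trans hXR'
      set q := fq 1 0 X with hq
      set Y := Psi R₁ X with hYd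
      set τ := (1 + Y.1)⁻¹ with hτ
      have hτ0 : 0 ≤ τ := by positivity
      have hτ2 : τ ^ 2 ≤ κ ^ 2 * q ^ 2 := by
        calc τ ^ 2 ≤ (κ * q) ^ 2 := by gcongr
          _ = _ := by ring
      have hi : 0 < q⁻¹ := inv_pos.2 hX
      have hiq : q⁻¹ * q = 1 := inv_mul_cancel₀ hX.ne'
      set D := C * κ ^ 2 with hD
      have hD0 : 0 ≤ D := by positivity
      have up : ∀ a, a ≤ C * τ ^ 2 → a ≤ D * q ^ 2 := fun a ha => ha.trans (by
        calc C * τ ^ 2 ≤ C * (κ ^ 2 * q ^ 2) := by gcongr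
          _ = _ := by rw [hD]; ring)
      have B1 := up _ b1
      have B2 := up _ b2
      have B3 := fun α => up _ (b3 α)
      have sc : ∀ a, |a| ≤ D * q ^ 2 → |q⁻¹ * a| ≤ D * q := fun a ha => by
        rw [abs_mul, abs_of_pos hi]
        calc q⁻¹ * |a| ≤ q⁻¹ * (D * q ^ 2) := by gcongr
          _ = D * q := by field_simp
      have sc2 : ∀ a, |a| ≤ D * q ^ 2 → |q⁻¹ ^ 2 * a| ≤ D := fun a ha => by
        rw [abs_mul, abs_of_pos (by positivity)]
        calc q⁻¹ ^ 2 * |a| ≤ q⁻¹ ^ 2 * (D * q ^ 2) := by gcongr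
          _ = D := by field_simp
      have hMD : D * (4 * R' + 3) ≤ M := by
        have : 0 ≤ C * (13 * R' ^ 2 * κ ^ 2 + 3 * κ * (2 + 2 * R' / b)) := by positivity
        rw [hM, hD]; linarith
      have K1 : |kel R₁ (g I) X| ≤ D * q := by rw [hkk]; exact sc _ B1
      refine ⟨?_, ?_, ?_, ?_⟩
      · -- box
        rw [hbox, abs_mul, abs_of_pos (by positivity : 0 < q⁻¹ ^ 3)]
        set s := sz (fun I => kel R₁ (g I)) X with hsd
        have hs0 : 0 ≤ s := sz_nonneg _ _
        have z1 : sz g Y ≤ 13 * R' ^ 2 * q * s := by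
          rw [hsd]; unfold sz; rw [Finset.mul_sum]
          exact Finset.sum_le_sum fun J _ => (hsz J).1
        have z2 : ∑ J, ∑ i, |Tg i (g J) Y| ≤ 3 * (q ^ 2 * (2 + 2 * R' / b)) * s := by
          rw [hsd]; unfold sz; rw [Finset.mul_sum]
          exact Finset.sum_le_sum fun J _ => (hsz J).2
        have hq0 : 0 ≤ q := hX.le
        calc q⁻¹ ^ 3 * |box (g I) Y| ≤ q⁻¹ ^ 3 * (C * ((κ ^ 2 * q ^ 2) * (13 * R' ^ 2 * q * s)
              + (κ * q) * (3 * (q ^ 2 * (2 + 2 * R' / b)) * s))) := by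
              gcongr
              refine b4.trans ?_
              gcongr
              exact sz_nonneg _ _
          _ = C * (13 * R' ^ 2 * κ ^ 2 + 3 * κ * (2 + 2 * R' / b)) * s := by
              generalize 2 + 2 * R' / b = e
              field_simp
          _ ≤ M * s := by
              gcongr
              rw [hM]
              have : 0 ≤ C * κ ^ 2 * (4 * R' + 3) := by positivity
              linarith
      · refine K1.trans ?_
        gcongr
        have e : D * (4 * R' + 3) = 4 * (R' * D) + 3 * D := by ring
        have : 0 ≤ R' * D := by positivity
        linarith
      · rw [k3]
        refine (abs_sub _ _).trans ?_
        rw [abs_mul]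
        have := sc _ B2
        have h2 : |(-2 : ℝ)| = 2 := by norm_num
        rw [h2]
        have : M * q ≥ D * (4 * R' + 3) * q := by gcongr
        have : 0 ≤ D * R' * q := by positivity
        have e : D * (4 * R' + 3) * q = 4 * (D * R' * q) + 3 * (D * q) := by ring
        linarith
      · intro α
        rw [hkp α]
        have e3 : q⁻¹ ^ 3 * ∑ β, co β X * pd β (g I) Y = q⁻¹ ^ 2 * Sp R₁ (g I) Y := by
          rw [← k2]; ring
        have e : -2 * (eta α * co α X) * q⁻¹ ^ 2 * g I Y + q⁻¹ ^ 2 * pd α (g I) Y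
            - 2 * (eta α * co α X) * q⁻¹ ^ 3 * ∑ β, co β X * pd β (g I) Y
            = -2 * (eta α * co α X) * (q⁻¹ ^ 2 * g I Y) + q⁻¹ ^ 2 * pd α (g I) Y
              + -2 * (eta α * co α X) * (q⁻¹ ^ 2 * Sp R₁ (g I) Y) := by
          linear_combination (-2 * (eta α * co α X)) * e3
        rw [e]
        have hc2 : |-2 * (eta α * co α X)| ≤ 2 * R' := by
          rw [abs_mul, abs_mul, abs_eta]
          have h2 : |(-2 : ℝ)| = 2 := by norm_num
          rw [h2]; linarith [hcX α]
        refine (abs_add_three _ _ _).trans ?_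
        rw [abs_mul (-2 * _) , abs_mul (-2 * _)]
        have t1 : |-2 * (eta α * co α X)| * |q⁻¹ ^ 2 * g I Y| ≤ 2 * R' * D := by
          gcongr; exact sc2 _ B1
        have t3 : |-2 * (eta α * co α X)| * |q⁻¹ ^ 2 * Sp R₁ (g I) Y| ≤ 2 * R' * D := by
          gcongr; exact sc2 _ B2
        have t2 := sc2 _ (B3 α)
        have e : D * (4 * R' + 3) = 4 * R' * D + 3 * D := by ring
        linarith
  intro I Y hY
  set X : Spc := (fq 1 R₁ Y)⁻¹ • (Y - Vp R₁) with hXd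
  have hX : fq 1 0 X = (fq 1 R₁ Y)⁻¹ := by
    have e : fq 1 0 X = (fq 1 R₁ Y)⁻¹ ^ 2 * fq 1 R₁ Y := by
      obtain ⟨h0, h1, h2, h3⟩ := co_Vp R₁
      have := fq_expand 1 R₁ Y
      rw [fq_expand 1 0]; simp only [hXd, co_smul, co_sub, h0, h1, h2, h3]
      generalize (fq 1 R₁ Y)⁻¹ = i
      rw [this]; ring
    rw [e]; field_simp
  have hX0 : 0 < fq 1 0 X := by rw [hX]; exact inv_pos.2 hY
  have hPsi : Psi R₁ X = Y := by
    rw [Psi, hX, inv_inv, hXd, smul_smul, mul_inv_cancel₀ hY.ne', one_smul]; abel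
  have := key I X hX0
  rw [kel, hPsi] at this
  rcases mul_eq_zero.1 this with h | h
  · exact absurd h (inv_pos.2 hX0).ne'
  · exact h

end

section
lemma lip_ball {E F : Type*} [NormedAddCommGroup E] [NormedSpace ℝ E] [ProperSpace E]
    [NormedAddCommGroup F] [NormedSpace ℝ F] {f : E → F} (hf : ContDiff ℝ 1 f) (M : ℝ) :
    ∃ C : ℝ, 0 ≤ C ∧ ∀ x y, ‖x‖ ≤ M → ‖y‖ ≤ M → ‖f y - f x‖ ≤ C * ‖y - x‖ := by
  obtain ⟨C, hC⟩ := (isCompact_closedBall (0 : E) M).exists_bound_of_continuousOn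
    (hf.continuous_fderiv (by simp)).continuousOn
  refine ⟨|C|, abs_nonneg _, fun x y hx hy => ?_⟩
  refine (convex_closedBall (0 : E) M).norm_image_sub_le_of_norm_fderiv_le (𝕜 := ℝ)
    (fun z _ => (hf.differentiable (by simp)) z) (fun z hz => (hC z hz).trans (le_abs_self _)) ?_ ?_
  · simpa using hx
  · simpa using hy

/-- a smooth function which is cubically small has quadratically small Lipschitz constant -/
lemma cubic_lip {E : Type*} [NormedAddCommGroup E] [NormedSpace ℝ E] [ProperSpace E]
    {R : E → ℝ} (hR : ContDiff ℝ (⊤ : ℕ∞) R) {C₀ ε : ℝ} (hε : 0 < ε)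
    (hc : ∀ z, ‖z‖ ≤ ε → |R z| ≤ C₀ * ‖z‖ ^ 3) :
    ∃ C : ℝ, 0 ≤ C ∧ ∀ ρ ≤ ε, ∀ x y, ‖x‖ ≤ ρ → ‖y‖ ≤ ρ →
      |R y - R x| ≤ C * ρ ^ 2 * ‖y - x‖ := by
  have hG : ContDiff ℝ (⊤ : ℕ∞) (fderiv ℝ R) := hR.fderiv_right (by simp)
  have hB : ContDiff ℝ (⊤ : ℕ∞) (fderiv ℝ (fderiv ℝ R)) := hG.fderiv_right (by simp)
  have hRd : Differentiable ℝ R := hR.differentiable (by simp)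
  have hGd : Differentiable ℝ (fderiv ℝ R) := hG.differentiable (by simp)
  have hR0 : R 0 = 0 := by have := hc 0 (by simpa using hε.le); simpa using this
  have hG0 : fderiv ℝ R 0 = 0 := by
    have : HasFDerivAt R (0 : E →L[ℝ] ℝ) 0 := by
      rw [hasFDerivAt_iff_isLittleO_nhds_zero]
      have hO : (fun h : E => R (0 + h) - R 0 - (0 : E →L[ℝ] ℝ) h) =O[𝓝 0] fun h => ‖h‖ ^ 3 := by
        refine Asymptotics.IsBigO.of_bound C₀ ?_
        filter_upwards [Metric.closedBall_mem_nhds (0 : E) hε] with h hh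
        have := hc h (by simpa using hh)
        simpa [hR0] using this
      refine hO.trans_isLittleO ?_
      exact Asymptotics.isLittleO_norm_pow_id (by norm_num)
    exact this.fderiv
  -- second order expansion of the derivative at the origin
  obtain ⟨M, hM0, hM⟩ := lip_ball (hB.of_le (by simp)) ε
  set B := fderiv ℝ (fderiv ℝ R) 0 with hBd
  have hGB : ∀ z, ‖z‖ ≤ ε → ‖fderiv ℝ R z - B z‖ ≤ M * ‖z‖ ^ 2 := by
    intro z hz
    have := (convex_closedBall (0 : E) ‖z‖).norm_image_sub_le_of_norm_fderiv_le' (𝕜 := ℝ)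
      (f := fderiv ℝ R) (φ := B) (C := M * ‖z‖) (x := 0) (y := z) (fun y _ => hGd y) (fun y hy => by
        have hy' : ‖y‖ ≤ ‖z‖ := by simpa using hy
        have := hM 0 y (by simpa using hε.le) (hy'.trans hz)
        refine this.trans ?_
        simp only [sub_zero]; gcongr) (by simp) (by simp)
    rw [hG0] at this
    simpa [pow_two, mul_assoc] using this
  have hBzz : ∀ z, B z z = 0 := by
    intro z
    by_contra hne
    set b := B z z with hb
    -- phi s = R (s z) - s^2 / 2 b
    have hder : ∀ s : ℝ, HasDerivAt (fun s : ℝ => R (s • z) - s ^ 2 / 2 * b)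
        (fderiv ℝ R (s • z) z - s * b) s := by
      intro s
      have h1 : HasDerivAt (fun s : ℝ => R (s • z)) (fderiv ℝ R (s • z) z) s := by
        have h2 : HasDerivAt (fun s : ℝ => s • z) ((1 : ℝ) • z) s := (hasDerivAt_id s).smul_const z
        rw [one_smul] at h2
        exact (hRd (s • z)).hasFDerivAt.comp_hasDerivAt s h2
      have h3 : HasDerivAt (fun s : ℝ => s ^ 2 / 2 * b) (s * b) s := by
        have := (((hasDerivAt_id s).pow 2).div_const 2).mul_const b
        refine this.congr_deriv ?_
        simp
      exact h1.sub h3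
    have key : ∀ s : ℝ, 0 < s → s * ‖z‖ ≤ ε → |b| ≤ 2 * (C₀ * ‖z‖ ^ 3 + M * ‖z‖ ^ 3) * s := by
      intro s hs hsz
      have hmv := (convex_Icc (0 : ℝ) s).norm_image_sub_le_of_norm_hasDerivWithin_le
        (f := fun s : ℝ => R (s • z) - s ^ 2 / 2 * b) (C := M * (s * ‖z‖) ^ 2 * ‖z‖)
        (f' := fun s => fderiv ℝ R (s • z) z - s * b)
        (x := 0) (y := s) (fun σ _ => (hder σ).hasDerivWithinAt) (fun σ hσ => by
          have hn : ‖σ • z‖ ≤ s * ‖z‖ := by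
            rw [norm_smul, Real.norm_eq_abs, abs_of_nonneg hσ.1]; gcongr; exact hσ.2
          have e : fderiv ℝ R (σ • z) z - σ * b = (fderiv ℝ R (σ • z) - B (σ • z)) z := by
            simp [hb]
          rw [e]
          refine ((fderiv ℝ R (σ • z) - B (σ • z)).le_opNorm z).trans ?_
          gcongr
          refine (hGB _ (hn.trans hsz)).trans ?_
          gcongr) (by simp [hs.le]) (by simp [hs.le])
      simp only [zero_smul, hR0] at hmv
      have h4 := hc (s • z) (by rwa [norm_smul, Real.norm_eq_abs, abs_of_pos hs])
      rw [norm_smul, Real.norm_eq_abs, abs_of_pos hs] at h4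
      simp only [Real.norm_eq_abs, sub_zero, abs_of_pos hs] at hmv
      have h5 : |s ^ 2 / 2 * b| ≤ C₀ * (s * ‖z‖) ^ 3 + M * (s * ‖z‖) ^ 2 * ‖z‖ * s := by
        have : s ^ 2 / 2 * b = R (s • z) - (R (s • z) - s ^ 2 / 2 * b) := by ring
        rw [this]
        refine (abs_sub _ _).trans (add_le_add h4 ?_)
        simpa using hmv
      rw [abs_mul, abs_of_pos (by positivity : 0 < s ^ 2 / 2)] at h5
      have h6 : s ^ 2 / 2 * |b| ≤ s ^ 2 / 2 * (2 * (C₀ * ‖z‖ ^ 3 + M * ‖z‖ ^ 3) * s) := by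
        refine h5.trans (le_of_eq ?_); ring
      exact le_of_mul_le_mul_left h6 (by positivity)
    have hlim : Tendsto (fun s : ℝ => 2 * (C₀ * ‖z‖ ^ 3 + M * ‖z‖ ^ 3) * s) (𝓝[>] 0) (𝓝 0) := by
      have : Continuous (fun s : ℝ => 2 * (C₀ * ‖z‖ ^ 3 + M * ‖z‖ ^ 3) * s) := by fun_prop
      have := (this.tendsto 0).mono_left (nhdsWithin_le_nhds (s := Ioi 0))
      simpa using this
    have hev : ∀ᶠ s : ℝ in 𝓝[>] 0, |b| ≤ 2 * (C₀ * ‖z‖ ^ 3 + M * ‖z‖ ^ 3) * s := by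
      have hcont : ∀ᶠ s : ℝ in 𝓝 0, s * ‖z‖ < ε := by
        have : Continuous (fun s : ℝ => s * ‖z‖) := by fun_prop
        exact this.continuousAt.eventually_lt continuousAt_const (by simpa using hε)
      filter_upwards [self_mem_nhdsWithin, nhdsWithin_le_nhds hcont] with s hs h2
      exact key s hs h2.le
    have := ge_of_tendsto hlim hev
    exact hne (abs_nonpos_iff.1 this)
  have hsym : ∀ x y, B x y = B y x := by
    have := (hR.contDiffAt (x := (0 : E))).isSymmSndFDerivAt (by
      simp only [minSmoothness_of_isRCLikeNormedField]
      exact WithTop.coe_le_coe.2 (le_top : (2 : ℕ∞) ≤ ⊤))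
    exact fun x y => this x y
  have hB0 : B = 0 := by
    ext x y
    have h := hBzz (x + y)
    simp only [map_add, _root_.add_apply, hBzz, hsym y x] at h
    simp; linarith
  refine ⟨M, hM0, fun ρ hρ x y hx hy => ?_⟩
  have := (convex_closedBall (0 : E) ρ).norm_image_sub_le_of_norm_fderiv_le (𝕜 := ℝ)
    (f := R) (C := M * ρ ^ 2) (x := x) (y := y) (fun z _ => hRd z) (fun z hz => by
      have hz' : ‖z‖ ≤ ρ := by simpa using hz
      have := hGB z (hz'.trans hρ)
      rw [hB0] at this
      simp only [_root_.zero_apply, sub_zero] at this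
      exact this.trans (by gcongr)) (by simpa using hx) (by simpa using hy)
  simpa using this

end

section
/-- size of the tangential part -/
def tgf (ω : EuclideanSpace ℝ (Fin 3)) (ξ : Fin 4 → ℝ) : ℝ := ∑ i : Fin 3, |ξ i.succ + ω i * ξ 0|

lemma tgf_nonneg (ω : EuclideanSpace ℝ (Fin 3)) (ξ : Fin 4 → ℝ) : 0 ≤ tgf ω ξ :=
  Finset.sum_nonneg fun _ _ => abs_nonneg _

lemma hatSph_le {ω : EuclideanSpace ℝ (Fin 3)} (hω : ‖ω‖ = 1) (α : Fin 4) : |hatSph ω α| ≤ 1 := by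
  refine Fin.cases ?_ (fun i => ?_) α
  · simp [hatSph]
  · have := PiLp.norm_apply_le ω i
    rw [hω, Real.norm_eq_abs] at this
    simpa [hatSph] using this

lemma tgf_bd (ω : EuclideanSpace ℝ (Fin 3)) (ξ : Fin 4 → ℝ) (α : Fin 4) :
    |ξ α + hatSph ω α * ξ 0| ≤ tgf ω ξ := by
  refine Fin.cases ?_ (fun i => ?_) α
  · simp [hatSph, tgf_nonneg]
  · exact Finset.single_le_sum (f := fun i : Fin 3 => |ξ i.succ + ω i * ξ 0|)
      (fun _ _ => abs_nonneg _) (Finset.mem_univ i)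

lemma null_est {A : Fin 4 → Fin 4 → ℝ} {ω : EuclideanSpace ℝ (Fin 3)} (hω : ‖ω‖ = 1)
    (hA : ∑ α, ∑ β, A α β * hatSph ω α * hatSph ω β = 0) (ξ η : Fin 4 → ℝ) :
    |∑ α, ∑ β, A α β * ξ α * η β| ≤ (∑ α, ∑ β, |A α β|) *
      (|ξ 0| * tgf ω η + |η 0| * tgf ω ξ + tgf ω ξ * tgf ω η) := by
  set o := hatSph ω with ho
  have e : ∑ α, ∑ β, A α β * ξ α * η β = ∑ α, ∑ β, A α β * ((ξ α + o α * ξ 0) * (η β + o β * η 0)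
      - ξ 0 * (o α * (η β + o β * η 0)) - η 0 * ((ξ α + o α * ξ 0) * o β)) := by
    have h2 : ∑ α, ∑ β, A α β * ((ξ α + o α * ξ 0) * (η β + o β * η 0)
      - ξ 0 * (o α * (η β + o β * η 0)) - η 0 * ((ξ α + o α * ξ 0) * o β))
      = (∑ α, ∑ β, A α β * ξ α * η β) - ξ 0 * η 0 * ∑ α, ∑ β, A α β * o α * o β := by
      rw [Finset.mul_sum, ← Finset.sum_sub_distrib]
      refine Finset.sum_congr rfl fun α _ => ?_
      rw [Finset.mul_sum, ← Finset.sum_sub_distrib]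
      refine Finset.sum_congr rfl fun β _ => ?_
      ring
    rw [h2, hA]; ring
  rw [e, Finset.sum_mul]
  refine (Finset.abs_sum_le_sum_abs _ _).trans (Finset.sum_le_sum fun α _ => ?_)
  rw [Finset.sum_mul]
  refine (Finset.abs_sum_le_sum_abs _ _).trans (Finset.sum_le_sum fun β _ => ?_)
  rw [abs_mul]
  refine mul_le_mul_of_nonneg_left ?_ (abs_nonneg _)
  have a1 := tgf_bd ω ξ α
  have a2 := tgf_bd ω η β
  have o1 := hatSph_le hω α
  have o2 := hatSph_le hω β
  rw [← ho] at a1 a2 o1 o2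
  have t0 := tgf_nonneg ω ξ
  have t1 := tgf_nonneg ω η
  generalize ξ α + o α * ξ 0 = x at *
  generalize η β + o β * η 0 = y at *
  refine (abs_sub _ _).trans ?_
  have := abs_sub (x * y) (ξ 0 * (o α * y))
  simp only [abs_mul] at this ⊢
  have b1 : |x| * |y| ≤ tgf ω ξ * tgf ω η := by gcongr
  have b2 : |ξ 0| * (|o α| * |y|) ≤ |ξ 0| * (1 * tgf ω η) := by gcongr
  have b3 : |η 0| * (|x| * |o β|) ≤ |η 0| * (tgf ω ξ * 1) := by gcongr
  linarith

set_option maxHeartbeats 400000 in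
lemma qdiff {N : ℕ} {Q : ((Fin N → ℝ) × (Fin N → Fin 4 → ℝ)) → Fin N → ℝ}
    {A : Fin N → Fin N → Fin N → Fin 4 → Fin 4 → ℝ} (hQ : HasNullForm Q A) {L : ℝ} (hL : 0 ≤ L) :
    ∃ C δ : ℝ, 0 ≤ C ∧ 0 < δ ∧ ∀ τ, 0 ≤ τ → τ ≤ δ → ∀ ω : EuclideanSpace ℝ (Fin 3), ‖ω‖ = 1 →
      ∀ z z' : (Fin N → ℝ) × (Fin N → Fin 4 → ℝ), ‖z‖ ≤ L * τ → ‖z'‖ ≤ L * τ →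
      (∀ J, tgf ω (z.2 J) ≤ L * τ ^ 2) → (∀ J, tgf ω (z'.2 J) ≤ L * τ ^ 2) → ∀ I,
      |Q z I - Q z' I| ≤ C * (τ ^ 2 * ∑ J, (|z.1 J - z'.1 J| + ∑ α, |z.2 J α - z'.2 J α|)
        + τ * ∑ J, tgf ω (fun α => z.2 J α - z'.2 J α)) := by
  obtain ⟨hs, ⟨C₀, ε, hC₀, hε, hcub⟩, hnull⟩ := hQ
  set P : ((Fin N → ℝ) × (Fin N → Fin 4 → ℝ)) → Fin N → ℝ := fun z I =>
    ∑ J, ∑ K, ∑ α, ∑ β, A I J K α β * z.2 J α * z.2 K β with hP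
  have hPs : ∀ I, ContDiff ℝ (⊤ : ℕ∞) fun z => P z I := by
    intro I
    simp only [hP]
    refine ContDiff.sum fun J _ => ContDiff.sum fun K _ => ContDiff.sum fun α _ =>
      ContDiff.sum fun β _ => ?_
    have h : ∀ J α, ContDiff ℝ (⊤ : ℕ∞)
        fun z : (Fin N → ℝ) × (Fin N → Fin 4 → ℝ) => z.2 J α := fun J α =>
      (contDiff_apply_apply ℝ ℝ J α).comp contDiff_snd
    exact (contDiff_const.mul (h J α)).mul (h K β)
  have hR : ∀ I, ∃ C : ℝ, 0 ≤ C ∧ ∀ ρ ≤ ε / 2, ∀ x y, ‖x‖ ≤ ρ → ‖y‖ ≤ ρ →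
      |(Q y I - P y I) - (Q x I - P x I)| ≤ C * ρ ^ 2 * ‖y - x‖ := by
    intro I
    refine cubic_lip (R := fun z => Q z I - P z I) (C₀ := 8 * C₀) ?_ (half_pos hε) ?_
    · exact ((contDiff_pi.1 hs) I).sub (hPs I)
    · intro z hz
      have h1 := norm_fst_le z
      have h2 := norm_snd_le z
      refine (hcub z (by linarith) I).trans ?_
      calc C₀ * (‖z.1‖ + ‖z.2‖) ^ 3 ≤ C₀ * (2 * ‖z‖) ^ 3 := by gcongr; linarith
        _ = _ := by ring
  choose CR hCR0 hCR using hR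
  set a : Fin N → ℝ := fun I => ∑ J, ∑ K, ∑ α, ∑ β, |A I J K α β| with ha
  have ha0 : ∀ I, 0 ≤ a I := fun I => Finset.sum_nonneg fun _ _ => Finset.sum_nonneg fun _ _ =>
    Finset.sum_nonneg fun _ _ => Finset.sum_nonneg fun _ _ => abs_nonneg _
  set δ := min 1 (ε / 2 / (L + 1)) with hδ
  have hδ0 : 0 < δ := by positivity
  refine ⟨∑ I, (CR I * L ^ 2 + 4 * L * a I), δ, ?_, hδ0, ?_⟩
  · exact Finset.sum_nonneg fun I _ => add_nonneg (mul_nonneg (hCR0 I) (sq_nonneg _))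
      (mul_nonneg (by positivity) (ha0 I))
  intro τ hτ0 hτδ ω hω z z' hz hz' ht ht' I
  have hτ1 : τ ≤ 1 := hτδ.trans (min_le_left _ _)
  have hLτ : L * τ ≤ ε / 2 := by
    have : τ * (L + 1) ≤ ε / 2 := by
      rw [← le_div_iff₀ (by positivity)]; exact hτδ.trans (min_le_right _ _)
    nlinarith
  set s := ∑ J, (|z.1 J - z'.1 J| + ∑ α, |z.2 J α - z'.2 J α|) with hsd
  set d := ∑ J, tgf ω (fun α => z.2 J α - z'.2 J α) with hdd
  have hs0 : 0 ≤ s := Finset.sum_nonneg fun _ _ => add_nonneg (abs_nonneg _)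
    (Finset.sum_nonneg fun _ _ => abs_nonneg _)
  have hd0 : 0 ≤ d := Finset.sum_nonneg fun _ _ => tgf_nonneg _ _
  have hsJ : ∀ J, |z.1 J - z'.1 J| + ∑ α, |z.2 J α - z'.2 J α| ≤ s := fun J =>
    Finset.single_le_sum (f := fun J => |z.1 J - z'.1 J| + ∑ α, |z.2 J α - z'.2 J α|)
      (fun _ _ => add_nonneg (abs_nonneg _) (Finset.sum_nonneg fun _ _ => abs_nonneg _))
      (Finset.mem_univ J)
  have hdJ : ∀ J, tgf ω (fun α => z.2 J α - z'.2 J α) ≤ d := fun J =>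
    Finset.single_le_sum (f := fun J => tgf ω (fun α => z.2 J α - z'.2 J α))
      (fun _ _ => tgf_nonneg _ _) (Finset.mem_univ J)
  have hsα : ∀ J α, |z.2 J α - z'.2 J α| ≤ s := fun J α => by
    have := Finset.single_le_sum (f := fun α => |z.2 J α - z'.2 J α|)
      (fun _ _ => abs_nonneg _) (Finset.mem_univ α)
    have h3 := hsJ J
    have := abs_nonneg (z.1 J - z'.1 J)
    linarith
  have hzz : ‖z - z'‖ ≤ s := by
    rw [Prod.norm_def]
    refine max_le ?_ ?_
    · refine (pi_norm_le_iff_of_nonneg hs0).2 fun J => ?_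
      have h3 := hsJ J
      have : 0 ≤ ∑ α, |z.2 J α - z'.2 J α| := Finset.sum_nonneg fun _ _ => abs_nonneg _
      simp only [Prod.fst_sub, Pi.sub_apply, Real.norm_eq_abs]; linarith
    · refine (pi_norm_le_iff_of_nonneg hs0).2 fun J => (pi_norm_le_iff_of_nonneg hs0).2 fun α => ?_
      simpa using hsα J α
  have hcomp : ∀ y : (Fin N → ℝ) × (Fin N → Fin 4 → ℝ), ‖y‖ ≤ L * τ → ∀ J α, |y.2 J α| ≤ L * τ :=
    fun y hy J α => by
      have h1 := norm_snd_le y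
      have h2 := norm_le_pi_norm y.2 J
      have h3 := norm_le_pi_norm (y.2 J) α
      rw [Real.norm_eq_abs] at h3; linarith
  -- remainder
  have r1 := hCR I (L * τ) hLτ z' z hz' hz
  have r2 : CR I * (L * τ) ^ 2 * ‖z - z'‖ ≤ CR I * L ^ 2 * (τ ^ 2 * s) := by
    calc CR I * (L * τ) ^ 2 * ‖z - z'‖ ≤ CR I * (L * τ) ^ 2 * s := by
          have := hCR0 I; gcongr
      _ = _ := by ring
  -- quadratic part
  have q1 : |P z I - P z' I| ≤ a I * (4 * L * (τ ^ 2 * s + τ * d)) := by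
    have e : P z I - P z' I = ∑ J, ∑ K, ((∑ α, ∑ β, A I J K α β * (z.2 J α - z'.2 J α) * z.2 K β)
        + (∑ α, ∑ β, A I J K α β * z'.2 J α * (z.2 K β - z'.2 K β))) := by
      simp only [hP, ← Finset.sum_sub_distrib, ← Finset.sum_add_distrib]
      refine Finset.sum_congr rfl fun J _ => Finset.sum_congr rfl fun K _ =>
        Finset.sum_congr rfl fun α _ => Finset.sum_congr rfl fun β _ => ?_
      ring
    rw [e, ha]
    simp only [Finset.sum_mul]
    refine (Finset.abs_sum_le_sum_abs _ _).trans (Finset.sum_le_sum fun J _ => ?_)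
    refine (Finset.abs_sum_le_sum_abs _ _).trans (Finset.sum_le_sum fun K _ => ?_)
    simp only [← Finset.sum_mul]
    refine (abs_add_le _ _).trans ?_
    have n1 := null_est hω (hnull I J K ω hω) (fun α => z.2 J α - z'.2 J α) (z.2 K)
    have n2 := null_est hω (hnull I J K ω hω) (z'.2 J) (fun α => z.2 K α - z'.2 K α)
    have hA0 : 0 ≤ ∑ α, ∑ β, |A I J K α β| :=
      Finset.sum_nonneg fun _ _ => Finset.sum_nonneg fun _ _ => abs_nonneg _
    have p3 : d * (L * τ ^ 2) ≤ L * τ * d := by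
      have : L * τ * d * τ ≤ L * τ * d * 1 := by gcongr
      linarith
    have m1 : |z.2 J 0 - z'.2 J 0| * tgf ω (z.2 K)
        + |z.2 K 0| * tgf ω (fun α => z.2 J α - z'.2 J α)
        + tgf ω (fun α => z.2 J α - z'.2 J α) * tgf ω (z.2 K) ≤ 2 * L * (τ ^ 2 * s + τ * d) := by
      have p1 : |z.2 J 0 - z'.2 J 0| * tgf ω (z.2 K) ≤ s * (L * τ ^ 2) :=
        mul_le_mul (hsα J 0) (ht K) (tgf_nonneg _ _) hs0
      have p2 : |z.2 K 0| * tgf ω (fun α => z.2 J α - z'.2 J α) ≤ L * τ * d :=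
        mul_le_mul (hcomp z hz K 0) (hdJ J) (tgf_nonneg _ _) (by positivity)
      have p3' : tgf ω (fun α => z.2 J α - z'.2 J α) * tgf ω (z.2 K) ≤ d * (L * τ ^ 2) :=
        mul_le_mul (hdJ J) (ht K) (tgf_nonneg _ _) hd0
      have : 0 ≤ L * τ ^ 2 * s := by positivity
      linarith
    have m2 : |z'.2 J 0| * tgf ω (fun α => z.2 K α - z'.2 K α)
        + |z.2 K 0 - z'.2 K 0| * tgf ω (z'.2 J)
        + tgf ω (z'.2 J) * tgf ω (fun α => z.2 K α - z'.2 K α) ≤ 2 * L * (τ ^ 2 * s + τ * d) := by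
      have p1 : |z.2 K 0 - z'.2 K 0| * tgf ω (z'.2 J) ≤ s * (L * τ ^ 2) :=
        mul_le_mul (hsα K 0) (ht' J) (tgf_nonneg _ _) hs0
      have p2 : |z'.2 J 0| * tgf ω (fun α => z.2 K α - z'.2 K α) ≤ L * τ * d :=
        mul_le_mul (hcomp z' hz' J 0) (hdJ K) (tgf_nonneg _ _) (by positivity)
      have p3' : tgf ω (z'.2 J) * tgf ω (fun α => z.2 K α - z'.2 K α) ≤ (L * τ ^ 2) * d :=
        mul_le_mul (ht' J) (hdJ K) (tgf_nonneg _ _) (by positivity)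
      have : 0 ≤ L * τ ^ 2 * s := by positivity
      linarith
    have M1 := n1.trans (mul_le_mul_of_nonneg_left m1 hA0)
    have M2 := n2.trans (mul_le_mul_of_nonneg_left m2 hA0)
    linarith
  have hfin : |Q z I - Q z' I| ≤ (CR I * L ^ 2 + 4 * L * a I) * (τ ^ 2 * s + τ * d) := by
    have e : Q z I - Q z' I = ((Q z I - P z I) - (Q z' I - P z' I)) + (P z I - P z' I) := by ring
    rw [e]
    refine (abs_add_le _ _).trans ?_
    have : 0 ≤ CR I * L ^ 2 * (τ * d) := by have := hCR0 I; positivity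
    linarith [r1.trans r2, q1]
  refine hfin.trans (mul_le_mul_of_nonneg_right ?_ (by positivity))
  exact Finset.single_le_sum (f := fun I => CR I * L ^ 2 + 4 * L * a I)
    (fun I _ => add_nonneg (mul_nonneg (hCR0 I) (sq_nonneg _)) (mul_nonneg (by positivity) (ha0 I)))
    (Finset.mem_univ I)

end

section
/-- derivative of `r` -/
def om (p : Spc) (α : Fin 4) : ℝ := Fin.cases 0 (fun i => p.2 i / ‖p.2‖) α

lemma om_zero (p : Spc) : om p 0 = 0 := rfl
lemma om_succ (p : Spc) (i : Fin 3) : om p i.succ = p.2 i / ‖p.2‖ := rfl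
lemma om_le (p : Spc) (α : Fin 4) : |om p α| ≤ 1 := by
  refine Fin.cases ?_ (fun i => ?_) α
  · simp [om]
  · exact abs_om_le p i

lemma hasPD_rr {p : Spc} (h : 0 < ‖p.2‖) : HasPD rr (om p) p := by
  have hq := (((hasPD_co 1 p).sq).add ((hasPD_co 2 p).sq)).add ((hasPD_co 3 p).sq)
  have hn := norm_sq_snd p
  have hne : co 1 p ^ 2 + co 2 p ^ 2 + co 3 p ^ 2 ≠ 0 := by rw [← hn]; positivity
  have h2 := hq.comp (Real.hasDerivAt_sqrt hne)
  have hs : √(co 1 p ^ 2 + co 2 p ^ 2 + co 3 p ^ 2) = ‖p.2‖ := by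
    rw [← hn, Real.sqrt_sq h.le]
  refine (h2.congr_f (Eventually.of_forall fun y => ?_)).congr_d fun α => ?_
  · change ‖y.2‖ = √(co 1 y ^ 2 + co 2 y ^ 2 + co 3 y ^ 2)
    rw [← norm_sq_snd y, Real.sqrt_sq (norm_nonneg _)]
  · rw [hs]
    fin_cases α
    · simp [om]
    · simp only [co_one]; change _ = p.2 0 / ‖p.2‖; simp; field_simp
    · simp only [co_two]; change _ = p.2 1 / ‖p.2‖; simp; field_simp
    · simp only [co_three]; change _ = p.2 2 / ‖p.2‖; simp; field_simp

/-- map to the radiation field coordinates -/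
def Phi (p : Spc) : Spc := (rr p - p.1, (rr p)⁻¹ • p.2)

/-- profile -/
def prof (f : Spc → ℝ) (p : Spc) : ℝ := (rr p)⁻¹ * f (Phi p)

/-- derivative matrix of `Phi` -/
def DPhi (p : Spc) (β α : Fin 4) : ℝ :=
  Fin.cases (om p α - if (0 : Fin 4) = α then 1 else 0)
    (fun j => -((‖p.2‖ ^ 2)⁻¹) * om p α * p.2 j + ‖p.2‖⁻¹ * if j.succ = α then 1 else 0) β

lemma hasPD_Phi {p : Spc} (h : 0 < ‖p.2‖) (β : Fin 4) :
    HasPD (fun y => co β (Phi y)) (DPhi p β) p := by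
  refine Fin.cases ?_ (fun j => ?_) β
  · exact (hasPD_rr h).sub (hasPD_co 0 p)
  · exact (((hasPD_rr h).inv h.ne').mul (hasPD_co j.succ p)).congr_d fun α => rfl

lemma hasPD_prof {f : Spc → ℝ} (hf : ContDiff ℝ 1 f) {p : Spc} (h : 0 < ‖p.2‖) :
    HasPD (prof f) (fun α => -((‖p.2‖ ^ 2)⁻¹) * om p α * f (Phi p)
      + ‖p.2‖⁻¹ * ∑ β, DPhi p β α * pd β f (Phi p)) p :=
  ((hasPD_rr h).inv h.ne').mul
    (HasPD.chain (fun β => hasPD_Phi h β) (hf.differentiable (by simp) _))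

lemma DPhi_le {p : Spc} (h : 1 ≤ ‖p.2‖) (β α : Fin 4) : |DPhi p β α| ≤ 2 := by
  have o1 := om_le p α
  have hi : ‖p.2‖⁻¹ ≤ 1 := inv_le_one_of_one_le₀ h
  refine Fin.cases ?_ (fun j => ?_) β
  · change |om p α - if (0 : Fin 4) = α then 1 else 0| ≤ 2
    refine (abs_sub _ _).trans ?_
    have : |(if (0 : Fin 4) = α then (1 : ℝ) else 0)| ≤ 1 := by split_ifs <;> simp
    linarith
  · change |-((‖p.2‖ ^ 2)⁻¹) * om p α * p.2 j + ‖p.2‖⁻¹ * (if j.succ = α then 1 else 0)| ≤ 2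
    have e : -((‖p.2‖ ^ 2)⁻¹) * om p α * p.2 j = -(‖p.2‖⁻¹ * (om p α * (p.2 j / ‖p.2‖))) := by
      field_simp
    rw [e]
    refine (abs_add_le _ _).trans ?_
    rw [abs_neg, abs_mul, abs_mul, abs_mul, abs_of_nonneg (by positivity : 0 ≤ ‖p.2‖⁻¹)]
    have o2 := abs_om_le p j
    have : |(if j.succ = α then (1 : ℝ) else 0)| ≤ 1 := by split_ifs <;> simp
    have h1 : ‖p.2‖⁻¹ * (|om p α| * |p.2 j / ‖p.2‖|) ≤ 1 * (1 * 1) := by gcongr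
    have h2 : ‖p.2‖⁻¹ * |(if j.succ = α then (1 : ℝ) else 0)| ≤ 1 * 1 := by gcongr
    linarith

lemma DPhi_T {p : Spc} (h : 1 ≤ ‖p.2‖) (i : Fin 3) (β : Fin 4) :
    |DPhi p β i.succ + p.2 i / ‖p.2‖ * DPhi p β 0| ≤ 2 * ‖p.2‖⁻¹ := by
  refine Fin.cases ?_ (fun j => ?_) β
  · have : DPhi p 0 i.succ + p.2 i / ‖p.2‖ * DPhi p 0 0 = 0 := by
      have h1 : DPhi p 0 i.succ = om p i.succ - if (0 : Fin 4) = i.succ then 1 else 0 := rfl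
      have h2 : DPhi p 0 0 = om p 0 - 1 := rfl
      rw [h1, h2, if_neg (Fin.succ_ne_zero i).symm, om_zero, om_succ]; ring
    rw [this]; simp
  · have h1 : DPhi p j.succ i.succ = -((‖p.2‖ ^ 2)⁻¹) * om p i.succ * p.2 j
        + ‖p.2‖⁻¹ * if j.succ = i.succ then 1 else 0 := rfl
    have h2 : DPhi p j.succ 0 = -((‖p.2‖ ^ 2)⁻¹) * om p 0 * p.2 j
        + ‖p.2‖⁻¹ * if j.succ = (0 : Fin 4) then 1 else 0 := rfl
    have o1 := om_le p i.succ
    have o2 := abs_om_le p j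
    have e : DPhi p j.succ i.succ + p.2 i / ‖p.2‖ * DPhi p j.succ 0
        = -(‖p.2‖⁻¹ * (om p i.succ * (p.2 j / ‖p.2‖)))
          + ‖p.2‖⁻¹ * if j.succ = i.succ then 1 else 0 := by
      rw [h1, h2, if_neg (Fin.succ_ne_zero j), om_zero]; field_simp; ring
    rw [e]
    refine (abs_add_le _ _).trans ?_
    rw [abs_neg, abs_mul, abs_mul, abs_mul, abs_of_nonneg (by positivity : 0 ≤ ‖p.2‖⁻¹)]
    have : |(if j.succ = i.succ then (1 : ℝ) else 0)| ≤ 1 := by split_ifs <;> simp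
    have h1 : ‖p.2‖⁻¹ * (|om p i.succ| * |p.2 j / ‖p.2‖|) ≤ ‖p.2‖⁻¹ * (1 * 1) := by gcongr
    have h2 : ‖p.2‖⁻¹ * |(if j.succ = i.succ then (1 : ℝ) else 0)| ≤ ‖p.2‖⁻¹ * 1 := by gcongr
    linarith

lemma prof_bounds {f : Spc → ℝ} (hf : ContDiff ℝ 1 f) (R₁ : ℝ) :
    ∃ K : ℝ, 0 ≤ K ∧ ∀ p : Spc, 1 ≤ ‖p.2‖ → |rr p - p.1| ≤ R₁ →
      |prof f p| ≤ K * ‖p.2‖⁻¹ ∧ (∀ α, |pd α (prof f) p| ≤ K * ‖p.2‖⁻¹) ∧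
      ∀ i, |Tg i (prof f) p| ≤ K * ‖p.2‖⁻¹ ^ 2 := by
  have hcpt : IsCompact (Metric.closedBall (0 : Spc) (|R₁| + 1)) := isCompact_closedBall _ _
  have hpdc : ∀ β, Continuous (pd β f) := fun β =>
    (hf.continuous_fderiv (by simp)).clm_apply continuous_const
  obtain ⟨M0, hM0⟩ := hcpt.exists_bound_of_continuousOn hf.continuous.continuousOn
  obtain ⟨M1, hM1⟩ := hcpt.exists_bound_of_continuousOn
    (f := fun p => ∑ β, |pd β f p|) (by
      exact (continuous_finsetSum _ fun β _ => (hpdc β).abs).continuousOn)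
  set M := |M0| + |M1| with hM
  have hMn : 0 ≤ M := by positivity
  refine ⟨9 * M, by positivity, fun p hp hq => ?_⟩
  have hp0 : 0 < ‖p.2‖ := by linarith
  have hmem : Phi p ∈ Metric.closedBall (0 : Spc) (|R₁| + 1) := by
    rw [mem_closedBall_zero_iff, Prod.norm_def]
    refine max_le ?_ ?_
    · change |rr p - p.1| ≤ _
      linarith [le_abs_self R₁]
    · change ‖‖p.2‖⁻¹ • p.2‖ ≤ _
      rw [norm_smul, norm_inv, norm_norm, inv_mul_cancel₀ hp0.ne']
      linarith [abs_nonneg R₁]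
  have b0 : |f (Phi p)| ≤ M := by
    have := hM0 _ hmem
    rw [Real.norm_eq_abs] at this
    linarith [le_abs_self M0, abs_nonneg M1]
  have b1 : ∀ β, |pd β f (Phi p)| ≤ M := fun β => by
    have h1 := hM1 _ hmem
    rw [Real.norm_eq_abs] at h1
    have h2 := le_abs_self (∑ β, |pd β f (Phi p)|)
    have h3 := Finset.single_le_sum (f := fun β => |pd β f (Phi p)|)
      (fun _ _ => abs_nonneg _) (Finset.mem_univ β)
    linarith [le_abs_self M1, abs_nonneg M0]
  have hP := hasPD_prof hf hp0
  set ρ := ‖p.2‖⁻¹ with hρ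
  have hρ0 : 0 ≤ ρ := by positivity
  have hρ1 : ρ ≤ 1 := inv_le_one_of_one_le₀ hp
  have hρ2 : (‖p.2‖ ^ 2)⁻¹ = ρ ^ 2 := by rw [hρ, inv_pow]
  have sumb : ∀ (c : Fin 4 → ℝ) (B : ℝ), 0 ≤ B → (∀ β, |c β| ≤ B) →
      |∑ β, c β * pd β f (Phi p)| ≤ 4 * (B * M) := by
    intro c B hB hc
    refine (Finset.abs_sum_le_sum_abs _ _).trans ?_
    calc ∑ β, |c β * pd β f (Phi p)| ≤ ∑ β : Fin 4, B * M := Finset.sum_le_sum fun β _ => by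
          rw [abs_mul]; exact mul_le_mul (hc β) (b1 β) (abs_nonneg _) hB
      _ = 4 * (B * M) := by simp
  refine ⟨?_, fun α => ?_, fun i => ?_⟩
  · change |ρ * f (Phi p)| ≤ _
    rw [abs_mul, abs_of_nonneg hρ0]
    nlinarith
  · rw [hP.2 α, hρ2]
    refine (abs_add_le _ _).trans ?_
    rw [abs_mul, abs_mul, abs_mul, abs_neg, abs_of_nonneg hρ0, abs_of_nonneg (by positivity : 0 ≤ ρ ^ 2)]
    have s := sumb (fun β => DPhi p β α) 2 (by norm_num) (fun β => DPhi_le hp β α)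
    have t1 : ρ ^ 2 * |om p α| * |f (Phi p)| ≤ (ρ * 1) * 1 * M := by
      have h : ρ ^ 2 ≤ ρ * 1 := by rw [pow_two]; gcongr
      have := om_le p α
      gcongr
    have t2 : ρ * |∑ β, DPhi p β α * pd β f (Phi p)| ≤ ρ * (4 * (2 * M)) := by gcongr
    linarith
  · have e : Tg i (prof f) p = -(ρ ^ 2 * (p.2 i / ‖p.2‖) * f (Phi p))
        + ρ * ∑ β, (DPhi p β i.succ + p.2 i / ‖p.2‖ * DPhi p β 0) * pd β f (Phi p) := by
      have e3 : ∑ β, (DPhi p β i.succ + p.2 i / ‖p.2‖ * DPhi p β 0) * pd β f (Phi p)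
          = ∑ β, DPhi p β i.succ * pd β f (Phi p)
            + p.2 i / ‖p.2‖ * ∑ β, DPhi p β 0 * pd β f (Phi p) := by
        rw [Finset.mul_sum, ← Finset.sum_add_distrib]
        exact Finset.sum_congr rfl fun β _ => by ring
      rw [Tg, hP.2, hP.2, e3]; beta_reduce; rw [om_zero, om_succ, hρ2]; ring
    rw [e]
    refine (abs_add_le _ _).trans ?_
    rw [abs_neg, abs_mul, abs_mul, abs_mul, abs_of_nonneg hρ0, abs_of_nonneg (by positivity : 0 ≤ ρ ^ 2)]
    have s := sumb (fun β => DPhi p β i.succ + p.2 i / ‖p.2‖ * DPhi p β 0) (2 * ρ) (by positivity)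
      (fun β => DPhi_T hp i β)
    have o1 := abs_om_le p i
    have t1 : ρ ^ 2 * |p.2 i / ‖p.2‖| * |f (Phi p)| ≤ ρ ^ 2 * 1 * M := by gcongr
    have t2 : ρ * |∑ β, (DPhi p β i.succ + p.2 i / ‖p.2‖ * DPhi p β 0) * pd β f (Phi p)|
      ≤ ρ * (4 * (2 * ρ * M)) := by gcongr
    calc _ ≤ ρ ^ 2 * 1 * M + ρ * (4 * (2 * ρ * M)) := add_le_add t1 t2
      _ = _ := by ring

end

section
lemma Z1_facts (g : Spc → ℝ) (p : Spc) : |g p| ≤ Z1sum g p ∧ (∀ α, |pd α g p| ≤ Z1sum g p) ∧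
    |Sc g p| ≤ Z1sum g p ∧ 0 ≤ Z1sum g p := by
  have h0 := abs_nonneg (g p)
  have h : ∀ Z ∈ ZList, |Z g p| ≤ (ZList.map fun Z => |Z g p|).sum := fun Z hZ =>
    List.single_le_sum (by simp) _ (List.mem_map_of_mem (f := fun Z => |Z g p|) hZ)
  have hn : 0 ≤ (ZList.map fun Z => |Z g p|).sum := List.sum_nonneg (by simp)
  unfold Z1sum
  refine ⟨by linarith, fun α => ?_, ?_, by linarith⟩
  · have : pd α ∈ ZList := by fin_cases α <;> simp [ZList]
    linarith [h _ this]
  · linarith [h Sc (by simp [ZList])]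

lemma rad_bounds {N : ℕ} {u : Fin N → Spc → ℝ} {F : ℝ → EuclideanSpace ℝ (Fin 3) → Fin N → ℝ}
    (hu : ∀ I, ContDiff ℝ (⊤ : ℕ∞) (u I)) (hF : IsRadiationField u F) (R₁ : ℝ) :
    ∃ K T : ℝ, 0 ≤ K ∧ 2 * |R₁| + 2 ≤ T ∧ ∀ p : Spc, T ≤ p.1 → |rr p - p.1| ≤ R₁ → ∀ I,
      DifferentiableAt ℝ (radProfile u F I) p ∧
      |radProfile u F I p| ≤ K * p.1⁻¹ ^ 2 ∧ (∀ α, |pd α (radProfile u F I) p| ≤ K * p.1⁻¹ ^ 2) ∧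
      |Sc (radProfile u F I) p| ≤ K * p.1⁻¹ ^ 2 ∧
      |u I p| ≤ K * p.1⁻¹ ∧ (∀ α, |pd α (u I) p| ≤ K * p.1⁻¹) ∧
      ∀ i, |Tg i (u I) p| ≤ K * p.1⁻¹ ^ 2 := by
  obtain ⟨hF1, -, C, c, hC, hc, hb⟩ := hF
  have hf : ∀ I, ContDiff ℝ 1 (fun z : Spc => F z.1 z.2 I) := fun I => (contDiff_pi.1 hF1) I
  choose K1 hK1 hK using fun I => prof_bounds (hf I) R₁
  set S := √(1 + R₁ ^ 2) with hS
  have hS0 : 0 ≤ S := Real.sqrt_nonneg _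
  set K2 := ∑ I, K1 I with hK2
  have hK2I : ∀ I, K1 I ≤ K2 := fun I =>
    Finset.single_le_sum (f := K1) (fun I _ => hK1 I) (Finset.mem_univ I)
  have hK20 : 0 ≤ K2 := Finset.sum_nonneg fun I _ => hK1 I
  refine ⟨4 * K2 + 2 * (C * S), max (2 * c) (2 * |R₁| + 2), by positivity, le_max_right _ _, ?_⟩
  intro p hp hr I
  have ht1 : 2 * c ≤ p.1 := (le_max_left _ _).trans hp
  have ht2 : 2 * |R₁| + 2 ≤ p.1 := (le_max_right _ _).trans hp
  have hRa := abs_nonneg R₁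
  have ht : 0 < p.1 := by linarith
  have hr2 := (abs_le.1 hr).1
  have hR1 := le_abs_self R₁
  have hrt : p.1 / 2 < rr p := by linarith
  have hr1 : 1 ≤ ‖p.2‖ := by change 1 ≤ rr p; linarith
  have hr0 : 0 < ‖p.2‖ := by linarith
  have hb1 := hb p (by linarith) hrt
  have hsq : √(1 + (rr p - p.1) ^ 2) ≤ S := by
    apply Real.sqrt_le_sqrt
    have := sq_abs (rr p - p.1)
    have h2 := abs_nonneg (rr p - p.1)
    nlinarith
  set τ := p.1⁻¹ with hτ
  have hτ0 : 0 < τ := inv_pos.2 ht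
  have hτ1 : τ ≤ 1 := inv_le_one_of_one_le₀ (by linarith)
  have hZ : Z1sum (radProfile u F I) p ≤ C * S * τ ^ 2 := by
    have h1 := Finset.single_le_sum (f := fun I => Z1sum (radProfile u F I) p)
      (fun I _ => (Z1_facts _ p).2.2.2) (Finset.mem_univ I)
    refine (h1.trans hb1).trans ?_
    calc C * (p.1 ^ 2)⁻¹ * √(1 + (rr p - p.1) ^ 2) ≤ C * (p.1 ^ 2)⁻¹ * S := by gcongr
      _ = _ := by rw [hτ, inv_pow]; ring
  obtain ⟨z1, z2, z3, z4⟩ := Z1_facts (radProfile u F I) p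
  have hρ : ‖p.2‖⁻¹ ≤ 2 * τ := by
    rw [hτ, inv_le_iff_one_le_mul₀ hr0]
    have : 2 * p.1⁻¹ * ‖p.2‖ = ‖p.2‖ / (p.1 / 2) := by field_simp
    rw [this, le_div_iff₀ (by linarith)]
    have : p.1 / 2 < ‖p.2‖ := hrt
    linarith
  set f : Spc → ℝ := fun z : Spc => F z.1 z.2 I with hfd
  obtain ⟨k1, k2, k3⟩ := hK I p hr1 hr
  have hPp := hasPD_prof (hf I) hr0
  have hdp : DifferentiableAt ℝ (prof f) p := hPp.1
  have hdu : DifferentiableAt ℝ (u I) p := (hu I).differentiable (by simp) p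
  have hdr : DifferentiableAt ℝ (radProfile u F I) p := hdu.sub hdp
  have hu2 : HasPD (u I) (fun α => pd α (radProfile u F I) p + pd α (prof f) p) p := by
    refine ((hasPD_of_diff hdr).add (hasPD_of_diff hdp)).congr_f (Eventually.of_forall fun y => ?_)
    change u I y = (u I y - prof f y) + prof f y
    ring
  have hval : u I p = radProfile u F I p + prof f p := by
    change u I p = (u I p - prof f p) + prof f p
    ring
  have hKI := hK2I I
  have hKIn := hK1 I
  have hin : 0 ≤ ‖p.2‖⁻¹ := by positivity
  have e1 : K1 I * ‖p.2‖⁻¹ ≤ 2 * K2 * τ := by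
    calc K1 I * ‖p.2‖⁻¹ ≤ K2 * (2 * τ) := by gcongr
      _ = _ := by ring
  have e2 : K1 I * ‖p.2‖⁻¹ ^ 2 ≤ 4 * K2 * τ ^ 2 := by
    calc K1 I * ‖p.2‖⁻¹ ^ 2 ≤ K2 * (2 * τ) ^ 2 := by gcongr
      _ = _ := by ring
  have hCS : 0 ≤ C * S := by positivity
  have e3 : C * S * τ ^ 2 ≤ C * S * τ := by
    have : τ ^ 2 ≤ τ := by nlinarith
    gcongr
  have e4 : 0 ≤ C * S * τ := by positivity
  have e5 : 0 ≤ K2 * τ := by positivity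
  have e6 : 0 ≤ C * S * τ ^ 2 := by positivity
  have e7 : 0 ≤ K2 * τ ^ 2 := by positivity
  refine ⟨hdr, by linarith, fun α => by linarith [z2 α], by linarith, ?_, fun α => ?_, fun i => ?_⟩
  · rw [hval]
    refine (abs_add_le _ _).trans ?_
    linarith
  · rw [hu2.2 α]
    refine (abs_add_le _ _).trans ?_
    linarith [z2 α, k2 α]
  · have e : Tg i (u I) p = pd i.succ (radProfile u F I) p
        + p.2 i / ‖p.2‖ * pd 0 (radProfile u F I) p + Tg i (prof f) p := by
      rw [Tg, Tg, hu2.2, hu2.2]; ring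
    rw [e]
    refine (abs_add_three _ _ _).trans ?_
    rw [abs_mul]
    have o1 := abs_om_le p i
    have : |p.2 i / ‖p.2‖| * |pd 0 (radProfile u F I) p| ≤ 1 * |pd 0 (radProfile u F I) p| := by gcongr
    linarith [z2 i.succ, z2 0, k3 i]

end

section
lemma pd_sub {f g : Spc → ℝ} (hf : ContDiff ℝ (⊤ : ℕ∞) f) (hg : ContDiff ℝ (⊤ : ℕ∞) g) (α : Fin 4)
    (p : Spc) : pd α (fun x => f x - g x) p = pd α f p - pd α g p :=
  ((hasPD_of_smooth hf.contDiffAt).sub (hasPD_of_smooth hg.contDiffAt)).2 α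

lemma box_sub {f g : Spc → ℝ} (hf : ContDiff ℝ (⊤ : ℕ∞) f) (hg : ContDiff ℝ (⊤ : ℕ∞) g)
    (p : Spc) : box (fun x => f x - g x) p = box f p - box g p := by
  rw [box_eq, box_eq, box_eq, ← Finset.sum_sub_distrib]
  refine Finset.sum_congr rfl fun α _ => ?_
  have : pd α (fun x => f x - g x) = fun x => pd α f x - pd α g x := by
    funext x; exact pd_sub hf hg α x
  rw [this, pd_sub (contDiff_pd hf α) (contDiff_pd hg α)]; ring

/-- the jet of `u` -/
def zof {N : ℕ} (u : Fin N → Spc → ℝ) (p : Spc) : (Fin N → ℝ) × (Fin N → Fin 4 → ℝ) :=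
  (fun J => u J p, fun J α => pd α (u J) p)

lemma zof_norm_le {N : ℕ} {u : Fin N → Spc → ℝ} {p : Spc} {B : ℝ} (hB : 0 ≤ B)
    (h1 : ∀ J, |u J p| ≤ B) (h2 : ∀ J α, |pd α (u J) p| ≤ B) : ‖zof u p‖ ≤ B := by
  rw [Prod.norm_def]
  refine max_le ?_ ?_
  · exact (pi_norm_le_iff_of_nonneg hB).2 fun J => h1 J
  · exact (pi_norm_le_iff_of_nonneg hB).2 fun J => (pi_norm_le_iff_of_nonneg hB).2 fun α => h2 J α

lemma sz_comp {N : ℕ} (W : Fin N → Spc → ℝ) (p : Spc) (J : Fin N) :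
    |W J p| ≤ sz W p ∧ ∀ α, |pd α (W J) p| ≤ sz W p := by
  have h1 := Finset.single_le_sum (f := fun J => |W J p| + ∑ α, |pd α (W J) p|)
    (fun J _ => add_nonneg (abs_nonneg _) (Finset.sum_nonneg fun _ _ => abs_nonneg _))
    (Finset.mem_univ J)
  have h2 : ∀ α, |pd α (W J) p| ≤ ∑ α, |pd α (W J) p| := fun α =>
    Finset.single_le_sum (f := fun α => |pd α (W J) p|) (fun _ _ => abs_nonneg _) (Finset.mem_univ α)
  have h3 : 0 ≤ ∑ α, |pd α (W J) p| := Finset.sum_nonneg fun _ _ => abs_nonneg _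
  have h4 := abs_nonneg (W J p)
  unfold sz
  refine ⟨?_, fun α => ?_⟩
  · linarith
  · have := h2 α
    linarith

lemma bdd_cont {f : Spc → ℝ} (hf : Continuous f) (M : ℝ) : ∃ C : ℝ, 0 ≤ C ∧ ∀ p, ‖p‖ ≤ M → |f p| ≤ C := by
  obtain ⟨C, hC⟩ := (isCompact_closedBall (0 : Spc) M).exists_bound_of_continuousOn hf.continuousOn
  exact ⟨|C|, abs_nonneg _, fun p hp => (hC p (by simpa using hp)).trans (le_abs_self _)⟩

section
variable {N : ℕ} {Q : ((Fin N → ℝ) × (Fin N → Fin 4 → ℝ)) → Fin N → ℝ}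
    {u v : Fin N → Spc → ℝ}

lemma jet_bdd (hu : ∀ I, ContDiff ℝ (⊤ : ℕ∞) (u I)) (M : ℝ) :
    ∃ B : ℝ, 0 ≤ B ∧ ∀ p, ‖p‖ ≤ M → sz u p ≤ B := by
  have hc : Continuous (sz u) := continuous_finsetSum _ fun J _ => ((hu J).continuous.abs).add
    (continuous_finsetSum _ fun α _ => (contDiff_pd (hu J) α).continuous.abs)
  obtain ⟨B, hB, h⟩ := bdd_cont hc M
  exact ⟨B, hB, fun p hp => (le_abs_self _).trans (h p hp)⟩

lemma lip_box (hQ : ContDiff ℝ (⊤ : ℕ∞) Q)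
    (hu : IsGlobalSolution Q u) (hv : IsGlobalSolution Q v) (M : ℝ) :
    ∃ C : ℝ, 0 ≤ C ∧ ∀ p : Spc, 0 ≤ p.1 → ‖p‖ ≤ M → ∀ I,
      |box (fun x => u I x - v I x) p| ≤ C * sz (fun I x => u I x - v I x) p := by
  obtain ⟨hus, -, -, hue⟩ := hu
  obtain ⟨hvs, -, -, hve⟩ := hv
  obtain ⟨B1, hB1, h1⟩ := jet_bdd hus M
  obtain ⟨B2, hB2, h2⟩ := jet_bdd hvs M
  obtain ⟨C, hC, hL⟩ := lip_ball (hQ.of_le (by simp)) (B1 + B2)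
  refine ⟨C, hC, fun p hp hpM I => ?_⟩
  have n1 : ‖zof u p‖ ≤ B1 + B2 := zof_norm_le (by positivity)
    (fun J => by linarith [(sz_comp u p J).1, h1 p hpM])
    (fun J α => by linarith [(sz_comp u p J).2 α, h1 p hpM])
  have n2 : ‖zof v p‖ ≤ B1 + B2 := zof_norm_le (by positivity)
    (fun J => by linarith [(sz_comp v p J).1, h2 p hpM])
    (fun J α => by linarith [(sz_comp v p J).2 α, h2 p hpM])
  have e : zof u p - zof v p = zof (fun I x => u I x - v I x) p := by
    ext J
    · rfl
    · change pd _ (u J) p - pd _ (v J) p = pd _ (fun x => u J x - v J x) p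
      rw [pd_sub (hus J) (hvs J)]
  rw [box_sub (hus I) (hvs I), hue p hp I, hve p hp I]
  change |Q (zof u p) I - Q (zof v p) I| ≤ _
  have hl := hL _ _ n2 n1
  have h3 := norm_le_pi_norm (Q (zof u p) - Q (zof v p)) I
  rw [Pi.sub_apply, Real.norm_eq_abs] at h3
  refine (h3.trans hl).trans ?_
  gcongr
  rw [e]
  exact zof_norm_le (sz_nonneg _ _) (fun J => (sz_comp (fun I x => u I x - v I x) p J).1)
    (fun J => (sz_comp (fun I x => u I x - v I x) p J).2)

lemma Sp_eq (R₁ : ℝ) (g : Spc → ℝ) (Y : Spc) : Sp R₁ g Y = Sc g Y - R₁ * pd 0 g Y := by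
  unfold Sp Sc dt dxi
  rw [Fin.sum_univ_succ]
  have h : ∀ i : Fin 3, co i.succ (Y - Vp R₁) = Y.2 i := fun i => by
    rw [co_sub, co_succ, co_succ]; simp [Vp]
  simp only [h]
  rw [co_sub, co_zero, co_zero]
  simp only [Vp]; ring

lemma fq_pos_iff {R₁ : ℝ} {Y : Spc} : 0 < fq 1 R₁ Y ↔ |Y.1 - R₁| < ‖Y.2‖ := by
  rw [fq_norm, ← sq_lt_sq₀ (abs_nonneg _) (norm_nonneg _), sq_abs]
  constructor <;> intro h <;> linarith

set_option maxHeartbeats 400000 in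
/-- bounds for large times -/
lemma w_large {A : Fin N → Fin N → Fin N → Fin 4 → Fin 4 → ℝ} (hQ : HasNullForm Q A)
    (hu : IsGlobalSolution Q u) (hv : IsGlobalSolution Q v)
    {F F' : ℝ → EuclideanSpace ℝ (Fin 3) → Fin N → ℝ}
    (hF : IsRadiationField u F) (hF' : IsRadiationField v F')
    {R₁ R₂ : ℝ} (hR₁ : 0 < R₁) (hR₂ : R₂ ≤ -R₁)
    (hrad : ∀ (q : ℝ) (ω : EuclideanSpace ℝ (Fin 3)), ‖ω‖ = 1 → R₂ < q → F q ω = F' q ω) :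
    ∃ C T : ℝ, 0 ≤ C ∧ 1 ≤ T ∧ ∀ Y : Spc, 0 < fq 1 R₁ Y → ‖Y.2‖ ≤ Y.1 + R₁ → T ≤ Y.1 → ∀ I,
      |u I Y - v I Y| ≤ C * Y.1⁻¹ ^ 2 ∧ |Sp R₁ (fun x => u I x - v I x) Y| ≤ C * Y.1⁻¹ ^ 2 ∧
      (∀ α, |pd α (fun x => u I x - v I x) Y| ≤ C * Y.1⁻¹ ^ 2) ∧
      |box (fun x => u I x - v I x) Y| ≤ C * (Y.1⁻¹ ^ 2 * sz (fun I x => u I x - v I x) Y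
        + Y.1⁻¹ * ∑ J, ∑ i, |Tg i (fun x => u J x - v J x) Y|) := by
  have hus := hu.1
  have hvs := hv.1
  obtain ⟨K1, T1, hK1, hT1, hb1⟩ := rad_bounds hus hF R₁
  obtain ⟨K2, T2, hK2, hT2, hb2⟩ := rad_bounds hvs hF' R₁
  obtain ⟨Cq, δ, hCq, hδ, hq⟩ := qdiff hQ (L := 3 * (K1 + K2)) (by positivity)
  have hRa := abs_nonneg R₁
  refine ⟨(1 + R₁) * (K1 + K2) + Cq, max (max T1 T2) δ⁻¹, by positivity,
    le_max_of_le_left (le_max_of_le_left (by linarith)), ?_⟩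
  intro Y hY hYr hT I
  rw [fq_pos_iff] at hY
  have hT1' : T1 ≤ Y.1 := ((le_max_left _ _).trans (le_max_left _ _)).trans hT
  have hT2' : T2 ≤ Y.1 := ((le_max_right _ _).trans (le_max_left _ _)).trans hT
  have hTd : δ⁻¹ ≤ Y.1 := (le_max_right _ _).trans hT
  have ht : 0 < Y.1 := by linarith
  have hlow : -R₁ < rr Y - Y.1 := by
    have := le_abs_self (Y.1 - R₁); change -R₁ < ‖Y.2‖ - Y.1; linarith
  have hrt : |rr Y - Y.1| ≤ R₁ := abs_le.2 ⟨hlow.le, by change ‖Y.2‖ - Y.1 ≤ R₁; linarith⟩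
  have hr0 : 0 < ‖Y.2‖ := (abs_nonneg _).trans_lt hY
  set τ := Y.1⁻¹ with hτ
  have hτ0 : 0 < τ := inv_pos.2 ht
  have hτδ : τ ≤ δ := inv_le_of_inv_le₀ hδ hTd
  have B1 := hb1 Y hT1' hrt
  have B2 := hb2 Y hT2' hrt
  -- local representation
  have hloc : ∀ J, (fun x => u J x - v J x) =ᶠ[𝓝 Y]
      fun x => radProfile u F J x - radProfile v F' J x := by
    intro J
    have hcr : Continuous (rr : Spc → ℝ) := by unfold rr; fun_prop
    have h1 : ∀ᶠ x : Spc in 𝓝 Y, -R₁ < rr x - x.1 :=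
      continuousAt_const.eventually_lt (hcr.sub continuous_fst).continuousAt hlow
    have h2 : ∀ᶠ x : Spc in 𝓝 Y, 0 < rr x :=
      continuousAt_const.eventually_lt hcr.continuousAt hr0
    filter_upwards [h1, h2] with x hx1 hx2
    have : F (rr x - x.1) ((rr x)⁻¹ • x.2) = F' (rr x - x.1) ((rr x)⁻¹ • x.2) := by
      refine hrad _ _ ?_ (by linarith)
      have h3 : ‖x.2‖ = rr x := rfl
      rw [norm_smul, h3, Real.norm_eq_abs, abs_of_pos (inv_pos.2 hx2), inv_mul_cancel₀ hx2.ne']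
    simp only [radProfile, this]; ring
  have hpd : ∀ J α, pd α (fun x => u J x - v J x) Y
      = pd α (radProfile u F J) Y - pd α (radProfile v F' J) Y := by
    intro J α
    rw [pd_congr (hloc J) α]
    exact ((hasPD_of_diff (B1 J).1).sub (hasPD_of_diff (B2 J).1)).2 α
  obtain ⟨-, a2, a3, a4, -⟩ := B1 I
  obtain ⟨-, b2, b3, b4, -⟩ := B2 I
  have hKτ : 0 ≤ (K1 + K2) * τ ^ 2 := by positivity
  have hCτ : 0 ≤ Cq * τ ^ 2 := by positivity
  have hRKτ : 0 ≤ R₁ * ((K1 + K2) * τ ^ 2) := by positivity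
  have P : ∀ α, |pd α (fun x => u I x - v I x) Y| ≤ (K1 + K2) * τ ^ 2 := fun α => by
    rw [hpd]; refine (abs_sub _ _).trans ?_; linarith [a3 α, b3 α]
  have eC : ((1 + R₁) * (K1 + K2) + Cq) * τ ^ 2 =
    (K1 + K2) * τ ^ 2 + R₁ * ((K1 + K2) * τ ^ 2) + Cq * τ ^ 2 := by ring
  refine ⟨?_, ?_, fun α => ?_, ?_⟩
  · have := (hloc I).eq_of_nhds
    rw [this, eC]
    refine (abs_sub _ _).trans ?_; linarith
  · have hSc : Sc (fun x => u I x - v I x) Y = Sc (radProfile u F I) Y - Sc (radProfile v F' I) Y := by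
      unfold Sc dt dxi
      simp only [hpd, mul_sub, Finset.sum_sub_distrib]; ring
    rw [Sp_eq, hSc, eC]
    refine (abs_sub _ _).trans ?_
    have h1 := abs_sub (Sc (radProfile u F I) Y) (Sc (radProfile v F' I) Y)
    rw [abs_mul, abs_of_pos hR₁]
    have h2 : R₁ * |pd 0 (fun x => u I x - v I x) Y| ≤ R₁ * ((K1 + K2) * τ ^ 2) := by
      gcongr; exact P 0
    linarith
  · rw [eC]; linarith [P α]
  · rw [box_sub (hus I) (hvs I), hu.2.2.2 Y ht.le I, hv.2.2.2 Y ht.le I]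
    set ω : EuclideanSpace ℝ (Fin 3) := ‖Y.2‖⁻¹ • Y.2 with hω
    have hω1 : ‖ω‖ = 1 := by
      rw [hω, norm_smul, norm_inv, norm_norm, inv_mul_cancel₀ hr0.ne']
    have hωi : ∀ i, ω i = Y.2 i / ‖Y.2‖ := fun i => by
      rw [hω, PiLp.smul_apply, smul_eq_mul, div_eq_inv_mul]
    have htg : ∀ g : Spc → ℝ, tgf ω (fun α => pd α g Y) = ∑ i, |Tg i g Y| := fun g => by
      unfold tgf Tg; simp only [hωi]
    have hKn : 0 ≤ (K1 + K2) * τ := by positivity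
    have hk1 : 0 ≤ K1 * τ := by positivity
    have hk2 : 0 ≤ K2 * τ := by positivity
    have hk3 : 0 ≤ K1 * τ ^ 2 := by positivity
    have hk4 : 0 ≤ K2 * τ ^ 2 := by positivity
    have hQd := hq τ hτ0.le hτδ ω hω1 (zof u Y) (zof v Y)
      (zof_norm_le (by positivity)
        (fun J => by obtain ⟨-, -, -, -, c5, c6, c7⟩ := B1 J; linarith)
        (fun J α => by obtain ⟨-, -, -, -, c5, c6, c7⟩ := B1 J; linarith [c6 α]))
      (zof_norm_le (by positivity)
        (fun J => by obtain ⟨-, -, -, -, c5, c6, c7⟩ := B2 J; linarith)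
        (fun J α => by obtain ⟨-, -, -, -, c5, c6, c7⟩ := B2 J; linarith [c6 α]))
      (fun J => by
        obtain ⟨-, -, -, -, c5, c6, c7⟩ := B1 J
        change tgf ω (fun α => pd α (u J) Y) ≤ _
        rw [htg, Fin.sum_univ_three]; linarith [c7 0, c7 1, c7 2])
      (fun J => by
        obtain ⟨-, -, -, -, c5, c6, c7⟩ := B2 J
        change tgf ω (fun α => pd α (v J) Y) ≤ _
        rw [htg, Fin.sum_univ_three]; linarith [c7 0, c7 1, c7 2]) I
    have es : ∑ J, (|(zof u Y).1 J - (zof v Y).1 J| + ∑ α, |(zof u Y).2 J α - (zof v Y).2 J α|)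
        = sz (fun I x => u I x - v I x) Y := by
      unfold sz zof; simp only [pd_sub (hus _) (hvs _)]
    have et : ∑ J, tgf ω (fun α => (zof u Y).2 J α - (zof v Y).2 J α)
        = ∑ J, ∑ i, |Tg i (fun x => u J x - v J x) Y| := by
      refine Finset.sum_congr rfl fun J _ => ?_
      rw [← htg]; unfold zof; simp only [pd_sub (hus _) (hvs _)]
    rw [es, et] at hQd
    refine hQd.trans ?_
    have hs0 := sz_nonneg (fun I x => u I x - v I x) Y
    have ht0 : 0 ≤ ∑ J, ∑ i, |Tg i (fun x => u J x - v J x) Y| :=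
      Finset.sum_nonneg fun _ _ => Finset.sum_nonneg fun _ _ => abs_nonneg _
    gcongr
    have : 0 ≤ (1 + R₁) * (K1 + K2) := by positivity
    linarith

end

end

section
lemma w_bounds {N : ℕ} {Q : ((Fin N → ℝ) × (Fin N → Fin 4 → ℝ)) → Fin N → ℝ}
    {u v : Fin N → Spc → ℝ} {A : Fin N → Fin N → Fin N → Fin 4 → Fin 4 → ℝ} (hQ : HasNullForm Q A)
    (hu : IsGlobalSolution Q u) (hv : IsGlobalSolution Q v)
    {F F' : ℝ → EuclideanSpace ℝ (Fin 3) → Fin N → ℝ}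
    (hF : IsRadiationField u F) (hF' : IsRadiationField v F')
    {R₁ R₂ : ℝ} (hR₁ : 0 < R₁) (hR₂ : R₂ ≤ -R₁)
    (hrad : ∀ (q : ℝ) (ω : EuclideanSpace ℝ (Fin 3)), ‖ω‖ = 1 → R₂ < q → F q ω = F' q ω)
    {w : Fin N → Spc → ℝ} (hw : w = fun I x => u I x - v I x) :
    ∃ C : ℝ, 0 ≤ C ∧ ∀ Y : Spc, 0 < fq 1 R₁ Y → ‖Y.2‖ ≤ Y.1 + R₁ → 0 < Y.1 → ∀ I,
      |w I Y| ≤ C * (1 + Y.1)⁻¹ ^ 2 ∧ |Sp R₁ (w I) Y| ≤ C * (1 + Y.1)⁻¹ ^ 2 ∧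
      (∀ α, |pd α (w I) Y| ≤ C * (1 + Y.1)⁻¹ ^ 2) ∧
      |box (w I) Y| ≤ C * ((1 + Y.1)⁻¹ ^ 2 * sz w Y
        + (1 + Y.1)⁻¹ * ∑ J, ∑ i, |Tg i (w J) Y|) := by
  obtain ⟨C1, T, hC1, hT, hL⟩ := w_large hQ hu hv hF hF' hR₁ hR₂ hrad
  obtain ⟨C2, hC2, hB⟩ := lip_box hQ.1 hu hv (T + R₁)
  have hws : ∀ I, ContDiff ℝ (⊤ : ℕ∞) (w I) := fun I => by
    rw [hw]; exact (hu.1 I).sub (hv.1 I)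
  have hw' : ∀ I, w I = fun x => u I x - v I x := fun I => by rw [hw]
  obtain ⟨C3, hC3, hB3⟩ := jet_bdd hws (T + R₁)
  have hSc : ∀ I, Continuous (Sp R₁ (w I)) := fun I => by
    unfold Sp
    exact continuous_finsetSum _ fun α _ =>
      ((continuous_co α).comp (continuous_id.sub continuous_const)).mul
        (contDiff_pd (hws I) α).continuous
  obtain ⟨C4, hC4, hB4⟩ := bdd_cont (f := fun p => ∑ I, |Sp R₁ (w I) p|)
    (continuous_finsetSum _ fun I _ => (hSc I).abs) (T + R₁)
  have hT2 : 0 ≤ (1 + T) ^ 2 * (C2 + C3 + C4) := by positivity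
  refine ⟨4 * C1 + (1 + T) ^ 2 * (C2 + C3 + C4), by positivity, fun Y hY hYr ht I => ?_⟩
  have hs0 := sz_nonneg w Y
  have ht0 : 0 ≤ ∑ J, ∑ i, |Tg i (w J) Y| :=
    Finset.sum_nonneg fun _ _ => Finset.sum_nonneg fun _ _ => abs_nonneg _
  set σ := (1 + Y.1)⁻¹ with hσ
  have hσ0 : 0 < σ := by positivity
  rcases le_total T Y.1 with h | h
  · obtain ⟨l1, l2, l3, l4⟩ := hL Y hY hYr h I
    rw [← hw] at l4
    simp only [← hw'] at l2 l3 l4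
    have l1' : |w I Y| ≤ C1 * Y.1⁻¹ ^ 2 := by rw [hw']; exact l1
    have hτσ : Y.1⁻¹ ≤ 2 * σ := by
      rw [hσ, inv_le_iff_one_le_mul₀ ht]
      have : 2 * (1 + Y.1)⁻¹ * Y.1 = 2 * Y.1 / (1 + Y.1) := by field_simp
      rw [this, le_div_iff₀ (by linarith)]; linarith
    have hτ0 : 0 < Y.1⁻¹ := inv_pos.2 ht
    have hτ2 : Y.1⁻¹ ^ 2 ≤ 4 * σ ^ 2 := by
      calc Y.1⁻¹ ^ 2 ≤ (2 * σ) ^ 2 := by gcongr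
        _ = _ := by ring
    have up : ∀ a, a ≤ C1 * Y.1⁻¹ ^ 2 → a ≤ (4 * C1 + (1 + T) ^ 2 * (C2 + C3 + C4)) * σ ^ 2 := by
      intro a ha
      have h1 : C1 * Y.1⁻¹ ^ 2 ≤ C1 * (4 * σ ^ 2) := by gcongr
      have h2 : 0 ≤ (1 + T) ^ 2 * (C2 + C3 + C4) * σ ^ 2 := by positivity
      linarith
    refine ⟨up _ l1', up _ l2, fun α => up _ (l3 α), ?_⟩
    refine l4.trans ?_
    have h1 : Y.1⁻¹ ^ 2 * sz w Y ≤ 4 * (σ ^ 2 * sz w Y) := by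
      calc Y.1⁻¹ ^ 2 * sz w Y ≤ 4 * σ ^ 2 * sz w Y := by gcongr
        _ = _ := by ring
    have h2 : Y.1⁻¹ * (∑ J, ∑ i, |Tg i (w J) Y|) ≤ 2 * (σ * ∑ J, ∑ i, |Tg i (w J) Y|) := by
      calc Y.1⁻¹ * (∑ J, ∑ i, |Tg i (w J) Y|) ≤ 2 * σ * ∑ J, ∑ i, |Tg i (w J) Y| := by gcongr
        _ = _ := by ring
    have p1 : 0 ≤ σ ^ 2 * sz w Y := by positivity
    have p2 : 0 ≤ σ * ∑ J, ∑ i, |Tg i (w J) Y| := by positivity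
    generalize σ ^ 2 * sz w Y = a at *
    generalize σ * ∑ J, ∑ i, |Tg i (w J) Y| = b at *
    calc _ ≤ C1 * (4 * (a + b)) := by gcongr; linarith
      _ = 4 * C1 * (a + b) := by ring
      _ ≤ _ := by gcongr; linarith
  · have hYM : ‖Y‖ ≤ T + R₁ := by
      rw [Prod.norm_def]
      refine max_le ?_ (by linarith)
      rw [Real.norm_eq_abs, abs_of_pos ht]; linarith
    have hσT : 1 ≤ (1 + T) ^ 2 * σ ^ 2 := by
      rw [← mul_pow]
      apply one_le_pow₀
      rw [hσ, ← div_eq_mul_inv, le_div_iff₀ (by linarith)]; linarith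
    have b3 := hB3 Y hYM
    have b4 := (le_abs_self _).trans (hB4 Y hYM)
    have b2 := hB Y ht.le hYM I
    rw [← hw, ← hw'] at b2
    have up : ∀ a, a ≤ C2 + C3 + C4 → a ≤ (4 * C1 + (1 + T) ^ 2 * (C2 + C3 + C4)) * σ ^ 2 := by
      intro a ha
      have h1 : (C2 + C3 + C4) * 1 ≤ (C2 + C3 + C4) * ((1 + T) ^ 2 * σ ^ 2) := by gcongr
      have h2 : 0 ≤ 4 * C1 * σ ^ 2 := by positivity
      linarith
    obtain ⟨c1, c2⟩ := sz_comp w Y I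
    refine ⟨up _ (by linarith), up _ ?_, fun α => up _ (by linarith [c2 α]), ?_⟩
    · have := Finset.single_le_sum (f := fun I => |Sp R₁ (w I) Y|)
        (fun _ _ => abs_nonneg _) (Finset.mem_univ I)
      linarith
    · have h1 := up C2 (by linarith)
      have h2 : C2 * sz w Y ≤ (4 * C1 + (1 + T) ^ 2 * (C2 + C3 + C4)) * σ ^ 2 * sz w Y := by gcongr
      have p2 : 0 ≤ (4 * C1 + (1 + T) ^ 2 * (C2 + C3 + C4)) * (σ * ∑ J, ∑ i, |Tg i (w J) Y|) := by
        positivity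
      rw [mul_add]
      linarith

/-- finite speed of propagation outside the light cone -/
lemma ext_zero {N : ℕ} {Q : ((Fin N → ℝ) × (Fin N → Fin 4 → ℝ)) → Fin N → ℝ}
    {u v : Fin N → Spc → ℝ} (hQ : ContDiff ℝ (⊤ : ℕ∞) Q)
    (hu : IsGlobalSolution Q u) (hv : IsGlobalSolution Q v) {R₁ : ℝ} (hR₁ : 0 < R₁)
    (hdata : ∀ x : EuclideanSpace ℝ (Fin 3), R₁ ≤ ‖x‖ → ∀ I,
      u I (0, x) = v I (0, x) ∧ dt (u I) (0, x) = dt (v I) (0, x)) :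
    ∀ I (p : Spc), 0 ≤ p.1 → p.1 + R₁ ≤ ‖p.2‖ → u I p - v I p = 0 := by
  have hws : ∀ I, ContDiff ℝ (⊤ : ℕ∞) (fun x => u I x - v I x) := fun I => (hu.1 I).sub (hv.1 I)
  have strict : ∀ I (p : Spc), 0 ≤ p.1 → p.1 + R₁ < ‖p.2‖ → u I p - v I p = 0 := by
    intro I p hp hlt
    set ρ := ‖p.2‖ - R₁ with hρ
    obtain ⟨C, hC, hB⟩ := lip_box hQ hu hv (‖p.2‖ + ρ)
    refine energy (W := fun I x => u I x - v I x) hws (ς := 1) (ρ := ρ) (C := C) (P := (0, p.2))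
      (by simp) hC ?_ ?_ p (by simpa using hp) (by simp; linarith) I
    · intro x hx J
      have hx' : R₁ ≤ ‖x‖ := by
        have h1 := norm_sub_norm_le p.2 x
        have h2 := norm_sub_rev p.2 x
        simp only at hx
        linarith
      obtain ⟨d1, d2⟩ := hdata x hx' J
      refine ⟨by simp [d1], ?_⟩
      change pd 0 (fun x => u J x - v J x) (0, x) = 0
      rw [pd_sub (hu.1 J) (hv.1 J)]
      exact sub_eq_zero.2 d2
    · intro q hq1 hq2 J
      simp only [sub_zero, one_mul] at hq1 hq2
      refine hB q hq1 ?_ J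
      have h0 := norm_nonneg (q.2 - p.2)
      have h1 := norm_sub_norm_le q.2 p.2
      have h2 := norm_nonneg p.2
      rw [Prod.norm_def]
      refine max_le ?_ (by linarith)
      rw [Real.norm_eq_abs, abs_of_nonneg hq1]; linarith
  intro I p hp hle
  have hcont : Continuous fun s : ℝ => u I (p.1, s • p.2) - v I (p.1, s • p.2) :=
    (hws I).continuous.comp (continuous_const.prodMk (continuous_id.smul continuous_const))
  have hlim := (hcont.tendsto 1).mono_left (nhdsWithin_le_nhds (s := Ioi 1))
  have hz : ∀ᶠ s : ℝ in 𝓝[>] 1, u I (p.1, s • p.2) - v I (p.1, s • p.2) = 0 := by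
    filter_upwards [self_mem_nhdsWithin] with s hs
    refine strict I (p.1, s • p.2) hp ?_
    have hs' : 1 < s := hs
    change p.1 + R₁ < ‖s • p.2‖
    rw [norm_smul, Real.norm_eq_abs, abs_of_pos (by linarith)]
    have : 0 < ‖p.2‖ := by linarith
    nlinarith
  have h2 := tendsto_nhds_unique hlim (tendsto_const_nhds.congr' (hz.mono fun s hs => hs.symm))
  simpa using h2

end

section
lemma main_thm {N : ℕ} {Q : ((Fin N → ℝ) × (Fin N → Fin 4 → ℝ)) → Fin N → ℝ}
    {A : Fin N → Fin N → Fin N → Fin 4 → Fin 4 → ℝ}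
    (hQ : HasNullForm Q A)
    {u v : Fin N → Spc → ℝ}
    (hu : IsGlobalSolution Q u) (hv : IsGlobalSolution Q v)
    {F F' : ℝ → EuclideanSpace ℝ (Fin 3) → Fin N → ℝ}
    (hF : IsRadiationField u F) (hF' : IsRadiationField v F')
    {R₁ R₂ : ℝ} (hR₁ : 0 < R₁) (hR₂ : R₂ ≤ -R₁)
    (hdata : ∀ x : EuclideanSpace ℝ (Fin 3), R₁ ≤ ‖x‖ → ∀ I,
      u I (0, x) = v I (0, x) ∧ dt (u I) (0, x) = dt (v I) (0, x))
    (hrad : ∀ (q : ℝ) (ω : EuclideanSpace ℝ (Fin 3)), ‖ω‖ = 1 → R₂ < q →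
      F q ω = F' q ω) :
    ∀ p : Spc, 0 ≤ p.1 → ∀ I, u I p = v I p := by
  have hws : ∀ I, ContDiff ℝ (⊤ : ℕ∞) (fun x => u I x - v I x) := fun I => (hu.1 I).sub (hv.1 I)
  have hext := ext_zero hQ.1 hu hv hR₁ hdata
  set w : Fin N → Spc → ℝ := fun I x => u I x - v I x with hw
  set g : Fin N → Spc → ℝ := fun I Y => if 0 < Y.1 then w I Y else 0 with hg
  have hgw : ∀ Y : Spc, 0 < Y.1 → ∀ I, g I =ᶠ[𝓝 Y] w I := by
    intro Y hY I
    filter_upwards [continuous_fst.continuousAt.eventually (lt_mem_nhds hY)] with x hx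
    simp only [hg]; rw [if_pos hx]
  have hg0 : ∀ I (Y : Spc), Y.1 + R₁ ≤ ‖Y.2‖ → g I Y = 0 := by
    intro I Y hY
    simp only [hg]
    split_ifs with h
    · exact hext I Y h.le hY
    · rfl
  have hgz : ∀ I Y, 0 < fq 1 R₁ Y → g I Y = 0 := by
    refine kelvin_uniq hR₁ ?_ (fun I Y _ h => hg0 I Y h) ?_
    · intro I Y hY
      rcases lt_or_ge 0 Y.1 with h | h
      · exact (hws I).contDiffAt.congr_of_eventuallyEq (hgw Y h I)
      · have h1 : Y.1 + R₁ < ‖Y.2‖ := by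
          have h2 := fq_pos_iff.1 hY
          have h3 := neg_abs_le (Y.1 - R₁)
          linarith
        have h2 : g I =ᶠ[𝓝 Y] fun _ => (0:ℝ) := by
          have hc : Continuous fun x : Spc => ‖x.2‖ - (x.1 + R₁) := by fun_prop
          filter_upwards [hc.continuousAt.eventually (lt_mem_nhds (sub_pos.2 h1))] with x hx
          exact hg0 I x (sub_pos.1 hx).le
        exact contDiffAt_const.congr_of_eventuallyEq h2
    · obtain ⟨C, hC, hB⟩ := w_bounds hQ hu hv hF hF' hR₁ hR₂ hrad hw
      refine ⟨C, hC, fun Y hY h1 h2 I => ?_⟩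
      have e0 : ∀ J, g J Y = w J Y := fun J => (hgw Y h2 J).eq_of_nhds
      have e1 : ∀ J α, pd α (g J) Y = pd α (w J) Y := fun J α => pd_congr (hgw Y h2 J) α
      have e2 : box (g I) Y = box (w I) Y := box_congr (hgw Y h2 I)
      have e3 : sz g Y = sz w Y := by simp only [sz, e0, e1]
      have e4 : Sp R₁ (g I) Y = Sp R₁ (w I) Y := by simp only [Sp, e1]
      have e5 : ∀ i J, Tg i (g J) Y = Tg i (w J) Y := by intro i J; simp only [Tg, e1]
      simp only [e0, e1, e2, e3, e4, e5]
      exact hB Y hY h1 h2 I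
  have hsl : ∀ (x : EuclideanSpace ℝ (Fin 3)) I, x ≠ 0 → w I (R₁, x) = 0 ∧ pd 0 (w I) (R₁, x) = 0 := by
    intro x I hx
    have h0 : w I =ᶠ[𝓝 (R₁, x)] fun _ => (0:ℝ) := by
      have hc : Continuous fun y : Spc => ‖y.2‖ - |y.1 - R₁| := by fun_prop
      have hp : 0 < ‖((R₁, x) : Spc).2‖ - |((R₁, x) : Spc).1 - R₁| := by simpa using hx
      filter_upwards [hc.continuousAt.eventually (lt_mem_nhds hp), hgw (R₁, x) hR₁ I] with y hy hy2
      rw [← hy2]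
      exact hgz I y (fq_pos_iff.2 (sub_pos.1 hy))
    exact ⟨(box_zero_loc h0).1, (box_zero_loc h0).2.1 0⟩
  have hsl' : ∀ (x : EuclideanSpace ℝ (Fin 3)) I, w I (R₁, x) = 0 ∧ pd 0 (w I) (R₁, x) = 0 := by
    intro x I
    have hd : Dense ({0}ᶜ : Set (EuclideanSpace ℝ (Fin 3))) := dense_compl_singleton 0
    have c0 : Continuous fun x : EuclideanSpace ℝ (Fin 3) => w I (R₁, x) :=
      (hws I).continuous.comp (by fun_prop)
    have c1 : Continuous fun x : EuclideanSpace ℝ (Fin 3) => pd 0 (w I) (R₁, x) := by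
      have : Continuous (pd 0 (w I)) := by
        have h := (hws I).continuous_fderiv (by simp)
        exact h.clm_apply continuous_const
      exact this.comp (by fun_prop)
    have h0 := Continuous.ext_on hd c0 (continuous_const (y := (0:ℝ))) fun y hy => (hsl y I hy).1
    have h1 := Continuous.ext_on hd c1 (continuous_const (y := (0:ℝ))) fun y hy => (hsl y I hy).2
    exact ⟨congrFun h0 x, congrFun h1 x⟩
  have hpos : ∀ p : Spc, 0 < p.1 → ∀ I, w I p = 0 := by
    intro p hp
    rcases le_or_gt R₁ p.1 with h | h
    · obtain ⟨C, hC, hB⟩ := lip_box hQ.1 hu hv (‖p.2‖ + p.1 + 1)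
      refine energy (W := w) hws (ς := 1) (ρ := p.1 - R₁ + 1) (C := C) (P := (R₁, p.2))
        (by simp) hC (fun x _ J => hsl' x J) ?_ p (by simpa using h) (by simp)
      intro q hq1 hq2 J
      simp only [one_mul] at hq1 hq2
      refine hB q (by linarith) ?_ J
      have h0 := norm_nonneg (q.2 - p.2)
      have h1 := norm_sub_norm_le q.2 p.2
      have h2 := norm_nonneg p.2
      rw [Prod.norm_def]
      refine max_le ?_ (by linarith)
      rw [Real.norm_eq_abs, abs_of_nonneg (by linarith)]; linarith
    · obtain ⟨C, hC, hB⟩ := lip_box hQ.1 hu hv (‖p.2‖ + R₁)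
      refine energy (W := w) hws (ς := -1) (ρ := R₁) (C := C) (P := (R₁, p.2))
        (by simp) hC (fun x _ J => hsl' x J) ?_ p (by simp; linarith) (by simp; linarith)
      intro q hq1 hq2 J
      simp only at hq1 hq2
      have h0 := norm_nonneg (q.2 - p.2)
      have h1 := norm_sub_norm_le q.2 p.2
      have h2 := norm_nonneg p.2
      refine hB q (by linarith) ?_ J
      rw [Prod.norm_def]
      refine max_le ?_ (by linarith)
      rw [Real.norm_eq_abs, abs_of_nonneg (by linarith)]; linarith
  intro p hp I
  rw [← sub_eq_zero]
  change w I p = 0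
  have hcont : Continuous fun s : ℝ => w I (s, p.2) := (hws I).continuous.comp (by fun_prop)
  have hlim := (hcont.tendsto p.1).mono_left (nhdsWithin_le_nhds (s := Ioi p.1))
  have hz : ∀ᶠ s : ℝ in 𝓝[>] p.1, w I (s, p.2) = 0 := by
    filter_upwards [self_mem_nhdsWithin] with s hs
    exact hpos (s, p.2) (lt_of_le_of_lt hp hs) I
  exact tendsto_nhds_unique hlim (tendsto_const_nhds.congr' (hz.mono fun s hs => hs.symm))

end

/-- Theorem 1.1 (ii) of the paper: if two global solutions of a
semilinear system satisfying the null condition have equal data outside the ball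
`{|x| ≤ R₁}` and equal radiation fields for `q > R₂` with `R₂ ≤ -R₁`, then they agree
everywhere on `{t ≥ 0}`. -/
theorem stmt1 {N : ℕ}
    (Q : ((Fin N → ℝ) × (Fin N → Fin 4 → ℝ)) → Fin N → ℝ)
    (A : Fin N → Fin N → Fin N → Fin 4 → Fin 4 → ℝ)
    (hQ : HasNullForm Q A)
    (u v : Fin N → Spc → ℝ)
    (hu : IsGlobalSolution Q u) (hv : IsGlobalSolution Q v)
    (F F' : ℝ → EuclideanSpace ℝ (Fin 3) → Fin N → ℝ)
    (hF : IsRadiationField u F) (hF' : IsRadiationField v F')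
    (R₁ R₂ : ℝ) (hR₁ : 0 < R₁) (hR₂ : R₂ ≤ -R₁)
    (hdata : ∀ x : EuclideanSpace ℝ (Fin 3), R₁ ≤ ‖x‖ → ∀ I,
      u I (0, x) = v I (0, x) ∧ dt (u I) (0, x) = dt (v I) (0, x))
    (hrad : ∀ (q : ℝ) (ω : EuclideanSpace ℝ (Fin 3)), ‖ω‖ = 1 → R₂ < q →
      F q ω = F' q ω) :
    ∀ p : Spc, 0 ≤ p.1 → ∀ I, u I p = v I p := by
  exact main_thm hQ hu hv hF hF' hR₁ hR₂ hdata hrad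

end UCP
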